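/- Let n ≥ 1, let Ω ⊂ ℝ^n be open, and let f ∈ L^1_loc(Ω). Then for every family {f_ε}_{ε>0} with f_ε − f ∈ L^∞_loc(Ω) and f_ε − f → 0 in L^∞_loc(Ω) as ε → 0, one has (1/4)·|D^a f|(Ω) + (1/4)·|D^c f|(Ω) + (1/2)·|D^j f|(Ω) ≤ liminf_{ε→0} κ_ε(f_ε, Ω). -/

import Mathlib

open MeasureTheory Filter Topology Metric
open scoped ENNReal RealInnerProductSpace Classical

noncomputable section

/-- An open cube in `ℝⁿ` with side length `ε` and arbitrary orientation. -/
def IsCube (n : ℕ) (ε : ℝ) (Q : Set (EuclideanSpace ℝ (Fin n))) : Prop :=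
  ∃ (T : EuclideanSpace ℝ (Fin n) ≃ₗᵢ[ℝ] EuclideanSpace ℝ (Fin n))
    (x : EuclideanSpace ℝ (Fin n)),
    Q = (fun y => x + T y) '' {y : EuclideanSpace ℝ (Fin n) | ∀ i, |y i| < ε / 2}

/-- The BMO-type functional `κ_ε(f, Ω)`. -/
def kappa (n : ℕ) (ε : ℝ) (f : EuclideanSpace ℝ (Fin n) → ℝ)
    (Ω : Set (EuclideanSpace ℝ (Fin n))) : ℝ≥0∞ :=
  ENNReal.ofReal (ε ^ (n - 1)) *
    ⨆ (F : Set (Set (EuclideanSpace ℝ (Fin n))))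
      (_ : ∀ Q ∈ F, IsCube n ε Q ∧ Q ⊆ Ω) (_ : F.Pairwise Disjoint),
      ∑' Q : F, ENNReal.ofReal
        (⨍ x in (Q : Set (EuclideanSpace ℝ (Fin n))),
          |f x - ⨍ y in (Q : Set (EuclideanSpace ℝ (Fin n))), f y ∂volume| ∂volume)

/-- The divergence of a vector field on `ℝⁿ`. -/
def vdiv (n : ℕ) (Φ : EuclideanSpace ℝ (Fin n) → EuclideanSpace ℝ (Fin n))
    (x : EuclideanSpace ℝ (Fin n)) : ℝ :=
  ∑ i : Fin n, fderiv ℝ Φ x (EuclideanSpace.single i 1) i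

/-- The variation `Var(f, Ω)`. -/
def variation (n : ℕ) (f : EuclideanSpace ℝ (Fin n) → ℝ)
    (Ω : Set (EuclideanSpace ℝ (Fin n))) : ℝ≥0∞ :=
  ⨆ (Φ : EuclideanSpace ℝ (Fin n) → EuclideanSpace ℝ (Fin n))
    (_ : ContDiff ℝ 1 Φ) (_ : HasCompactSupport Φ) (_ : tsupport Φ ⊆ Ω)
    (_ : ∀ x, ‖Φ x‖ ≤ 1),
    ENNReal.ofReal (∫ x in Ω, f x * vdiv n Φ x)

/-- The approximate jump set `J_f`. -/
def jumpSet (n : ℕ) (f : EuclideanSpace ℝ (Fin n) → ℝ) : Set (EuclideanSpace ℝ (Fin n)) :=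
  {x | ∃ ν : EuclideanSpace ℝ (Fin n), ‖ν‖ = 1 ∧ ∃ a b : ℝ, a ≠ b ∧
    Tendsto (fun r : ℝ =>
        ⨍ y in {y ∈ ball x r | 0 < ⟪y - x, ν⟫}, |f y - a| ∂volume)
      (𝓝[>] 0) (𝓝 0) ∧
    Tendsto (fun r : ℝ =>
        ⨍ y in {y ∈ ball x r | ⟪y - x, ν⟫ < 0}, |f y - b| ∂volume)
      (𝓝[>] 0) (𝓝 0)}

/-- The approximate discontinuity set `S_f` (the set of non-Lebesgue points). -/
def approxDiscontSet (n : ℕ) (f : EuclideanSpace ℝ (Fin n) → ℝ) :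
    Set (EuclideanSpace ℝ (Fin n)) :=
  {x | ¬ ∃ c : ℝ,
    Tendsto (fun r : ℝ => ⨍ y in ball x r, |f y - c| ∂volume) (𝓝[>] 0) (𝓝 0)}

/-- `(μ, σ)` is the polar decomposition `Df = σ |Df|` of the gradient measure of `f` on `Ω`:
`μ` plays the role of the total variation measure `|Df|` and `σ` of the polar vector field. -/
def IsVariationPair (n : ℕ) (f : EuclideanSpace ℝ (Fin n) → ℝ)
    (Ω : Set (EuclideanSpace ℝ (Fin n))) (μ : Measure (EuclideanSpace ℝ (Fin n)))
    (σ : EuclideanSpace ℝ (Fin n) → EuclideanSpace ℝ (Fin n)) : Prop :=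
  IsFiniteMeasure μ ∧ μ Ωᶜ = 0 ∧ AEStronglyMeasurable σ μ ∧ (∀ᵐ x ∂μ, ‖σ x‖ = 1) ∧
  ∀ Φ : EuclideanSpace ℝ (Fin n) → EuclideanSpace ℝ (Fin n),
    ContDiff ℝ 1 Φ → HasCompactSupport Φ → tsupport Φ ⊆ Ω →
    ∫ x in Ω, f x * vdiv n Φ x = - ∫ x, ⟪Φ x, σ x⟫ ∂μ

/-- `|D^a f|(Ω)`, the total variation of the absolutely continuous part of `Df`,
with the convention that it is `∞` if `f` is not of bounded variation in `Ω`. -/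
def absVar (n : ℕ) (f : EuclideanSpace ℝ (Fin n) → ℝ)
    (Ω : Set (EuclideanSpace ℝ (Fin n))) : ℝ≥0∞ :=
  if h : ∃ p : Measure (EuclideanSpace ℝ (Fin n)) ×
      (EuclideanSpace ℝ (Fin n) → EuclideanSpace ℝ (Fin n)),
      IsVariationPair n f Ω p.1 p.2 then
    volume.withDensity ((h.choose.1).rnDeriv volume) Ω
  else ⊤

/-- `|D^c f|(Ω)`, the total variation of the Cantor part of `Df`,
with the convention that it is `∞` if `f` is not of bounded variation in `Ω`. -/
def cantorVar (n : ℕ) (f : EuclideanSpace ℝ (Fin n) → ℝ)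
    (Ω : Set (EuclideanSpace ℝ (Fin n))) : ℝ≥0∞ :=
  if h : ∃ p : Measure (EuclideanSpace ℝ (Fin n)) ×
      (EuclideanSpace ℝ (Fin n) → EuclideanSpace ℝ (Fin n)),
      IsVariationPair n f Ω p.1 p.2 then
    (h.choose.1.singularPart volume) (Ω \ approxDiscontSet n f)
  else ⊤

/-- `|D^j f|(Ω)`, the total variation of the jump part of `Df`,
with the convention that it is `∞` if `f` is not of bounded variation in `Ω`. -/
def jumpVar (n : ℕ) (f : EuclideanSpace ℝ (Fin n) → ℝ)
    (Ω : Set (EuclideanSpace ℝ (Fin n))) : ℝ≥0∞ :=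
  if h : ∃ p : Measure (EuclideanSpace ℝ (Fin n)) ×
      (EuclideanSpace ℝ (Fin n) → EuclideanSpace ℝ (Fin n)),
      IsVariationPair n f Ω p.1 p.2 then
    (h.choose.1.singularPart volume) (jumpSet n f ∩ Ω)
  else ⊤

/-- `g` is the weak (distributional) gradient of `u` on `Ω`. -/
def HasWeakGradientOn (n : ℕ) (u : EuclideanSpace ℝ (Fin n) → ℝ)
    (g : EuclideanSpace ℝ (Fin n) → EuclideanSpace ℝ (Fin n))
    (Ω : Set (EuclideanSpace ℝ (Fin n))) : Prop :=
  ∀ φ : EuclideanSpace ℝ (Fin n) → ℝ,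
    ContDiff ℝ 1 φ → HasCompactSupport φ → tsupport φ ⊆ Ω →
    ∀ k : Fin n,
      ∫ x in Ω, u x * fderiv ℝ φ x (EuclideanSpace.single k 1) =
        - ∫ x in Ω, φ x * g x k

/-- `f ∈ BV(Ω)`: `f` is integrable on `Ω` and has finite variation in `Ω`. -/
def IsBVOn (n : ℕ) (f : EuclideanSpace ℝ (Fin n) → ℝ)
    (Ω : Set (EuclideanSpace ℝ (Fin n))) : Prop :=
  IntegrableOn f Ω volume ∧ variation n f Ω < ⊤

/-- `f ∈ SBV(Ω)`: `f ∈ BV(Ω)` and the Cantor part of `Df` vanishes. -/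
def IsSBVOn (n : ℕ) (f : EuclideanSpace ℝ (Fin n) → ℝ)
    (Ω : Set (EuclideanSpace ℝ (Fin n))) : Prop :=
  IsBVOn n f Ω ∧ cantorVar n f Ω = 0

/-- Euclidean space `ℝⁿ`. -/
abbrev Euc (n : ℕ) := EuclideanSpace ℝ (Fin n)

/-- The open unit cube centred at the origin. -/
def unitCube (n : ℕ) : Set (Euc n) := {u | ∀ i, |u i| < 1 / 2}

/-- The open cube of centre `y` and side `ε` whose axes are the images of the coordinate axes
under `T`. -/
def rotCube {n : ℕ} (T : Euc n ≃ₗᵢ[ℝ] Euc n) (ε : ℝ) (y : Euc n) : Set (Euc n) :=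
  {x | ∀ i, |T.symm (x - y) i| < ε / 2}

/-- The affine map sending the unit cube to `rotCube T ε y`. -/
def cubeMap {n : ℕ} (T : Euc n ≃ₗᵢ[ℝ] Euc n) (ε : ℝ) (y u : Euc n) : Euc n := y + T (ε • u)

section Cubes

variable {n : ℕ} (T : Euc n ≃ₗᵢ[ℝ] Euc n) {ε : ℝ} (y : Euc n)

lemma isCube_rotCube : IsCube n ε (rotCube T ε y) := by
  refine ⟨T, y, ?_⟩
  ext x
  simp only [rotCube, Set.mem_ofPred_eq, Set.mem_image]
  constructor
  · intro h
    exact ⟨T.symm (x - y), h, by simp⟩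
  · rintro ⟨u, hu, rfl⟩
    simpa using hu

lemma euc_norm_le_of_coord_le {v : Euc n} {c : ℝ} (hc : ∀ i, |v i| ≤ c) : ‖v‖ ≤ n * c := by
  have h : ‖v‖ ≤ ∑ i, |v i| := by
    rw [EuclideanSpace.norm_eq]
    refine Real.sqrt_le_iff.2 ⟨Finset.sum_nonneg fun i _ => abs_nonneg _, ?_⟩
    simp only [Real.norm_eq_abs]
    exact Finset.sum_sq_le_sq_sum_of_nonneg fun i _ => abs_nonneg _
  refine h.trans ((Finset.sum_le_sum fun i _ => hc i).trans ?_)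
  simp

lemma rotCube_subset_closedBall (hε : 0 < ε) : rotCube T ε y ⊆ closedBall y (n * ε) := by
  intro x hx
  rw [mem_closedBall, dist_eq_norm, ← T.symm.norm_map]
  exact euc_norm_le_of_coord_le fun i => (hx i).le.trans (by linarith)

lemma isOpen_rotCube : IsOpen (rotCube T ε y) := by
  have : rotCube T ε y = ⋂ i, {x | |T.symm (x - y) i| < ε / 2} := by
    ext x; simp [rotCube]
  rw [this]
  exact isOpen_iInter_of_finite fun i => isOpen_lt (by fun_prop) continuous_const

lemma center_mem_rotCube (hε : 0 < ε) : y ∈ rotCube T ε y := by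
  intro i; simpa using hε

lemma isOpen_unitCube : IsOpen (unitCube n) := by
  have : unitCube n = ⋂ i, {x : Euc n | |x i| < 1 / 2} := by
    ext x; simp [unitCube]
  rw [this]
  exact isOpen_iInter_of_finite fun i => isOpen_lt (by fun_prop) continuous_const

lemma measurableSet_unitCube : MeasurableSet (unitCube n) := isOpen_unitCube.measurableSet

lemma volume_unitCube : volume (unitCube n) = 1 := by
  have h : unitCube n = (MeasurableEquiv.toLp 2 (Fin n → ℝ)).symm ⁻¹'
      (Set.univ.pi fun _ => Set.Ioo (-(1 / 2) : ℝ) (1 / 2)) := by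
    ext x; simp [unitCube, abs_lt]
  rw [h, (EuclideanSpace.volume_preserving_symm_measurableEquiv_toLp (Fin n)).measure_preimage
    (MeasurableSet.univ_pi fun _ => measurableSet_Ioo).nullMeasurableSet, volume_pi_pi]
  norm_num

lemma continuous_cubeMap : Continuous (cubeMap T ε y) := by
  unfold cubeMap; fun_prop

lemma cubeMap_preimage (hε : 0 < ε) : cubeMap T ε y ⁻¹' rotCube T ε y = unitCube n := by
  ext u
  simp only [cubeMap, rotCube, unitCube, Set.mem_preimage, Set.mem_ofPred_eq, add_sub_cancel_left,
    LinearIsometryEquiv.symm_apply_apply, PiLp.smul_apply, smul_eq_mul, abs_mul, abs_of_pos hε]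
  refine forall_congr' fun i => ?_
  constructor <;> intro h <;> nlinarith

lemma measurableEmbedding_cubeMap (hε : 0 < ε) : MeasurableEmbedding (cubeMap T ε y) := by
  refine (continuous_cubeMap T y).measurableEmbedding fun u v h => ?_
  have : T (ε • u) = T (ε • v) := add_left_cancel h
  exact smul_right_injective _ hε.ne' (T.injective this)

lemma map_cubeMap (hε : 0 < ε) :
    Measure.map (cubeMap T ε y) volume = ENNReal.ofReal ((ε ^ n)⁻¹) • volume := by
  have h1 : cubeMap T ε y = (fun x => y + x) ∘ T ∘ (fun u : Euc n => ε • u) := rfl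
  rw [h1, ← Measure.map_map (by fun_prop) (by fun_prop),
    ← Measure.map_map (by fun_prop) (by fun_prop),
    Measure.map_addHaar_smul volume hε.ne', Measure.map_smul, Measure.map_smul,
    T.measurePreserving.map_eq, (measurePreserving_add_left volume y).map_eq,
    abs_of_pos (by positivity)]
  simp

lemma setIntegral_rotCube (hε : 0 < ε) (h : Euc n → ℝ) :
    ∫ x in rotCube T ε y, h x = ε ^ n * ∫ u in unitCube n, h (cubeMap T ε y u) := by
  have h2 := (measurableEmbedding_cubeMap T y hε).setIntegral_map (μ := volume) h (rotCube T ε y)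
  rw [cubeMap_preimage T y hε, map_cubeMap T y hε, Measure.restrict_smul,
    integral_smul_measure, ENNReal.toReal_ofReal (by positivity)] at h2
  rw [← h2, smul_eq_mul, ← mul_assoc, mul_inv_cancel₀ (by positivity), one_mul]

lemma integrableOn_rotCube_iff (hε : 0 < ε) (h : Euc n → ℝ) :
    IntegrableOn h (rotCube T ε y) ↔
      IntegrableOn (fun u => h (cubeMap T ε y u)) (unitCube n) := by
  have h2 := (measurableEmbedding_cubeMap T y hε).integrableOn_map_iff (μ := volume) (f := h)
    (s := rotCube T ε y)
  rw [cubeMap_preimage T y hε, map_cubeMap T y hε] at h2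
  rw [IntegrableOn, Measure.restrict_smul, integrable_smul_measure] at h2
  · exact h2
  · simpa using by positivity
  · exact ENNReal.ofReal_ne_top

lemma volume_rotCube (hε : 0 < ε) : volume (rotCube T ε y) = ENNReal.ofReal (ε ^ n) := by
  have h1 : Measure.map (cubeMap T ε y) volume (rotCube T ε y) = 1 := by
    rw [(measurableEmbedding_cubeMap T y hε).map_apply, cubeMap_preimage T y hε, volume_unitCube]
  rw [map_cubeMap T y hε, Measure.smul_apply, smul_eq_mul,
    ENNReal.ofReal_inv_of_pos (by positivity)] at h1
  have h0 : ENNReal.ofReal (ε ^ n) ≠ 0 := by simpa using by positivity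
  calc volume (rotCube T ε y)
      = ENNReal.ofReal (ε ^ n) * ((ENNReal.ofReal (ε ^ n))⁻¹ * volume (rotCube T ε y)) := by
        rw [← mul_assoc, ENNReal.mul_inv_cancel h0 ENNReal.ofReal_ne_top, one_mul]
    _ = _ := by rw [h1, mul_one]

lemma setAverage_rotCube (hε : 0 < ε) (h : Euc n → ℝ) :
    ⨍ x in rotCube T ε y, h x = ∫ u in unitCube n, h (cubeMap T ε y u) := by
  rw [setAverage_eq, setIntegral_rotCube T y hε, Measure.real, volume_rotCube T y hε,
    ENNReal.toReal_ofReal (by positivity), smul_eq_mul, ← mul_assoc,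
    inv_mul_cancel₀ (by positivity), one_mul]

end Cubes

/-- The sign function with values in `{-1, 1}`. -/
def halfSign (t : ℝ) : ℝ := if 0 < t then 1 else -1

lemma measurable_halfSign : Measurable halfSign :=
  Measurable.ite measurableSet_Ioi measurable_const measurable_const

lemma abs_halfSign (t : ℝ) : |halfSign t| = 1 := by
  unfold halfSign; split_ifs <;> simp

/-- The mean over `rotCube T ε y` of `g` times the sign of the coordinate `i₀`. -/
def cubeCoef {n : ℕ} (i₀ : Fin n) (T : Euc n ≃ₗᵢ[ℝ] Euc n) (ε : ℝ) (g : Euc n → ℝ)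
    (y : Euc n) : ℝ :=
  ∫ u in unitCube n, g (cubeMap T ε y u) * halfSign (u i₀)

section Coef

variable {n : ℕ} (i₀ : Fin n) (T : Euc n ≃ₗᵢ[ℝ] Euc n) {ε : ℝ}

lemma setIntegral_unitCube_prod (h : Fin n → ℝ → ℝ) :
    ∫ u in unitCube n, ∏ i, h i (u i) = ∏ i, ∫ t in Set.Ioo (-(1 / 2) : ℝ) (1 / 2), h i t := by
  have hs : unitCube n = (MeasurableEquiv.toLp 2 (Fin n → ℝ)).symm ⁻¹'
      (Set.univ.pi fun _ => Set.Ioo (-(1 / 2) : ℝ) (1 / 2)) := by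
    ext x; simp [unitCube, abs_lt]
  have h1 := (EuclideanSpace.volume_preserving_symm_measurableEquiv_toLp
    (Fin n)).setIntegral_preimage_emb (MeasurableEquiv.measurableEmbedding _)
    (fun v : Fin n → ℝ => ∏ i, h i (v i)) (Set.univ.pi fun _ => Set.Ioo (-(1 / 2) : ℝ) (1 / 2))
  rw [← hs] at h1
  refine h1.trans ?_
  rw [volume_pi, Measure.restrict_pi_pi]
  exact integral_fintype_prod_eq_prod (fun i t => h i t)

lemma integral_Ioo_halfSign_mul (p : ℝ → ℝ) (hp : Continuous p) :
    ∫ t in Set.Ioo (-(1 / 2) : ℝ) (1 / 2), halfSign t * p t =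
      (∫ t in (0 : ℝ)..(1 / 2), p t) - ∫ t in (-(1 / 2) : ℝ)..0, p t := by
  have hp' : IntervalIntegrable p volume (-(1/2)) 0 := hp.intervalIntegrable _ _
  have hp2 : IntervalIntegrable p volume 0 (1/2) := hp.intervalIntegrable _ _
  have e1 : Set.EqOn (fun t => halfSign t * p t) (fun t => - p t) (Set.Ioc (-(1/2)) 0) := by
    intro t ht; simp [halfSign, not_lt.2 ht.2]
  have e2 : Set.EqOn (fun t => halfSign t * p t) p (Set.Ioc 0 (1/2)) := by
    intro t ht; simp [halfSign, ht.1]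
  have i1 : IntegrableOn (fun t => halfSign t * p t) (Set.Ioc (-(1/2)) 0) := by
    refine IntegrableOn.congr_fun ?_ e1.symm measurableSet_Ioc
    exact ((intervalIntegrable_iff_integrableOn_Ioc_of_le (by norm_num)).1 hp').neg
  have i2 : IntegrableOn (fun t => halfSign t * p t) (Set.Ioc 0 (1/2)) := by
    refine IntegrableOn.congr_fun ?_ e2.symm measurableSet_Ioc
    exact (intervalIntegrable_iff_integrableOn_Ioc_of_le (by norm_num)).1 hp2
  rw [← integral_Ioc_eq_integral_Ioo, ← Set.Ioc_union_Ioc_eq_Ioc (b := (0:ℝ)) (by norm_num)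
    (by norm_num), setIntegral_union (Set.Ioc_disjoint_Ioc_of_le le_rfl) measurableSet_Ioc i1 i2,
    setIntegral_congr_fun measurableSet_Ioc e1, setIntegral_congr_fun measurableSet_Ioc e2,
    integral_neg, intervalIntegral.integral_of_le (by norm_num),
    intervalIntegral.integral_of_le (by norm_num)]
  ring

lemma integral_unitCube_halfSign : ∫ u in unitCube n, halfSign (u i₀) = 0 := by
  have h := setIntegral_unitCube_prod (fun i t => if i = i₀ then halfSign t * 1 else 1)
  simp only [mul_one, Finset.prod_ite_eq', Finset.mem_univ, if_true] at h
  rw [h]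
  refine Finset.prod_eq_zero (Finset.mem_univ i₀) ?_
  have := integral_Ioo_halfSign_mul (fun _ => 1) continuous_const
  simp only [mul_one] at this
  simp only [if_true]
  rw [this]
  norm_num

lemma integral_unitCube_halfSign_mul_coord (i : Fin n) :
    ∫ u in unitCube n, halfSign (u i₀) * u i = if i = i₀ then 1 / 4 else 0 := by
  have h := setIntegral_unitCube_prod
    (fun j t => (if j = i₀ then halfSign t else 1) * (if j = i then t else 1))
  simp only [Finset.prod_mul_distrib, Finset.prod_ite_eq', Finset.mem_univ, if_true] at h
  rw [h]
  split_ifs with hi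
  · subst hi
    rw [Finset.prod_eq_single i]
    · simp only [if_true]
      rw [integral_Ioo_halfSign_mul (fun t => t) continuous_id]
      simp; norm_num
    · intro j _ hj
      simp [hj]
      norm_num
    · simp
  · refine Finset.prod_eq_zero (Finset.mem_univ i) ?_
    simp only [hi, if_false, if_true, one_mul]
    rw [← integral_Ioc_eq_integral_Ioo, ← intervalIntegral.integral_of_le (by norm_num)]
    simp

lemma integrableOn_mul_halfSign {h : Euc n → ℝ} {s : Set (Euc n)} (hh : IntegrableOn h s) :
    IntegrableOn (fun u => h u * halfSign (u i₀)) s := by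
  refine hh.mul_bdd (c := 1) ?_ ?_
  · exact (measurable_halfSign.comp (by fun_prop)).aestronglyMeasurable
  · exact Eventually.of_forall fun u => by rw [Real.norm_eq_abs, abs_halfSign]

lemma abs_cubeCoef_le_osc (hε : 0 < ε) {g : Euc n → ℝ} {y : Euc n}
    (hg : IntegrableOn g (rotCube T ε y)) :
    |cubeCoef i₀ T ε g y| ≤
      ⨍ x in rotCube T ε y, |g x - ⨍ z in rotCube T ε y, g z ∂volume| ∂volume := by
  rw [setAverage_rotCube T y hε (fun x => |g x - ⨍ z in rotCube T ε y, g z ∂volume|)]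
  set m := ⨍ z in rotCube T ε y, g z ∂volume
  have hg' := (integrableOn_rotCube_iff T y hε g).1 hg
  have hfin : volume (unitCube n) ≠ ∞ := by simp [volume_unitCube]
  have hc : IntegrableOn (fun _ : Euc n => m) (unitCube n) := integrableOn_const hfin
  have h1 : cubeCoef i₀ T ε g y =
      ∫ u in unitCube n, (g (cubeMap T ε y u) - m) * halfSign (u i₀) := by
    simp only [sub_mul]
    rw [integral_sub (integrableOn_mul_halfSign i₀ hg') (integrableOn_mul_halfSign i₀ hc),
      integral_const_mul, integral_unitCube_halfSign, mul_zero, sub_zero, cubeCoef]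
  rw [h1]
  refine (abs_integral_le_integral_abs).trans (le_of_eq ?_)
  simp only [abs_mul, abs_halfSign, mul_one]

lemma abs_cubeCoef_sub_le {g₁ g₂ : Euc n → ℝ} {y : Euc n}
    (h₁ : IntegrableOn (fun u => g₁ (cubeMap T ε y u)) (unitCube n))
    (h₂ : IntegrableOn (fun u => g₂ (cubeMap T ε y u)) (unitCube n)) :
    |cubeCoef i₀ T ε g₁ y - cubeCoef i₀ T ε g₂ y| ≤
      ∫ u in unitCube n, |g₁ (cubeMap T ε y u) - g₂ (cubeMap T ε y u)| := by
  unfold cubeCoef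
  rw [← integral_sub (integrableOn_mul_halfSign i₀ h₁) (integrableOn_mul_halfSign i₀ h₂)]
  refine (abs_integral_le_integral_abs).trans (le_of_eq ?_)
  simp only [← sub_mul, abs_mul, abs_halfSign, mul_one]

lemma tsum_cubeCoef_le_kappa {ι : Type*} (hε : 0 < ε) {g : Euc n → ℝ} {U : Set (Euc n)}
    (c : ι → Euc n) (hU : ∀ i, rotCube T ε (c i) ⊆ U)
    (hd : Pairwise fun i j => Disjoint (rotCube T ε (c i)) (rotCube T ε (c j)))
    (hg : ∀ i, IntegrableOn g (rotCube T ε (c i))) :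
    ENNReal.ofReal (ε ^ (n - 1)) * ∑' i, ENNReal.ofReal |cubeCoef i₀ T ε g (c i)| ≤
      kappa n ε g U := by
  set Q : ι → Set (Euc n) := fun i => rotCube T ε (c i)
  have hinj : Function.Injective Q := by
    intro i j hij
    by_contra hne
    have h1 : Disjoint (Q i) (Q j) := hd hne
    rw [hij, disjoint_self] at h1
    exact (Set.nonempty_iff_ne_empty.1 ⟨_, center_mem_rotCube T (c j) hε⟩) h1
  unfold kappa
  gcongr
  refine le_iSup_of_le (Set.range Q) (le_iSup_of_le ?_ (le_iSup_of_le ?_ ?_))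
  · rintro _ ⟨i, rfl⟩
    exact ⟨isCube_rotCube T (c i), hU i⟩
  · rintro _ ⟨i, rfl⟩ _ ⟨j, rfl⟩ hij
    exact hd fun h => hij (by rw [h])
  · rw [← (Equiv.ofInjective Q hinj).tsum_eq]
    refine ENNReal.tsum_le_tsum fun i => ENNReal.ofReal_le_ofReal ?_
    exact abs_cubeCoef_le_osc i₀ T hε (hg i)

lemma kappa_add_le (hε : 0 < ε) {g : Euc n → ℝ} {U V W : Set (Euc n)} (hUV : Disjoint U V)
    (hU : U ⊆ W) (hV : V ⊆ W) : kappa n ε g U + kappa n ε g V ≤ kappa n ε g W := by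
  have hcube : ∀ Q, IsCube n ε Q → Q.Nonempty := by
    rintro Q ⟨T, x, rfl⟩
    exact ⟨_, 0, fun i => by simpa using hε, rfl⟩
  unfold kappa
  rw [← mul_add]
  gcongr
  simp only [iSup_and']
  refine ENNReal.biSup_add_biSup_le' ⟨∅, by simp⟩ ⟨∅, by simp⟩ ?_
  rintro F ⟨hF, hFd⟩ G ⟨hG, hGd⟩
  have hFG : Disjoint F G := by
    rw [Set.disjoint_left]
    intro Q h1 h2
    obtain ⟨x, hx⟩ := hcube Q (hF Q h1).1
    exact Set.disjoint_left.1 hUV ((hF Q h1).2 hx) ((hG Q h2).2 hx)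
  refine le_iSup₂_of_le (F ∪ G) ⟨?_, ?_⟩ ?_
  · rintro Q (h | h)
    · exact ⟨(hF Q h).1, (hF Q h).2.trans hU⟩
    · exact ⟨(hG Q h).1, (hG Q h).2.trans hV⟩
  · rintro Q hQ R hR hne
    rcases hQ with h | h <;> rcases hR with h' | h'
    · exact hFd h h' hne
    · exact hUV.mono (hF Q h).2 (hG R h').2
    · exact (hUV.mono (hF R h').2 (hG Q h).2).symm
    · exact hGd h h' hne
  · refine le_of_eq ?_
    exact (Summable.tsum_union_disjoint (f := fun Q : Set (Euc n) => ENNReal.ofReal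
      (⨍ x in Q, |g x - ⨍ y in Q, g y ∂volume| ∂volume)) hFG ENNReal.summable
      ENNReal.summable).symm

lemma kappa_mono {g : Euc n → ℝ} {U W : Set (Euc n)} (hU : U ⊆ W) :
    kappa n ε g U ≤ kappa n ε g W := by
  unfold kappa
  gcongr
  refine iSup_le fun hF => ?_
  exact le_iSup_of_le (fun Q hQ => ⟨(hF Q hQ).1, (hF Q hQ).2.trans hU⟩) le_rfl

end Coef

/-- The points of `U` at distance more than `r` from the complement of `U`. -/
def erosion {n : ℕ} (U : Set (Euc n)) (r : ℝ) : Set (Euc n) := (cthickening r Uᶜ)ᶜ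

section Erosion

variable {n : ℕ} {U : Set (Euc n)} {r : ℝ}

lemma isOpen_erosion : IsOpen (erosion U r) := isClosed_cthickening.isOpen_compl

lemma closedBall_subset_of_mem_erosion {y : Euc n} (hy : y ∈ erosion U r) :
    closedBall y r ⊆ U := by
  intro x hx
  by_contra hxU
  exact hy (mem_cthickening_of_dist_le y x r _ hxU (by rwa [mem_closedBall, dist_comm] at hx))

lemma exists_subset_erosion {K : Set (Euc n)} (hK : IsCompact K) (hU : IsOpen U) (hKU : K ⊆ U) :
    ∃ δ > 0, ∀ r < δ, K ⊆ erosion U r := by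
  have hd : Disjoint K Uᶜ := Set.disjoint_compl_right_iff_subset.2 hKU
  obtain ⟨δ, hδ, h⟩ := hd.exists_cthickenings hK hU.isClosed_compl
  refine ⟨δ, hδ, fun r hr x hx hx' => ?_⟩
  exact Set.disjoint_left.1 h (self_subset_cthickening _ hx) (cthickening_mono hr.le _ hx')

end Erosion

section Unfolding

variable {n : ℕ}

/-- The integer vector `k` seen as a point of `ℝⁿ`. -/
def latticePoint (k : Fin n → ℤ) : Euc n := WithLp.toLp 2 fun i => (k i : ℝ)

/-- The half-open unit cell with lower corner `k`. -/
def latticeCell (k : Fin n → ℤ) : Set (Euc n) := {z | (fun i => ⌊z i⌋) = k}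

lemma measurableSet_latticeCell (k : Fin n → ℤ) : MeasurableSet (latticeCell k) := by
  have : latticeCell k = ⋂ i, {z : Euc n | ⌊z i⌋ = k i} := by
    ext z; simp [latticeCell, funext_iff]
  rw [this]
  refine MeasurableSet.iInter fun i => ?_
  exact (Int.measurable_floor.comp (by fun_prop : Measurable fun z : Euc n => z i))
    (measurableSet_singleton (k i))

lemma volume_latticeCell_zero : volume (latticeCell (0 : Fin n → ℤ)) = 1 := by
  have h : latticeCell (0 : Fin n → ℤ) = (MeasurableEquiv.toLp 2 (Fin n → ℝ)).symm ⁻¹'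
      (Set.univ.pi fun _ => Set.Ico (0 : ℝ) 1) := by
    ext x; simp [latticeCell, funext_iff, Int.floor_eq_zero_iff]
  rw [h, (EuclideanSpace.volume_preserving_symm_measurableEquiv_toLp (Fin n)).measure_preimage
    (MeasurableSet.univ_pi fun _ => measurableSet_Ico).nullMeasurableSet, volume_pi_pi]
  norm_num

lemma lintegral_eq_lintegral_tsum_lattice {H : Euc n → ℝ≥0∞} (hH : Measurable H) :
    ∫⁻ z, H z = ∫⁻ z in latticeCell (0 : Fin n → ℤ), ∑' k, H (z + latticePoint k) := by
  have hU : ⋃ k, latticeCell (n := n) k = Set.univ := by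
    ext z; simp [latticeCell]
  have hd : Pairwise (Function.onFun Disjoint (latticeCell (n := n))) := by
    intro k l hkl
    refine Set.disjoint_left.2 fun z hz hz' => hkl ?_
    exact hz.symm.trans hz'
  rw [← setLIntegral_univ, ← hU, lintegral_iUnion measurableSet_latticeCell hd,
    lintegral_tsum (f := fun k z => H (z + latticePoint k))
      fun k => (hH.comp (measurable_add_const _)).aemeasurable]
  congr 1 with k
  have hpre : (fun z => z + latticePoint k) ⁻¹' latticeCell k = latticeCell 0 := by
    ext z
    simp [latticeCell, latticePoint, funext_iff]
  rw [← hpre, (measurePreserving_add_right volume (latticePoint k)).setLIntegral_comp_preimage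
    (measurableSet_latticeCell k) hH]

variable (T : Euc n ≃ₗᵢ[ℝ] Euc n) {ε : ℝ}

lemma lintegral_cubeMap (hε : 0 < ε) {G : Euc n → ℝ≥0∞} (hG : Measurable G) :
    ∫⁻ y, G y = ENNReal.ofReal (ε ^ n) * ∫⁻ z, G (cubeMap T ε 0 z) := by
  have h1 := lintegral_map (μ := volume) hG (continuous_cubeMap T (ε := ε) 0).measurable
  rw [map_cubeMap T 0 hε, lintegral_smul_measure, smul_eq_mul] at h1
  rw [← h1, ← mul_assoc, ← ENNReal.ofReal_mul (by positivity), mul_inv_cancel₀ (by positivity)]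
  simp

lemma disjoint_rotCube_lattice (hε : 0 < ε) (z : Euc n) {k l : Fin n → ℤ} (hkl : k ≠ l) :
    Disjoint (rotCube T ε (cubeMap T ε 0 (z + latticePoint k)))
      (rotCube T ε (cubeMap T ε 0 (z + latticePoint l))) := by
  refine Set.disjoint_left.2 fun x hx hx' => hkl (funext fun i => ?_)
  have h1 := hx i
  have h2 := hx' i
  simp only [cubeMap, latticePoint, map_sub, zero_add, LinearIsometryEquiv.symm_apply_apply,
    PiLp.sub_apply, PiLp.smul_apply, PiLp.add_apply, smul_eq_mul] at h1 h2
  rw [abs_lt] at h1 h2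
  have h3 : (k i : ℝ) - l i < 1 := by
    by_contra! h; nlinarith
  have h4 : (l i : ℝ) - k i < 1 := by
    by_contra! h; nlinarith
  have h5 : k i - l i < 1 := by exact_mod_cast h3
  have h6 : l i - k i < 1 := by exact_mod_cast h4
  omega

variable (i₀ : Fin n)

lemma ae_comp_cubeMap (hε : 0 < ε) {p : Euc n → Prop} {y : Euc n}
    (h : ∀ᵐ x ∂(volume.restrict (rotCube T ε y)), p x) :
    ∀ᵐ u ∂(volume.restrict (unitCube n)), p (cubeMap T ε y u) := by
  have h2 : ∀ᵐ x ∂(Measure.map (cubeMap T ε y) volume).restrict (rotCube T ε y), p x := by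
    rw [map_cubeMap T y hε, Measure.restrict_smul]
    exact Measure.ae_smul_measure h _
  rw [(measurableEmbedding_cubeMap T y hε).restrict_map, cubeMap_preimage T y hε] at h2
  exact ae_of_ae_map (measurableEmbedding_cubeMap T y hε).measurable.aemeasurable h2

lemma cubeCoef_congr_ae (hε : 0 < ε) {g g' : Euc n → ℝ} {y : Euc n}
    (h : ∀ᵐ x ∂(volume.restrict (rotCube T ε y)), g x = g' x) :
    cubeCoef i₀ T ε g y = cubeCoef i₀ T ε g' y := by
  refine integral_congr_ae ?_
  filter_upwards [ae_comp_cubeMap T hε h] with u hu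
  rw [hu]

lemma measurable_cubeCoef {g : Euc n → ℝ} (hg : StronglyMeasurable g) :
    Measurable (cubeCoef i₀ T ε g) := by
  refine StronglyMeasurable.measurable (StronglyMeasurable.integral_prod_right (α := Euc n)
    (f := fun y u => g (cubeMap T ε y u) * halfSign (u i₀)) ?_)
  refine StronglyMeasurable.mul (hg.comp_measurable ?_) ?_
  · unfold cubeMap; fun_prop
  · exact (measurable_halfSign.comp (by fun_prop)).stronglyMeasurable

lemma exists_measurable_eq_cubeCoef (hε : 0 < ε) {g : Euc n → ℝ} {U : Set (Euc n)}
    (hg : LocallyIntegrableOn g U) :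
    ∃ A : Euc n → ℝ, Measurable A ∧ ∀ y, rotCube T ε y ⊆ U → cubeCoef i₀ T ε g y = A y := by
  have hgm : AEStronglyMeasurable g (volume.restrict U) := hg.aestronglyMeasurable
  refine ⟨_, measurable_cubeCoef (ε := ε) T i₀ hgm.stronglyMeasurable_mk, fun y hy => ?_⟩
  exact cubeCoef_congr_ae T i₀ hε (ae_restrict_of_ae_restrict_of_subset hy hgm.ae_eq_mk)

lemma integrableOn_rotCube_of_subset (hε : 0 < ε) {g : Euc n → ℝ} {U : Set (Euc n)}
    (hg : LocallyIntegrableOn g U) {y : Euc n} (hy : closedBall y (n * ε) ⊆ U) :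
    IntegrableOn g (rotCube T ε y) :=
  (hg.integrableOn_compact_subset hy (isCompact_closedBall _ _)).mono_set
    (rotCube_subset_closedBall T y hε)

lemma setLIntegral_cubeCoef_le (hn : 1 ≤ n) (hε : 0 < ε) {g : Euc n → ℝ} {U : Set (Euc n)}
    (hg : LocallyIntegrableOn g U) :
    ∫⁻ y in erosion U (n * ε), ENNReal.ofReal |cubeCoef i₀ T ε g y| ≤
      ENNReal.ofReal ε * kappa n ε g U := by
  obtain ⟨A, hA, hgA⟩ := exists_measurable_eq_cubeCoef T i₀ hε hg
  have hsub : ∀ y ∈ erosion U (n * ε), rotCube T ε y ⊆ U := fun y hy =>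
    (rotCube_subset_closedBall T y hε).trans (closedBall_subset_of_mem_erosion hy)
  set G : Euc n → ℝ≥0∞ := (erosion U (n * ε)).indicator fun y => ENNReal.ofReal |A y| with hG
  have hGm : Measurable G :=
    (hA.abs.ennreal_ofReal).indicator isOpen_erosion.measurableSet
  have h1 : ∫⁻ y in erosion U (n * ε), ENNReal.ofReal |cubeCoef i₀ T ε g y| = ∫⁻ y, G y := by
    rw [lintegral_indicator isOpen_erosion.measurableSet]
    refine setLIntegral_congr_fun isOpen_erosion.measurableSet fun y hy => ?_
    simp only [hgA y (hsub y hy)]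
  rw [h1, lintegral_cubeMap T hε hGm,
    lintegral_eq_lintegral_tsum_lattice (H := fun z => G (cubeMap T ε 0 z))
      (hGm.comp (continuous_cubeMap T 0).measurable)]
  have h2 : ∀ z : Euc n, ENNReal.ofReal (ε ^ (n - 1)) *
      ∑' k, G (cubeMap T ε 0 (z + latticePoint k)) ≤ kappa n ε g U := by
    intro z
    set c : (Fin n → ℤ) → Euc n := fun k => cubeMap T ε 0 (z + latticePoint k)
    set S : Set (Fin n → ℤ) := {k | c k ∈ erosion U (n * ε)}
    have h3 : ∑' k, G (c k) = ∑' k : S, ENNReal.ofReal |cubeCoef i₀ T ε g (c k)| := by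
      rw [tsum_subtype S fun k => ENNReal.ofReal |cubeCoef i₀ T ε g (c k)|]
      refine tsum_congr fun k => ?_
      by_cases hk : c k ∈ erosion U (n * ε)
      · rw [hG, Set.indicator_of_mem hk, Set.indicator_of_mem (by exact hk), hgA _ (hsub _ hk)]
      · rw [hG, Set.indicator_of_notMem hk, Set.indicator_of_notMem (by exact hk)]
    rw [h3]
    refine tsum_cubeCoef_le_kappa i₀ T hε (fun k : S => c k) (fun k => hsub _ k.2) ?_ ?_
    · intro k l hkl
      exact disjoint_rotCube_lattice T hε z fun h => hkl (Subtype.ext h)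
    · intro k
      exact integrableOn_rotCube_of_subset T hε hg (closedBall_subset_of_mem_erosion k.2)
  have hpow : ENNReal.ofReal (ε ^ n) = ENNReal.ofReal ε * ENNReal.ofReal (ε ^ (n - 1)) := by
    rw [← ENNReal.ofReal_mul hε.le, ← pow_succ', Nat.sub_add_cancel hn]
  rw [hpow, mul_assoc, ← lintegral_const_mul' _ _ ENNReal.ofReal_ne_top]
  gcongr
  refine (lintegral_mono h2).trans ?_
  simp [volume_latticeCell_zero]

end Unfolding

section Duality

variable {n : ℕ} (i₀ : Fin n) (T : Euc n ≃ₗᵢ[ℝ] Euc n) {ε : ℝ}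

/-- The adjoint of `cubeCoef`, applied to a test function. -/
def adjCoef (ε : ℝ) (φ : Euc n → ℝ) (x : Euc n) : ℝ :=
  ∫ u in unitCube n, φ (x - T (ε • u)) * halfSign (u i₀)

lemma integral_mul_cubeCoef {φ G : Euc n → ℝ} (hφ : Continuous φ)
    (hφc : HasCompactSupport φ) (hG : Integrable G) (hGm : StronglyMeasurable G) :
    ∫ y, φ y * cubeCoef i₀ T ε G y = ∫ x, G x * adjCoef i₀ T ε φ x := by
  obtain ⟨C, hC⟩ := hφ.bounded_above_of_compact_support hφc
  have hs : StronglyMeasurable fun p : Euc n × Euc n => halfSign (p.2 i₀) :=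
    (measurable_halfSign.comp (by fun_prop)).stronglyMeasurable
  have hfin : IsFiniteMeasure (volume.restrict (unitCube n)) := by
    refine ⟨?_⟩
    simp [volume_unitCube]
  have hm1 : StronglyMeasurable fun p : Euc n × Euc n =>
      φ p.1 * (G (cubeMap T ε p.1 p.2) * halfSign (p.2 i₀)) := by
    refine (hφ.stronglyMeasurable.comp_measurable measurable_fst).mul
      ((hGm.comp_measurable ?_).mul hs)
    unfold cubeMap; fun_prop
  have hGi : ∀ u : Euc n, Integrable fun y => G (cubeMap T ε y u) := fun u =>
    hG.comp_add_right (T (ε • u))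
  have hbound : ∀ y u : Euc n, ‖φ y * (G (cubeMap T ε y u) * halfSign (u i₀))‖ ≤
      C * ‖G (cubeMap T ε y u)‖ := by
    intro y u
    rw [norm_mul, norm_mul, Real.norm_eq_abs (halfSign _), abs_halfSign, mul_one]
    gcongr
    exact hC y
  have hi1 : Integrable (fun p : Euc n × Euc n =>
      φ p.1 * (G (cubeMap T ε p.1 p.2) * halfSign (p.2 i₀)))
      (volume.prod (volume.restrict (unitCube n))) := by
    rw [integrable_prod_iff' hm1.aestronglyMeasurable]
    have hI : ∀ u : Euc n, Integrable fun y => φ y * (G (cubeMap T ε y u) * halfSign (u i₀)) :=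
      fun u => ((hGi u).norm.const_mul C).mono'
        (hm1.comp_measurable (by fun_prop : Measurable fun y : Euc n => (y, u))).aestronglyMeasurable
        (Eventually.of_forall fun y => hbound y u)
    refine ⟨Eventually.of_forall hI, ?_⟩
    refine (integrable_const (C * ∫ x, ‖G x‖)).mono' ?_ (Eventually.of_forall fun u => ?_)
    · exact (hm1.norm.integral_prod_left').aestronglyMeasurable
    · rw [Real.norm_of_nonneg (integral_nonneg fun y => norm_nonneg _)]
      refine (integral_mono (hI u).norm ((hGi u).norm.const_mul C) fun y => hbound y u).trans ?_
      rw [integral_const_mul]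
      exact le_of_eq (congrArg _ (integral_add_right_eq_self (fun x => ‖G x‖) (T (ε • u))))
  have hi2 : Integrable (fun p : Euc n × Euc n =>
      G p.1 * (φ (p.1 - T (ε • p.2)) * halfSign (p.2 i₀)))
      (volume.prod (volume.restrict (unitCube n))) := by
    have h0 : Integrable (fun p : Euc n × Euc n => C * ‖G p.1‖)
      (volume.prod (volume.restrict (unitCube n))) := (hG.norm.comp_fst _).const_mul C
    refine h0.mono' ?_ (Eventually.of_forall fun p => ?_)
    · refine ((hGm.comp_measurable measurable_fst).mul
        ((hφ.stronglyMeasurable.comp_measurable ?_).mul hs)).aestronglyMeasurable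
      fun_prop
    · rw [norm_mul, norm_mul, Real.norm_eq_abs (halfSign _), abs_halfSign, mul_one, mul_comm]
      gcongr
      exact hC _
  have e1 : ∀ y, φ y * cubeCoef i₀ T ε G y =
      ∫ u in unitCube n, φ y * (G (cubeMap T ε y u) * halfSign (u i₀)) := fun y => by
    rw [cubeCoef, integral_const_mul]
  have e2 : ∀ x, G x * adjCoef i₀ T ε φ x =
      ∫ u in unitCube n, G x * (φ (x - T (ε • u)) * halfSign (u i₀)) := fun y => by
    rw [adjCoef, integral_const_mul]
  simp_rw [e1, e2]
  rw [integral_integral_swap hi1]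
  refine Eq.trans ?_ (integral_integral_swap hi2).symm
  refine integral_congr_ae (Eventually.of_forall fun u => ?_)
  beta_reduce
  rw [← integral_sub_right_eq_self _ (T (ε • u))]
  refine integral_congr_ae (Eventually.of_forall fun x => ?_)
  simp only [cubeMap, sub_add_cancel]
  ring

lemma isFiniteMeasure_restrict_unitCube : IsFiniteMeasure (volume.restrict (unitCube n)) :=
  ⟨by simp [volume_unitCube]⟩

lemma integrableOn_unitCube_of_continuous {g : Euc n → ℝ} (hg : Continuous g) :
    IntegrableOn g (unitCube n) := by
  have h : unitCube n ⊆ closedBall 0 (n * 1) := by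
    intro u hu
    rw [mem_closedBall, dist_zero_right]
    exact euc_norm_le_of_coord_le fun i => (hu i).le.trans (by norm_num)
  exact (hg.continuousOn.integrableOn_compact (isCompact_closedBall _ _)).mono_set h

lemma norm_le_of_mem_unitCube {u : Euc n} (hu : u ∈ unitCube n) : ‖u‖ ≤ n := by
  simpa using euc_norm_le_of_coord_le (c := 1) fun i => (hu i).le.trans (by norm_num)

lemma adjCoef_eq {φ : Euc n → ℝ} (hφ : Continuous φ) (x : Euc n) :
    adjCoef i₀ T ε φ x = ∫ u in unitCube n, (φ (x - T (ε • u)) - φ x) * halfSign (u i₀) := by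
  simp only [sub_mul]
  rw [integral_sub, integral_const_mul, integral_unitCube_halfSign, mul_zero, sub_zero, adjCoef]
  · exact integrableOn_mul_halfSign i₀ (integrableOn_unitCube_of_continuous (by fun_prop))
  · exact integrableOn_mul_halfSign i₀ (integrableOn_unitCube_of_continuous (by fun_prop))

lemma abs_adjCoef_integrand_le (hε : 0 < ε) {φ : Euc n → ℝ} {C : NNReal} (hL : LipschitzWith C φ)
    (x : Euc n) {u : Euc n} (hu : u ∈ unitCube n) :
    ‖ε⁻¹ * ((φ (x - T (ε • u)) - φ x) * halfSign (u i₀))‖ ≤ C * n := by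
  rw [norm_mul, norm_mul, Real.norm_eq_abs (halfSign _), abs_halfSign, mul_one,
    Real.norm_of_nonneg (inv_nonneg.2 hε.le), inv_mul_le_iff₀ hε]
  have h := hL.dist_le_mul (x - T (ε • u)) x
  rw [dist_eq_norm, dist_eq_norm, sub_sub_cancel_left, norm_neg, T.norm_map, norm_smul,
    Real.norm_of_nonneg hε.le] at h
  refine h.trans ?_
  have := norm_le_of_mem_unitCube hu
  calc (C : ℝ) * (ε * ‖u‖) ≤ C * (ε * n) := by gcongr
    _ = _ := by ring

lemma abs_adjCoef_le (hε : 0 < ε) {φ : Euc n → ℝ} {C : NNReal} (hL : LipschitzWith C φ)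
    (x : Euc n) : ‖ε⁻¹ * adjCoef i₀ T ε φ x‖ ≤ C * n := by
  rw [adjCoef_eq i₀ T hL.continuous, ← integral_const_mul]
  have := norm_setIntegral_le_of_norm_le_const (μ := volume) (s := unitCube n)
    (by simp [volume_unitCube]) (fun u hu => abs_adjCoef_integrand_le i₀ T hε hL x hu)
  simpa [Measure.real, volume_unitCube] using this

lemma continuous_adjCoef {φ : Euc n → ℝ} {C : NNReal} (hL : LipschitzWith C φ) :
    Continuous (adjCoef i₀ T ε φ) := by
  have hfin := isFiniteMeasure_restrict_unitCube (n := n)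
  refine LipschitzWith.continuous (K := C) (LipschitzWith.of_dist_le_mul fun x y => ?_)
  have hi : ∀ x, IntegrableOn (fun u => φ (x - T (ε • u)) * halfSign (u i₀)) (unitCube n) :=
    fun x => integrableOn_mul_halfSign i₀ (integrableOn_unitCube_of_continuous
      (hL.continuous.comp (by fun_prop)))
  rw [dist_eq_norm, adjCoef, adjCoef, ← integral_sub (hi x) (hi y)]
  have := norm_setIntegral_le_of_norm_le_const (μ := volume) (s := unitCube n)
    (f := fun u => φ (x - T (ε • u)) * halfSign (u i₀) - φ (y - T (ε • u)) * halfSign (u i₀))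
    (C := C * dist x y)
    (by simp [volume_unitCube]) (fun u _ => by
      rw [← sub_mul, norm_mul, Real.norm_eq_abs (halfSign _), abs_halfSign, mul_one]
      have := hL.dist_le_mul (x - T (ε • u)) (y - T (ε • u))
      rwa [dist_sub_right, dist_eq_norm] at this)
  simpa [Measure.real, volume_unitCube] using this

lemma tendsto_adjCoef {φ : Euc n → ℝ} (hφ : ContDiff ℝ 1 φ) {C : NNReal} (hL : LipschitzWith C φ)
    (x : Euc n) :
    Tendsto (fun ε => ε⁻¹ * adjCoef i₀ T ε φ x) (𝓝[>] (0 : ℝ))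
      (𝓝 (-(1 / 4) * fderiv ℝ φ x (T (EuclideanSpace.single i₀ 1)))) := by
  have hfin := isFiniteMeasure_restrict_unitCube (n := n)
  have hD : HasFDerivAt φ (fderiv ℝ φ x) x := (hφ.differentiable one_ne_zero x).hasFDerivAt
  have hlim : ∫ u in unitCube n, -(fderiv ℝ φ x (T u)) * halfSign (u i₀) =
      -(1 / 4) * fderiv ℝ φ x (T (EuclideanSpace.single i₀ 1)) := by
    have h1 : ∀ u : Euc n, -(fderiv ℝ φ x (T u)) * halfSign (u i₀) =
        ∑ i, -(fderiv ℝ φ x (T (EuclideanSpace.single i 1))) * (halfSign (u i₀) * u i) := by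
      intro u
      have h2 : u = ∑ i, u i • EuclideanSpace.single i (1 : ℝ) := by
        have := (EuclideanSpace.basisFun (Fin n) ℝ).sum_repr u
        simpa using this.symm
      have h3 : fderiv ℝ φ x (T u) =
          ∑ i, u i * fderiv ℝ φ x (T (EuclideanSpace.single i 1)) := by
        conv_lhs => rw [h2, map_sum, map_sum]
        simp only [map_smul, smul_eq_mul]
      rw [h3, ← Finset.sum_neg_distrib, Finset.sum_mul]
      refine Finset.sum_congr rfl fun i _ => ?_
      ring
    simp_rw [h1]
    rw [integral_finsetSum]
    · simp_rw [integral_const_mul, integral_unitCube_halfSign_mul_coord]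
      simp
      ring
    · intro i _
      refine Integrable.const_mul ?_ _
      have := integrableOn_mul_halfSign i₀
        (integrableOn_unitCube_of_continuous (by fun_prop : Continuous fun u : Euc n => u i))
      exact this.congr (Eventually.of_forall fun u => mul_comm _ _)
  rw [← hlim]
  have heq : (fun ε => ε⁻¹ * adjCoef i₀ T ε φ x) = fun ε =>
      ∫ u in unitCube n, ε⁻¹ * ((φ (x - T (ε • u)) - φ x) * halfSign (u i₀)) := by
    funext ε
    rw [adjCoef_eq i₀ T hL.continuous, ← integral_const_mul]
  rw [heq]
  refine tendsto_integral_filter_of_dominated_convergence (fun _ => (C : ℝ) * n) ?_ ?_ ?_ ?_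
  · refine Eventually.of_forall fun ε => ?_
    refine ((integrableOn_mul_halfSign i₀ (integrableOn_unitCube_of_continuous ?_)).const_mul
      _).aestronglyMeasurable
    exact (hL.continuous.comp (by fun_prop)).sub continuous_const
  · filter_upwards [self_mem_nhdsWithin] with ε hε
    filter_upwards [ae_restrict_mem measurableSet_unitCube] with u hu
    exact abs_adjCoef_integrand_le i₀ T hε hL x hu
  · exact integrable_const _
  · refine Eventually.of_forall fun u => ?_
    have h1 := (hD.hasLineDerivAt (-(T u)))
    have h2 := h1.tendsto_slope_zero_right
    have h3 := h2.mul_const (halfSign (u i₀))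
    simp only [map_neg] at h3
    refine h3.congr fun t => ?_
    rw [smul_eq_mul, map_smul, smul_neg, ← sub_eq_add_neg, mul_assoc]

end Duality

section Limit

variable {n : ℕ}

/-- The lower limit of `κ_ε(F_ε, U)` as `ε → 0⁺`. -/
def liminfKappa (n : ℕ) (F : ℝ → Euc n → ℝ) (U : Set (Euc n)) : ℝ≥0∞ :=
  liminf (fun ε => kappa n ε (F ε) U) (𝓝[>] (0 : ℝ))

/-- `F ε → f` in `L^∞_loc(Ω)`, together with local integrability. -/
structure LocUnifConv (n : ℕ) (F : ℝ → Euc n → ℝ) (f : Euc n → ℝ) (Ω : Set (Euc n)) : Prop where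
  isOpen : IsOpen Ω
  locInt : LocallyIntegrableOn f Ω volume
  locInt_approx : ∀ ε, 0 < ε → LocallyIntegrableOn (F ε) Ω volume
  conv : ∀ K, IsCompact K → K ⊆ Ω →
      Tendsto (fun ε => eLpNorm (fun x => F ε x - f x) ⊤ (volume.restrict K)) (𝓝[>] (0:ℝ)) (𝓝 0)

variable {F : ℝ → Euc n → ℝ} {f : Euc n → ℝ} {Ω : Set (Euc n)}

lemma LocUnifConv.eventually_le (H : LocUnifConv n F f Ω) {K : Set (Euc n)} (hK : IsCompact K)
    (hKΩ : K ⊆ Ω) {δ : ℝ} (hδ : 0 < δ) :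
    ∀ᶠ ε in 𝓝[>] (0 : ℝ), ∀ᵐ x ∂volume.restrict K, |F ε x - f x| ≤ δ := by
  have h := (H.conv K hK hKΩ).eventually (ge_mem_nhds (ENNReal.ofReal_pos.2 hδ))
  filter_upwards [h] with ε hε
  rw [eLpNorm_exponent_top] at hε
  filter_upwards [ae_le_eLpNormEssSup (f := fun x => F ε x - f x)
    (μ := volume.restrict K)] with x hx
  have := hx.trans hε
  rwa [← ofReal_norm, ENNReal.ofReal_le_ofReal_iff hδ.le, Real.norm_eq_abs] at this

lemma liminfKappa_mono {U V : Set (Euc n)} (h : U ⊆ V) :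
    liminfKappa n F U ≤ liminfKappa n F V :=
  liminf_le_liminf (Eventually.of_forall fun _ => kappa_mono h)

lemma integral_mul_cubeCoef_of_tsupport (H : LocUnifConv n F f Ω) (i₀ : Fin n)
    (T : Euc n ≃ₗᵢ[ℝ] Euc n) {φ : Euc n → ℝ} (hφ : Continuous φ) (hφc : HasCompactSupport φ)
    {δ ε : ℝ} (hδ : cthickening δ (tsupport φ) ⊆ Ω) (hε : 0 < ε) (hεδ : n * ε ≤ δ) :
    ∫ y, φ y * cubeCoef i₀ T ε (F ε) y =
      ∫ x in cthickening δ (tsupport φ), F ε x * adjCoef i₀ T ε φ x := by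
  set K := cthickening δ (tsupport φ)
  have hK : IsCompact K := IsCompact.cthickening hφc
  have hi : IntegrableOn (F ε) K := (H.locInt_approx ε hε).integrableOn_compact_subset hδ hK
  have hi2 : Integrable (K.indicator (F ε)) := (integrable_indicator_iff hK.measurableSet).2 hi
  obtain ⟨G, hGm, hGe⟩ : ∃ G : Euc n → ℝ, StronglyMeasurable G ∧ K.indicator (F ε) =ᵐ[volume] G :=
    ⟨_, hi2.1.stronglyMeasurable_mk, hi2.1.ae_eq_mk⟩
  have hG : Integrable G := hi2.congr hGe
  have h1 : ∀ y, φ y * cubeCoef i₀ T ε (F ε) y = φ y * cubeCoef i₀ T ε G y := by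
    intro y
    by_cases hy : y ∈ tsupport φ
    · congr 1
      have hs : rotCube T ε y ⊆ K := (rotCube_subset_closedBall T y hε).trans
        ((closedBall_subset_closedBall hεδ).trans (closedBall_subset_cthickening hy δ))
      refine cubeCoef_congr_ae T i₀ hε ?_
      filter_upwards [ae_restrict_of_ae hGe,
        ae_restrict_mem (isOpen_rotCube T y).measurableSet] with x hx hxm
      rw [← hx, Set.indicator_of_mem (hs hxm)]
    · rw [image_eq_zero_of_notMem_tsupport hy, zero_mul, zero_mul]
  simp_rw [h1]
  rw [integral_mul_cubeCoef i₀ T hφ hφc hG hGm,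
    ← integral_indicator hK.measurableSet]
  refine integral_congr_ae ?_
  filter_upwards [hGe] with x hx
  rw [← hx]
  by_cases hxK : x ∈ K <;> simp [hxK]

lemma tendsto_integral_mul_cubeCoef (H : LocUnifConv n F f Ω) (i₀ : Fin n)
    (T : Euc n ≃ₗᵢ[ℝ] Euc n) {φ : Euc n → ℝ} (hφ : ContDiff ℝ 1 φ) (hφc : HasCompactSupport φ)
    (hφΩ : tsupport φ ⊆ Ω) :
    Tendsto (fun ε => ε⁻¹ * ∫ y, φ y * cubeCoef i₀ T ε (F ε) y) (𝓝[>] (0 : ℝ))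
      (𝓝 (-(1 / 4) * ∫ x in Ω, f x * fderiv ℝ φ x (T (EuclideanSpace.single i₀ 1)))) := by
  obtain ⟨C, hL⟩ := hφ.lipschitzWith_of_hasCompactSupport hφc one_ne_zero
  obtain ⟨δ, hδ, hδΩ⟩ := hφc.isCompact.exists_cthickening_subset_open H.isOpen hφΩ
  set K := cthickening δ (tsupport φ) with hKdef
  have hK : IsCompact K := hφc.isCompact.cthickening
  have hfK : IntegrableOn f K := H.locInt.integrableOn_compact_subset hδΩ hK
  have hsm : ∀ᶠ ε in 𝓝[>] (0 : ℝ), n * ε ≤ δ := by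
    have : Tendsto (fun ε : ℝ => n * ε) (𝓝[>] 0) (𝓝 0) := by
      have h0 : Tendsto (fun ε : ℝ => n * ε) (𝓝 0) (𝓝 (n * 0)) :=
        (continuous_const.mul continuous_id).tendsto 0
      rw [mul_zero] at h0
      exact h0.mono_left nhdsWithin_le_nhds
    exact this.eventually (ge_mem_nhds hδ)
  have hlim : ∫ x in Ω, f x * fderiv ℝ φ x (T (EuclideanSpace.single i₀ 1)) =
      ∫ x in K, f x * fderiv ℝ φ x (T (EuclideanSpace.single i₀ 1)) := by
    refine (setIntegral_eq_of_subset_of_forall_sdiff_eq_zero H.isOpen.measurableSet hδΩ ?_)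
    intro x hx
    have : x ∉ tsupport (fderiv ℝ φ) := fun h =>
      hx.2 (self_subset_cthickening _ (tsupport_fderiv_subset ℝ h))
    rw [image_eq_zero_of_notMem_tsupport this]
    simp
  have hmain : Tendsto (fun ε => ∫ x in K, f x * (ε⁻¹ * adjCoef i₀ T ε φ x)) (𝓝[>] (0 : ℝ))
      (𝓝 (-(1 / 4) * ∫ x in Ω, f x * fderiv ℝ φ x (T (EuclideanSpace.single i₀ 1)))) := by
    rw [hlim, ← integral_const_mul]
    refine tendsto_integral_filter_of_dominated_convergence (fun x => ‖f x‖ * (C * n)) ?_ ?_ ?_ ?_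
    · refine Eventually.of_forall fun ε => hfK.1.mul ?_
      exact ((continuous_adjCoef i₀ T hL).const_mul _).aestronglyMeasurable
    · filter_upwards [self_mem_nhdsWithin] with ε hε
      refine Eventually.of_forall fun x => ?_
      rw [norm_mul]
      gcongr
      exact abs_adjCoef_le i₀ T hε hL x
    · exact hfK.norm.mul_const _
    · refine Eventually.of_forall fun x => ?_
      have := (tendsto_adjCoef i₀ T hφ hL x).const_mul (f x)
      convert this using 2
      ring
  have herr : Tendsto (fun ε => (ε⁻¹ * ∫ y, φ y * cubeCoef i₀ T ε (F ε) y) -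
      ∫ x in K, f x * (ε⁻¹ * adjCoef i₀ T ε φ x)) (𝓝[>] (0 : ℝ)) (𝓝 0) := by
    rw [Metric.tendsto_nhds]
    intro η hη
    set D : ℝ := C * n * volume.real K
    have hD : 0 ≤ D := by positivity
    filter_upwards [hsm, self_mem_nhdsWithin, H.eventually_le hK hδΩ
      (δ := η / (D + 1)) (by positivity)] with ε h1 hε h2
    have hε : 0 < ε := hε
    have hFK : IntegrableOn (F ε) K := (H.locInt_approx ε hε).integrableOn_compact_subset hδΩ hK
    have hb : ∀ {g : Euc n → ℝ}, IntegrableOn g K →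
        IntegrableOn (fun x => g x * (ε⁻¹ * adjCoef i₀ T ε φ x)) K := by
      intro g hg
      refine Integrable.mul_bdd (c := C * n) hg
        ((continuous_adjCoef i₀ T hL).const_mul _).aestronglyMeasurable
        (Eventually.of_forall fun x => abs_adjCoef_le i₀ T hε hL x)
    rw [integral_mul_cubeCoef_of_tsupport H i₀ T hφ.continuous hφc hδΩ hε h1, ← hKdef,
      ← integral_const_mul]
    have h3 : ∀ x, ε⁻¹ * (F ε x * adjCoef i₀ T ε φ x) =
      F ε x * (ε⁻¹ * adjCoef i₀ T ε φ x) := fun x => by ring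
    simp_rw [h3]
    rw [← integral_sub (hb hFK) (hb hfK), dist_zero_right]
    have h4 := norm_setIntegral_le_of_norm_le_const_ae (μ := volume) (s := K)
      (f := fun x => F ε x * (ε⁻¹ * adjCoef i₀ T ε φ x) - f x * (ε⁻¹ * adjCoef i₀ T ε φ x))
      (C := η / (D + 1) * (C * n)) hK.measure_lt_top ?_
    · refine h4.trans_lt ?_
      calc η / (D + 1) * (C * n) * volume.real K = η / (D + 1) * D := by ring
        _ < η / (D + 1) * (D + 1) := by gcongr; linarith
        _ = η := by field_simp
    · filter_upwards [h2] with x hx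
      rw [← sub_mul, norm_mul]
      gcongr
      · exact hx
      · exact abs_adjCoef_le i₀ T hε hL x
  have := herr.add hmain
  simpa using this

lemma ofReal_abs_integral_mul_cubeCoef_le (H : LocUnifConv n F f Ω) (i₀ : Fin n)
    (T : Euc n ≃ₗᵢ[ℝ] Euc n) {U : Set (Euc n)} {φ : Euc n → ℝ} {ε : ℝ}
    (hφ : ∀ x, |φ x| ≤ 1) (hU : tsupport φ ⊆ erosion U (n * ε)) (hUΩ : U ⊆ Ω) (hε : 0 < ε) :
    ENNReal.ofReal |ε⁻¹ * ∫ y, φ y * cubeCoef i₀ T ε (F ε) y| ≤ kappa n ε (F ε) U := by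
  have hn : 1 ≤ n := Nat.one_le_iff_ne_zero.2 fun h => by subst h; exact i₀.elim0
  rw [abs_mul, abs_of_nonneg (inv_nonneg.2 hε.le), ENNReal.ofReal_mul (inv_nonneg.2 hε.le)]
  have h1 := setLIntegral_cubeCoef_le T i₀ hn hε ((H.locInt_approx ε hε).mono_set hUΩ)
  have h2 : ENNReal.ofReal |∫ y, φ y * cubeCoef i₀ T ε (F ε) y| ≤
      ∫⁻ y in erosion U (n * ε), ENNReal.ofReal |cubeCoef i₀ T ε (F ε) y| := by
    rw [← Real.norm_eq_abs, ofReal_norm]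
    refine (enorm_integral_le_lintegral_enorm _).trans ?_
    rw [← lintegral_indicator isOpen_erosion.measurableSet]
    refine lintegral_mono fun y => ?_
    by_cases hy : y ∈ erosion U (n * ε)
    · rw [Set.indicator_of_mem hy, ← ofReal_norm, Real.norm_eq_abs, abs_mul]
      exact ENNReal.ofReal_le_ofReal (mul_le_of_le_one_left (abs_nonneg _) (hφ y))
    · rw [image_eq_zero_of_notMem_tsupport fun h => hy (hU h)]
      simp
  calc _ ≤ ENNReal.ofReal ε⁻¹ * (ENNReal.ofReal ε * kappa n ε (F ε) U) := by
        gcongr; exact h2.trans h1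
    _ = kappa n ε (F ε) U := by
        rw [← mul_assoc, ← ENNReal.ofReal_mul (inv_nonneg.2 hε.le), inv_mul_cancel₀ hε.ne']
        simp

lemma eventually_tsupport_subset_erosion {U K : Set (Euc n)} (hK : IsCompact K) (hU : IsOpen U)
    (hKU : K ⊆ U) : ∀ᶠ ε in 𝓝[>] (0 : ℝ), K ⊆ erosion U (n * ε) := by
  obtain ⟨δ, hδ, h⟩ := exists_subset_erosion hK hU hKU
  have h0 : Tendsto (fun ε : ℝ => n * ε) (𝓝 0) (𝓝 (n * 0)) :=
    (continuous_const.mul continuous_id).tendsto 0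
  rw [mul_zero] at h0
  filter_upwards [(h0.mono_left nhdsWithin_le_nhds).eventually (gt_mem_nhds hδ)] with ε hε
  exact h _ hε

lemma exists_linearIsometryEquiv_apply_single (i₀ : Fin n) {ν : Euc n} (hν : ‖ν‖ = 1) :
    ∃ T : Euc n ≃ₗᵢ[ℝ] Euc n, T (EuclideanSpace.single i₀ 1) = ν := by
  refine ⟨(ℝ ∙ (EuclideanSpace.single i₀ 1 - ν))ᗮ.reflection, ?_⟩
  exact Submodule.reflection_sub (by simp [hν])

lemma ofReal_abs_integral_fderiv_le (H : LocUnifConv n F f Ω) (i₀ : Fin n) {ν : Euc n}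
    (hν : ‖ν‖ = 1) {U : Set (Euc n)} (hU : IsOpen U) (hUΩ : U ⊆ Ω) {φ : Euc n → ℝ}
    (hφ : ContDiff ℝ 1 φ) (hφc : HasCompactSupport φ) (hφU : tsupport φ ⊆ U)
    (hφ1 : ∀ x, |φ x| ≤ 1) :
    ENNReal.ofReal (1 / 4 * |∫ x in Ω, f x * fderiv ℝ φ x ν|) ≤ liminfKappa n F U := by
  obtain ⟨T, hT⟩ := exists_linearIsometryEquiv_apply_single i₀ hν
  have h := tendsto_integral_mul_cubeCoef H i₀ T hφ hφc (hφU.trans hUΩ)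
  rw [hT] at h
  have h2 := (ENNReal.continuous_ofReal.tendsto _).comp h.abs
  have h3 : ENNReal.ofReal (1 / 4 * |∫ x in Ω, f x * fderiv ℝ φ x ν|) =
      ENNReal.ofReal |-(1 / 4) * ∫ x in Ω, f x * fderiv ℝ φ x ν| := by
    rw [abs_mul]; norm_num
  rw [h3, ← h2.liminf_eq]
  refine liminf_le_liminf ?_
  filter_upwards [eventually_tsupport_subset_erosion hφc.isCompact hU hφU, self_mem_nhdsWithin]
    with ε h1 hε
  exact ofReal_abs_integral_mul_cubeCoef_le H i₀ T hφ1 h1 hUΩ hε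

end Limit

section WeakLimit

open CompactlySupported

variable {n : ℕ}

/-- Uniformly bounded measures have a vague limit along every ultrafilter. -/
lemma exists_vague_limit {ι : Type*} (𝒰 : Ultrafilter ι) (m : ι → Measure (Euc n)) {C : ℝ≥0∞}
    (hC : C ≠ ⊤) (hm : ∀ᶠ i in (𝒰 : Filter ι), m i Set.univ ≤ C) :
    ∃ m₀ : Measure (Euc n), IsFiniteMeasure m₀ ∧ ∀ ψ : Euc n → ℝ, Continuous ψ →
      HasCompactSupport ψ →
      Tendsto (fun i => ∫ x, ψ x ∂(m i)) 𝒰 (𝓝 (∫ x, ψ x ∂m₀)) := by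
  have hbdd : ∀ ψ : C_c(Euc n, ℝ), ∀ B : ℝ, (∀ x, ‖ψ x‖ ≤ B) →
      ∀ᶠ i in (𝒰 : Filter ι), ‖∫ x, ψ x ∂(m i)‖ ≤ B * C.toReal := by
    intro ψ B hB
    filter_upwards [hm] with i hi
    have : IsFiniteMeasure (m i) := ⟨hi.trans_lt hC.lt_top⟩
    refine (norm_integral_le_of_norm_le_const (Eventually.of_forall hB)).trans ?_
    have hB0 : 0 ≤ B := (norm_nonneg _).trans (hB 0)
    exact mul_le_mul_of_nonneg_left (ENNReal.toReal_mono hC hi) hB0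
  have hex : ∀ ψ : C_c(Euc n, ℝ), ∃ l : ℝ, Tendsto (fun i => ∫ x, ψ x ∂(m i)) 𝒰 (𝓝 l) := by
    intro ψ
    obtain ⟨B, hB⟩ := ψ.continuous.bounded_above_of_compact_support ψ.hasCompactSupport
    have h1 : (𝒰.map fun i => ∫ x, ψ x ∂(m i) : Filter ℝ) ≤ 𝓟 (closedBall 0 (B * C.toReal)) := by
      rw [le_principal_iff]
      change ∀ᶠ i in (𝒰 : Filter ι), ∫ x, ψ x ∂(m i) ∈ closedBall (0 : ℝ) (B * C.toReal)
      filter_upwards [hbdd ψ B hB] with i hi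
      simpa using hi
    obtain ⟨l, -, hl⟩ := (isCompact_closedBall (0 : ℝ) (B * C.toReal)).ultrafilter_le_nhds _ h1
    exact ⟨l, hl⟩
  choose Λ hΛ using hex
  have hInt : ∀ ψ : C_c(Euc n, ℝ), ∀ᶠ i in (𝒰 : Filter ι), Integrable ψ (m i) := by
    intro ψ
    filter_upwards [hm] with i hi
    have : IsFiniteMeasure (m i) := ⟨hi.trans_lt hC.lt_top⟩
    exact ψ.continuous.integrable_of_hasCompactSupport ψ.hasCompactSupport
  let L : C_c(Euc n, ℝ) →ₗ[ℝ] ℝ :=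
    { toFun := Λ
      map_add' := fun φ ψ => by
        refine tendsto_nhds_unique (hΛ _) (((hΛ φ).add (hΛ ψ)).congr' ?_)
        filter_upwards [hInt φ, hInt ψ] with i h1 h2
        simp only [CompactlySupportedContinuousMap.add_apply]
        rw [integral_add h1 h2]
      map_smul' := fun c ψ => by
        refine tendsto_nhds_unique (hΛ _) (((hΛ ψ).const_mul c).congr fun i => ?_)
        simp only [CompactlySupportedContinuousMap.smul_apply, smul_eq_mul]
        rw [integral_const_mul] }
  let P : C_c(Euc n, ℝ) →ₚ[ℝ] ℝ := PositiveLinearMap.mk₀ L fun ψ hψ =>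
    ge_of_tendsto' (hΛ ψ) fun i => integral_nonneg hψ
  have hP : ∀ ψ, P ψ = Λ ψ := fun ψ => rfl
  refine ⟨RealRMK.rieszMeasure P, ⟨?_⟩, fun ψ h1 h2 => ?_⟩
  · have hball : ∀ N : ℕ, RealRMK.rieszMeasure P (closedBall 0 N) ≤ C := by
      intro N
      obtain ⟨φ, hφ1, -, hφc, hφI⟩ := exists_continuous_one_zero_of_isCompact
        (isCompact_closedBall (0 : Euc n) N) isClosed_empty (Set.disjoint_empty _)
      refine (RealRMK.rieszMeasure_le_of_eq_one P (f := ⟨φ, hφc⟩) (fun x => (hφI x).1)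
        (isCompact_closedBall _ _) hφ1).trans ?_
      refine ENNReal.ofReal_le_of_le_toReal ?_
      refine (le_abs_self _).trans (le_of_tendsto (hΛ ⟨φ, hφc⟩).abs ?_)
      filter_upwards [hbdd ⟨φ, hφc⟩ 1 fun x => by
        exact (Real.norm_of_nonneg (hφI x).1).le.trans (hφI x).2] with i hi
      simpa using hi
    have hU : (Set.univ : Set (Euc n)) = ⋃ N : ℕ, closedBall 0 N := (iUnion_closedBall_nat 0).symm
    rw [hU, Monotone.measure_iUnion]
    · exact (iSup_le hball).trans_lt hC.lt_top
    · intro a b hab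
      exact closedBall_subset_closedBall (by exact_mod_cast hab)
  · have := RealRMK.integral_rieszMeasure P ⟨⟨ψ, h1⟩, h2⟩
    rw [hP] at this
    have h3 := hΛ ⟨⟨ψ, h1⟩, h2⟩
    rw [← this] at h3
    exact h3

end WeakLimit

section Riesz

/-- A linear functional dominated by the seminorm induced from a Hilbert space is represented by a
vector of that space. -/
lemma exists_inner_eq_of_abs_le {V H : Type*} [AddCommGroup V] [Module ℝ V]
    [NormedAddCommGroup H] [InnerProductSpace ℝ H] [CompleteSpace H] (J : V →ₗ[ℝ] H)
    (l : V →ₗ[ℝ] ℝ) {C : ℝ} (hC : ∀ v, |l v| ≤ C * ‖J v‖) :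
    ∃ g : H, ∀ v, l v = ⟪g, J v⟫ := by
  have hker : LinearMap.ker J ≤ LinearMap.ker l := by
    intro v hv
    have h := hC v
    rw [LinearMap.mem_ker.1 hv, norm_zero, mul_zero] at h
    exact LinearMap.mem_ker.2 (abs_nonpos_iff.1 h)
  let e := J.quotKerEquivRange
  let l₁ : LinearMap.range J →ₗ[ℝ] ℝ := ((LinearMap.ker J).liftQ l hker) ∘ₗ e.symm.toLinearMap
  have hl₁ : ∀ v, l₁ ⟨J v, v, rfl⟩ = l v := by
    intro v
    have : e.symm ⟨J v, v, rfl⟩ = (LinearMap.ker J).mkQ v := by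
      rw [LinearEquiv.symm_apply_eq]
      rfl
    simp [l₁, this]
  let l₂ : StrongDual ℝ (LinearMap.range J) := l₁.mkContinuous C (by
    rintro ⟨_, v, rfl⟩
    rw [hl₁]
    exact hC v)
  obtain ⟨l₃, hl₃, -⟩ := _root_.exists_extension_norm_eq (LinearMap.range J) l₂
  refine ⟨(InnerProductSpace.toDual ℝ H).symm l₃, fun v => ?_⟩
  rw [InnerProductSpace.toDual_symm_apply, ← hl₁ v]
  exact (hl₃ ⟨J v, v, rfl⟩).symm

end Riesz

section Existence

variable {n : ℕ} {F : ℝ → Euc n → ℝ} {f : Euc n → ℝ} {Ω : Set (Euc n)}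

lemma integrableOn_mul_of_hasCompactSupport (hf : LocallyIntegrableOn f Ω) {h : Euc n → ℝ}
    (hh : Continuous h) (hc : HasCompactSupport h) (hΩ : tsupport h ⊆ Ω) :
    IntegrableOn (fun x => f x * h x) Ω := by
  obtain ⟨C, hC⟩ := hh.bounded_above_of_compact_support hc
  have h1 : IntegrableOn f (tsupport h) :=
    hf.integrableOn_compact_subset hΩ hc.isCompact
  have h2 : IntegrableOn (fun x => f x * h x) (tsupport h) :=
    Integrable.mul_bdd (c := C) h1 hh.aestronglyMeasurable (Eventually.of_forall hC)
  have h3 : IntegrableOn (fun x => f x * h x) Set.univ :=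
    h2.of_forall_sdiff_eq_zero MeasurableSet.univ fun x hx => by
      rw [image_eq_zero_of_notMem_tsupport hx.2, mul_zero]
  exact h3.mono_set (Set.subset_univ _)

lemma integrableOn_mul_fderiv (hf : LocallyIntegrableOn f Ω) {φ : Euc n → ℝ}
    (hφ : ContDiff ℝ 1 φ) (hφc : HasCompactSupport φ) (hφΩ : tsupport φ ⊆ Ω) (ν : Euc n) :
    IntegrableOn (fun x => f x * fderiv ℝ φ x ν) Ω :=
  integrableOn_mul_of_hasCompactSupport hf
    ((hφ.continuous_fderiv one_ne_zero).clm_apply continuous_const)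
    (hφc.fderiv_apply ℝ ν) ((tsupport_fderiv_apply_subset ℝ ν).trans hφΩ)

lemma exists_measure_bound (H : LocUnifConv n F f Ω) (hfin : liminfKappa n F Ω ≠ ⊤) (i₀ : Fin n)
    {ν : Euc n} (hν : ‖ν‖ = 1) :
    ∃ m : Measure (Euc n), IsFiniteMeasure m ∧ ∀ φ : Euc n → ℝ, ContDiff ℝ 1 φ →
      HasCompactSupport φ → tsupport φ ⊆ Ω →
      |∫ x in Ω, f x * fderiv ℝ φ x ν| ≤ 4 * ∫ x, |φ x| ∂m := by
  obtain ⟨T, hT⟩ := exists_linearIsometryEquiv_apply_single i₀ hν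
  have hn : 1 ≤ n := Nat.one_le_iff_ne_zero.2 fun h => by subst h; exact i₀.elim0
  obtain ⟨C, hC1, hC2⟩ := exists_between hfin.lt_top
  have hfr : ∃ᶠ ε in 𝓝[>] (0 : ℝ), kappa n ε (F ε) Ω ≤ C :=
    (frequently_lt_of_liminf_lt (by isBoundedDefault) hC1).mono fun _ h => le_of_lt h
  have hne : NeBot (𝓝[>] (0 : ℝ) ⊓ 𝓟 {ε | kappa n ε (F ε) Ω ≤ C}) :=
    frequently_mem_iff_neBot.1 hfr
  set 𝒰 : Ultrafilter ℝ := Ultrafilter.of (𝓝[>] (0 : ℝ) ⊓ 𝓟 {ε | kappa n ε (F ε) Ω ≤ C})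
  have hU1 : (𝒰 : Filter ℝ) ≤ 𝓝[>] 0 := (Ultrafilter.of_le _).trans inf_le_left
  have hU2 : ∀ᶠ ε in (𝒰 : Filter ℝ), kappa n ε (F ε) Ω ≤ C :=
    le_principal_iff.1 ((Ultrafilter.of_le _).trans inf_le_right)
  have hA : ∀ ε : ℝ, 0 < ε → ∃ A : Euc n → ℝ, Measurable A ∧
      ∀ y, rotCube T ε y ⊆ Ω → cubeCoef i₀ T ε (F ε) y = A y := fun ε hε =>
    exists_measurable_eq_cubeCoef T i₀ hε (H.locInt_approx ε hε)
  choose! A hAm hAe using hA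
  have hAe' : ∀ ε : ℝ, 0 < ε → ∀ y ∈ erosion Ω (n * ε), cubeCoef i₀ T ε (F ε) y = A ε y :=
    fun ε hε y hy => hAe ε hε y
      ((rotCube_subset_closedBall T y hε).trans (closedBall_subset_of_mem_erosion hy))
  obtain ⟨m, hm, hmt⟩ := exists_vague_limit 𝒰
    (fun ε => (volume.restrict (erosion Ω (n * ε))).withDensity
      fun y => ENNReal.ofReal (ε⁻¹ * |A ε y|)) hC2.ne (by
    filter_upwards [hU1 self_mem_nhdsWithin, hU2] with ε hε hk
    have hε : 0 < ε := hε
    rw [withDensity_apply _ MeasurableSet.univ, Measure.restrict_univ]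
    simp_rw [ENNReal.ofReal_mul (inv_nonneg.2 hε.le)]
    rw [lintegral_const_mul' _ _ ENNReal.ofReal_ne_top]
    have h1 := setLIntegral_cubeCoef_le T i₀ hn hε (H.locInt_approx ε hε)
    rw [setLIntegral_congr_fun (g := fun y => ENNReal.ofReal |A ε y|)
      isOpen_erosion.measurableSet fun y hy => by simp only [hAe' ε hε y hy]] at h1
    calc _ ≤ ENNReal.ofReal ε⁻¹ * (ENNReal.ofReal ε * kappa n ε (F ε) Ω) := by gcongr
      _ = kappa n ε (F ε) Ω := by
        rw [← mul_assoc, ← ENNReal.ofReal_mul (inv_nonneg.2 hε.le), inv_mul_cancel₀ hε.ne']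
        simp
      _ ≤ C := hk)
  refine ⟨m, hm, fun φ hφ hφc hφΩ => ?_⟩
  have h1 := (tendsto_integral_mul_cubeCoef H i₀ T hφ hφc hφΩ).abs.mono_left hU1
  have h2 := hmt (fun x => |φ x|) hφ.continuous.abs hφc.abs
  rw [hT] at h1
  have h3 := le_of_tendsto_of_tendsto h1 h2 ?_
  · rw [abs_mul] at h3
    norm_num at h3
    linarith
  · filter_upwards [hU1 self_mem_nhdsWithin,
      hU1 (eventually_tsupport_subset_erosion hφc.isCompact H.isOpen hφΩ)] with ε hε hs
    have hε : 0 < ε := hε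
    have hs : tsupport φ ⊆ erosion Ω (n * ε) := hs
    rw [integral_withDensity_eq_integral_toReal_smul
      (((hAm ε hε).abs.const_mul _).ennreal_ofReal)
      (Eventually.of_forall fun _ => ENNReal.ofReal_lt_top)]
    have h4 : ∫ y, φ y * cubeCoef i₀ T ε (F ε) y =
        ∫ y in erosion Ω (n * ε), φ y * A ε y := by
      rw [← setIntegral_eq_integral_of_forall_compl_eq_zero (s := erosion Ω (n * ε))]
      · exact setIntegral_congr_fun isOpen_erosion.measurableSet fun y hy => by
          simp only [hAe' ε hε y hy]
      · intro y hy
        rw [image_eq_zero_of_notMem_tsupport fun h => hy (hs h), zero_mul]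
    rw [h4, ← integral_const_mul, ← Real.norm_eq_abs]
    refine (norm_integral_le_integral_norm _).trans (le_of_eq ?_)
    refine integral_congr_ae (Eventually.of_forall fun y => ?_)
    have h5 : 0 ≤ ε⁻¹ * |A ε y| := by positivity
    simp only [smul_eq_mul, Real.norm_eq_abs, abs_mul, abs_of_pos (inv_pos.2 hε),
      ENNReal.toReal_ofReal h5]
    ring

lemma integral_abs_le_mul_norm_toLp {m : Measure (Euc n)} [IsFiniteMeasure m] {φ : Euc n → ℝ}
    (hφ : MemLp φ 2 m) :
    ∫ x, |φ x| ∂m ≤ (m Set.univ ^ (1 / 2 : ℝ)).toReal * ‖hφ.toLp φ‖ := by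
  have h := eLpNorm_le_eLpNorm_mul_rpow_measure_univ (μ := m) (p := 1) (q := 2) (by norm_num) hφ.1
  have h1 : ∫ x, |φ x| ∂m = (eLpNorm φ 1 m).toReal := by
    rw [eLpNorm_one_eq_lintegral_enorm]
    exact integral_norm_eq_lintegral_enorm hφ.1
  rw [h1, Lp.norm_toLp, mul_comm, ← ENNReal.toReal_mul]
  have hfin : m Set.univ ^ (1 / 2 : ℝ) ≠ ⊤ :=
    ENNReal.rpow_ne_top_of_nonneg (by norm_num) (measure_ne_top _ _)
  refine ENNReal.toReal_mono (ENNReal.mul_ne_top hφ.2.ne hfin) (h.trans (le_of_eq ?_))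
  norm_num

/-- The space of `C¹` functions with compact support in `Ω`. -/
def testSpace (Ω : Set (Euc n)) : Submodule ℝ (Euc n → ℝ) where
  carrier := {φ | ContDiff ℝ 1 φ ∧ HasCompactSupport φ ∧ tsupport φ ⊆ Ω}
  add_mem' := fun {φ ψ} hφ hψ => ⟨hφ.1.add hψ.1, hφ.2.1.add hψ.2.1,
    (tsupport_add φ ψ).trans (Set.union_subset hφ.2.2 hψ.2.2)⟩
  zero_mem' := ⟨contDiff_const, HasCompactSupport.zero, by simp [tsupport]⟩
  smul_mem' := fun c φ hφ => ⟨contDiff_const.smul hφ.1, hφ.2.1.smul_left,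
    (tsupport_smul_subset_right (fun _ => c) φ).trans hφ.2.2⟩

lemma exists_density_of_bound (hf : LocallyIntegrableOn f Ω) {ν : Euc n} {m : Measure (Euc n)}
    [IsFiniteMeasure m]
    (hm : ∀ φ : Euc n → ℝ, ContDiff ℝ 1 φ → HasCompactSupport φ → tsupport φ ⊆ Ω →
      |∫ x in Ω, f x * fderiv ℝ φ x ν| ≤ 4 * ∫ x, |φ x| ∂m) :
    ∃ g : Euc n → ℝ, StronglyMeasurable g ∧ MemLp g 2 m ∧
      ∀ φ : Euc n → ℝ, ContDiff ℝ 1 φ → HasCompactSupport φ → tsupport φ ⊆ Ω →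
      ∫ x in Ω, f x * fderiv ℝ φ x ν = ∫ x, φ x * g x ∂m := by
  have hmem : ∀ φ : testSpace Ω, MemLp (φ : Euc n → ℝ) 2 m := fun φ =>
    φ.2.1.continuous.memLp_of_hasCompactSupport φ.2.2.1
  have hInt : ∀ φ : testSpace Ω, IntegrableOn (fun x => f x * fderiv ℝ φ x ν) Ω := fun φ =>
    integrableOn_mul_fderiv hf φ.2.1 φ.2.2.1 φ.2.2.2 ν
  let J : testSpace Ω →ₗ[ℝ] Lp ℝ 2 m :=
    { toFun := fun φ => (hmem φ).toLp φ
      map_add' := fun φ ψ => MemLp.toLp_add (hmem φ) (hmem ψ)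
      map_smul' := fun c φ => MemLp.toLp_const_smul c (hmem φ) }
  have hd : ∀ φ : testSpace Ω, ∀ x, DifferentiableAt ℝ (φ : Euc n → ℝ) x := fun φ x =>
    φ.2.1.differentiable one_ne_zero x
  let l : testSpace Ω →ₗ[ℝ] ℝ :=
    { toFun := fun φ => ∫ x in Ω, f x * fderiv ℝ φ x ν
      map_add' := fun φ ψ => by
        rw [← integral_add (hInt φ) (hInt ψ)]
        refine integral_congr_ae (Eventually.of_forall fun x => ?_)
        simp only [Submodule.coe_add]
        rw [fderiv_add (hd φ x) (hd ψ x), add_apply, mul_add]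
      map_smul' := fun c φ => by
        rw [RingHom.id_apply, smul_eq_mul, ← integral_const_mul]
        refine integral_congr_ae (Eventually.of_forall fun x => ?_)
        simp only [Submodule.coe_smul]
        rw [fderiv_const_smul (hd φ x), smul_apply, smul_eq_mul]
        ring }
  obtain ⟨g, hg⟩ := exists_inner_eq_of_abs_le J l
    (C := 4 * (m Set.univ ^ (1 / 2 : ℝ)).toReal) fun φ => by
      rw [mul_assoc]
      refine (hm φ φ.2.1 φ.2.2.1 φ.2.2.2).trans ?_
      gcongr
      exact integral_abs_le_mul_norm_toLp (hmem φ)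
  refine ⟨g, Lp.stronglyMeasurable g, Lp.memLp g, fun φ h1 h2 h3 => ?_⟩
  have h := hg ⟨φ, h1, h2, h3⟩
  change ∫ x in Ω, f x * fderiv ℝ φ x ν = _ at h
  rw [h, L2.inner_def]
  refine integral_congr_ae ?_
  filter_upwards [(hmem ⟨φ, h1, h2, h3⟩).coeFn_toLp] with x hx
  change ⟪g x, (hmem ⟨φ, h1, h2, h3⟩).toLp φ x⟫ = _
  rw [hx]
  simp

lemma vdiv_eq_sum {Φ : Euc n → Euc n} (hΦ : ContDiff ℝ 1 Φ) (x : Euc n) :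
    vdiv n Φ x = ∑ i, fderiv ℝ (fun y => Φ y i) x (EuclideanSpace.single i 1) := by
  refine Finset.sum_congr rfl fun i _ => ?_
  have h := ((EuclideanSpace.proj (𝕜 := ℝ) i).hasFDerivAt.comp x
    (hΦ.differentiable one_ne_zero x).hasFDerivAt)
  have h2 : fderiv ℝ (fun y => Φ y i) x = _ := h.fderiv
  rw [h2]
  rfl

theorem exists_isVariationPair (H : LocUnifConv n F f Ω) (hfin : liminfKappa n F Ω ≠ ⊤) :
    ∃ p : Measure (Euc n) × (Euc n → Euc n), IsVariationPair n f Ω p.1 p.2 := by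
  have hex := fun i : Fin n => exists_measure_bound H hfin i
    (ν := EuclideanSpace.single i 1) (by simp)
  choose m₁ hm₁ hb₁ using hex
  set m : Measure (Euc n) := ∑ i, m₁ i with hmdef
  have hb : ∀ i, ∀ φ : Euc n → ℝ, ContDiff ℝ 1 φ → HasCompactSupport φ → tsupport φ ⊆ Ω →
      |∫ x in Ω, f x * fderiv ℝ φ x (EuclideanSpace.single i 1)| ≤ 4 * ∫ x, |φ x| ∂m := by
    intro i φ h1 h2 h3
    refine (hb₁ i φ h1 h2 h3).trans ?_
    gcongr
    · exact Eventually.of_forall fun x => abs_nonneg _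
    · exact (h1.continuous.integrable_of_hasCompactSupport h2).abs
    · refine Measure.le_iff.2 fun s _ => ?_
      rw [hmdef, Measure.coe_finsetSum, Finset.sum_apply]
      exact Finset.single_le_sum (f := fun i => m₁ i s) (fun _ _ => zero_le) (Finset.mem_univ i)
  have hex2 := fun i => exists_density_of_bound H.locInt (hb i)
  choose g hgm hg2 hgφ using hex2
  let G : Euc n → Euc n := fun x => WithLp.toLp 2 fun i => g i x
  have hGm : Measurable G := by
    refine (WithLp.measurable_toLp 2 _).comp ?_
    exact measurable_pi_lambda _ fun i => (hgm i).measurable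
  have hGi : Integrable G m := by
    have h1 : Integrable (fun x => ∑ i, ‖g i x‖) m :=
      integrable_finsetSum _ fun i _ => ((hg2 i).integrable (by norm_num)).norm
    refine h1.mono' hGm.aestronglyMeasurable (Eventually.of_forall fun x => ?_)
    have h2 : G x = ∑ i, g i x • EuclideanSpace.single i (1 : ℝ) := by
      have := (EuclideanSpace.basisFun (Fin n) ℝ).sum_repr (G x)
      simpa using this.symm
    rw [h2]
    refine (norm_sum_le _ _).trans (le_of_eq (Finset.sum_congr rfl fun i _ => ?_))
    rw [norm_smul]; simp
  have hGn : Measurable fun x => ‖G x‖ₑ := hGm.enorm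
  refine ⟨⟨(m.restrict Ω).withDensity fun x => ‖G x‖ₑ, fun x => -(‖G x‖⁻¹ • G x)⟩,
    ?_, ?_, ?_, ?_, ?_⟩
  · exact isFiniteMeasure_withDensity (hGi.integrableOn.2).ne
  · refine withDensity_absolutelyContinuous _ _ ?_
    rw [Measure.restrict_apply H.isOpen.measurableSet.compl, Set.compl_inter_self, measure_empty]
  · exact (hGm.norm.inv.smul hGm).neg.aestronglyMeasurable
  · rw [ae_withDensity_iff hGn]
    refine Eventually.of_forall fun x hx => ?_
    have : ‖G x‖ ≠ 0 := fun h => hx (by rw [enorm_eq_zero]; exact norm_eq_zero.1 h)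
    simp only [norm_neg, norm_smul, norm_inv, norm_norm]
    exact inv_mul_cancel₀ this
  · intro Φ h1 h2 h3
    have hsup : ∀ i, tsupport (fun y => Φ y i) ⊆ tsupport Φ := fun i =>
      closure_mono fun x hx => fun h => hx (by simp only [h]; rfl)
    have hcd : ∀ i, ContDiff ℝ 1 (fun y => Φ y i) := fun i =>
      (contDiff_euclidean.1 h1) i
    have hcs : ∀ i, HasCompactSupport (fun y => Φ y i) := fun i =>
      h2.mono' ((subset_tsupport _).trans (hsup i))
    have hi1 : ∀ i, IntegrableOn
        (fun x => f x * fderiv ℝ (fun y => Φ y i) x (EuclideanSpace.single i 1)) Ω := fun i =>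
      integrableOn_mul_fderiv H.locInt (hcd i) (hcs i) ((hsup i).trans h3) _
    have hi2 : ∀ i, Integrable (fun x => Φ x i * g i x) m := fun i => by
      obtain ⟨C, hC⟩ := (hcd i).continuous.bounded_above_of_compact_support (hcs i)
      exact Integrable.bdd_mul (c := C) ((hg2 i).integrable (by norm_num))
        (hcd i).continuous.aestronglyMeasurable (Eventually.of_forall hC)
    simp_rw [vdiv_eq_sum h1, Finset.mul_sum]
    rw [integral_finsetSum _ fun i _ => hi1 i]
    simp_rw [hgφ _ _ (hcd _) (hcs _) ((hsup _).trans h3)]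
    rw [← integral_finsetSum _ fun i _ => hi2 i,
      integral_withDensity_eq_integral_toReal_smul hGn
        (Eventually.of_forall fun _ => enorm_lt_top),
      ← setIntegral_eq_integral_of_forall_compl_eq_zero (s := Ω), ← integral_neg]
    · refine integral_congr_ae (Eventually.of_forall fun x => ?_)
      have hin : ⟪Φ x, G x⟫ = ∑ i, Φ x i * g i x := by
        simp [PiLp.inner_apply, G, mul_comm]
      simp only [inner_neg_right, inner_smul_right, toReal_enorm, smul_eq_mul, hin]
      by_cases h0 : ‖G x‖ = 0
      · have : G x = 0 := norm_eq_zero.1 h0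
        rw [this, inner_zero_right] at hin
        rw [← hin, h0]; simp
      · field_simp
    · intro x hx
      have : Φ x = 0 := image_eq_zero_of_notMem_tsupport fun h => hx (h3 h)
      simp [this]

end Existence

section Directional

variable {n : ℕ} {F : ℝ → Euc n → ℝ} {f : Euc n → ℝ} {Ω : Set (Euc n)} {μ : Measure (Euc n)}
  {σ : Euc n → Euc n}

lemma exists_contDiff_bump {C U : Set (Euc n)} (hC : IsCompact C) (hU : IsOpen U) (hCU : C ⊆ U) :
    ∃ φ : Euc n → ℝ, ContDiff ℝ 1 φ ∧ HasCompactSupport φ ∧ tsupport φ ⊆ U ∧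
      (∀ x, 0 ≤ φ x ∧ φ x ≤ 1) ∧ ∀ x ∈ C, φ x = 1 := by
  obtain ⟨K, hK, hCK, hKU⟩ := exists_compact_between hC hU hCU
  obtain ⟨φ, h1, h2, h3, h4⟩ := exists_contMDiff_support_eq_eq_one_iff (n := 1)
    (modelWithCornersSelf ℝ (Euc n)) (isOpen_interior (s := K)) hC.isClosed hCK
  have hts : tsupport φ ⊆ K := by
    rw [tsupport, h3]
    exact closure_minimal interior_subset hK.isClosed
  exact ⟨φ, h1.contDiff, hK.of_isClosed_subset (isClosed_tsupport _) hts, hts.trans hKU,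
    fun x => h2 ⟨x, rfl⟩, fun x hx => (h4 x).1 hx⟩

lemma vdiv_smul_const {φ : Euc n → ℝ} (hφ : ContDiff ℝ 1 φ) (ν x : Euc n) :
    vdiv n (fun y => φ y • ν) x = fderiv ℝ φ x ν := by
  have h1 : ∀ i, fderiv ℝ (fun y => (φ y • ν) i) x (EuclideanSpace.single i 1) =
      ν i * fderiv ℝ φ x (EuclideanSpace.single i 1) := by
    intro i
    have : (fun y => (φ y • ν) i) = fun y => φ y * ν i := rfl
    rw [this, fderiv_mul_const (hφ.differentiable one_ne_zero x), smul_apply, smul_eq_mul]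
  rw [vdiv_eq_sum (Φ := fun y => φ y • ν) (hφ.smul contDiff_const)]
  simp_rw [h1]
  have h2 : ν = ∑ i, ν i • EuclideanSpace.single i (1 : ℝ) := by
    have := (EuclideanSpace.basisFun (Fin n) ℝ).sum_repr ν
    simpa using this.symm
  conv_rhs => rw [h2, map_sum]
  simp only [map_smul, smul_eq_mul]

lemma IsVariationPair.exists_stronglyMeasurable (h : IsVariationPair n f Ω μ σ) :
    ∃ σ' : Euc n → Euc n, StronglyMeasurable σ' ∧ IsVariationPair n f Ω μ σ' := by
  obtain ⟨h1, h2, h3, h4, h5⟩ := h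
  refine ⟨h3.mk σ, h3.stronglyMeasurable_mk, h1, h2,
    h3.stronglyMeasurable_mk.aestronglyMeasurable, ?_, fun Φ a b c => ?_⟩
  · filter_upwards [h3.ae_eq_mk, h4] with x hx hx2
    rwa [← hx]
  · rw [h5 Φ a b c]
    congr 1
    refine integral_congr_ae ?_
    filter_upwards [h3.ae_eq_mk] with x hx
    rw [← hx]

lemma IsVariationPair.integral_fderiv (h : IsVariationPair n f Ω μ σ) {φ : Euc n → ℝ}
    (hφ : ContDiff ℝ 1 φ) (hφc : HasCompactSupport φ) (hφΩ : tsupport φ ⊆ Ω) (ν : Euc n) :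
    ∫ x in Ω, f x * fderiv ℝ φ x ν = -∫ x, φ x * ⟪ν, σ x⟫ ∂μ := by
  have h5 := h.2.2.2.2 (fun y => φ y • ν) (hφ.smul contDiff_const)
    hφc.smul_right ((tsupport_smul_subset_left φ _).trans hφΩ)
  simp_rw [vdiv_smul_const hφ, real_inner_smul_left] at h5
  exact h5

lemma IsVariationPair.integrable_inner (h : IsVariationPair n f Ω μ σ) {ν : Euc n} (hν : ‖ν‖ = 1) :
    Integrable (fun x => ⟪ν, σ x⟫) μ := by
  have := h.1
  refine (integrable_const (1 : ℝ)).mono' (h.2.2.1.const_inner) ?_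
  filter_upwards [h.2.2.2.1] with x hx
  have := norm_inner_le_norm (𝕜 := ℝ) ν (σ x)
  rwa [hν, hx, one_mul] at this

/-- Lower bound for `∫ φ ⟪ν, σ⟫ dμ` for cut-off functions `φ` of a set on which `σ` is close
to `ν`. -/
lemma IsVariationPair.le_integral_mul_inner (h : IsVariationPair n f Ω μ σ) {ν : Euc n}
    (hν : ‖ν‖ = 1) {D V : Set (Euc n)} (hD : MeasurableSet D) (hV : MeasurableSet V)
    (hDV : D ⊆ V) {η : ℝ}
    (hση : ∀ x ∈ D, 1 - η ≤ ⟪ν, σ x⟫) {φ : Euc n → ℝ} (hφ : Measurable φ)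
    (hφ01 : ∀ x, 0 ≤ φ x ∧ φ x ≤ 1) (hφD : ∀ x ∈ D, φ x = 1) (hφV : ∀ x ∉ V, φ x = 0) :
    (1 - η) * μ.real D - μ.real (V \ D) ≤ ∫ x, φ x * ⟪ν, σ x⟫ ∂μ := by
  have := h.1
  have hi := h.integrable_inner hν
  have hi2 : Integrable (fun x => φ x * ⟪ν, σ x⟫) μ := by
    refine Integrable.bdd_mul (c := 1) hi hφ.aestronglyMeasurable (Eventually.of_forall fun x => ?_)
    rw [Real.norm_of_nonneg (hφ01 x).1]
    exact (hφ01 x).2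
  rw [← setIntegral_eq_integral_of_forall_compl_eq_zero (s := V) fun x hx => by
      rw [hφV x hx, zero_mul],
    ← Set.union_sdiff_cancel hDV,
    setIntegral_union Set.disjoint_sdiff_right (hV.diff hD) hi2.integrableOn hi2.integrableOn,
    Set.union_sdiff_cancel hDV, sub_eq_add_neg]
  refine add_le_add ?_ ?_
  · rw [setIntegral_congr_fun (g := fun x => ⟪ν, σ x⟫) hD fun x hx => by simp only [hφD x hx, one_mul]]
    calc (1 - η) * μ.real D = ∫ x in D, (1 - η) ∂μ := by
          rw [setIntegral_const, smul_eq_mul, mul_comm]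
      _ ≤ _ := setIntegral_mono_on (integrableOn_const (measure_ne_top _ _)) hi.integrableOn hD hση
  · have h1 : ‖∫ x in V \ D, φ x * ⟪ν, σ x⟫ ∂μ‖ ≤ 1 * μ.real (V \ D) := by
      refine norm_setIntegral_le_of_norm_le_const_ae (measure_lt_top _ _) ?_
      filter_upwards [ae_restrict_of_ae h.2.2.2.1] with x hx
      rw [norm_mul, Real.norm_of_nonneg (hφ01 x).1]
      have h2 := norm_inner_le_norm (𝕜 := ℝ) ν (σ x)
      rw [hν, hx, one_mul] at h2
      exact mul_le_one₀ (hφ01 x).2 (norm_nonneg _) h2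
    rw [one_mul] at h1
    exact (abs_le.1 h1).1

lemma ofReal_mul_measure_le_of_forall_pos {c : ℝ} (hc : 0 ≤ c) [IsFiniteMeasure μ] {C : Set (Euc n)}
    {K : ℝ≥0∞} (h : ∀ δ > 0, ENNReal.ofReal (c * μ.real C - δ) ≤ K) :
    ENNReal.ofReal c * μ C ≤ K := by
  have h1 : ENNReal.ofReal c * μ C = ENNReal.ofReal (c * μ.real C) := by
    rw [ENNReal.ofReal_mul hc, Measure.real, ENNReal.ofReal_toReal (measure_ne_top _ _)]
  rw [h1]
  have h2 : Tendsto (fun δ : ℝ => ENNReal.ofReal (c * μ.real C - δ)) (𝓝[>] 0)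
      (𝓝 (ENNReal.ofReal (c * μ.real C))) := by
    have : Continuous fun δ : ℝ => ENNReal.ofReal (c * μ.real C - δ) :=
      ENNReal.continuous_ofReal.comp (by fun_prop)
    have := (this.tendsto 0).mono_left (nhdsWithin_le_nhds (s := Set.Ioi 0))
    rwa [sub_zero] at this
  exact le_of_tendsto h2 (eventually_mem_nhdsWithin.mono fun δ hδ => h δ hδ)

/-- On sets where `σ` is nearly constant, `κ` controls a quarter of the total variation. -/
lemma IsVariationPair.quarter_measure_le (H : LocUnifConv n F f Ω) (hp : IsVariationPair n f Ω μ σ)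
    (i₀ : Fin n) {ν : Euc n} (hν : ‖ν‖ = 1) {C U : Set (Euc n)} (hC : IsCompact C)
    (hU : IsOpen U) (hCU : C ⊆ U) (hUΩ : U ⊆ Ω) {η : ℝ} (hη : η ≤ 1)
    (hση : ∀ x ∈ C, 1 - η ≤ ⟪ν, σ x⟫) :
    ENNReal.ofReal (1 / 4 * (1 - η)) * μ C ≤ liminfKappa n F U := by
  have := hp.1
  refine ofReal_mul_measure_le_of_forall_pos (by linarith) fun δ hδ => ?_
  obtain ⟨V₀, hCV₀, hV₀, hV₀C⟩ := C.exists_isOpen_lt_add (measure_ne_top μ C)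
    (ε := ENNReal.ofReal δ) (ENNReal.ofReal_pos.2 hδ).ne'
  obtain ⟨φ, h1, h2, h3, h4, h5⟩ := exists_contDiff_bump hC (hV₀.inter hU)
    (Set.subset_inter hCV₀ hCU)
  have h6 := ofReal_abs_integral_fderiv_le H i₀ hν hU hUΩ h1 h2
    (h3.trans Set.inter_subset_right) fun x => abs_le.2 ⟨by linarith [(h4 x).1], (h4 x).2⟩
  refine le_trans (ENNReal.ofReal_le_ofReal ?_) h6
  rw [hp.integral_fderiv h1 h2 (h3.trans (Set.inter_subset_right.trans hUΩ)), abs_neg]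
  have h7 := hp.le_integral_mul_inner hν hC.measurableSet hV₀.measurableSet hCV₀ hση
    h1.continuous.measurable h4 h5 fun x hx => image_eq_zero_of_notMem_tsupport fun h =>
      hx (h3 h).1
  have h8 : μ.real (V₀ \ C) ≤ δ := by
    rw [measureReal_sdiff hCV₀ hC.measurableSet]
    have : μ.real V₀ ≤ μ.real C + δ := by
      rw [Measure.real, Measure.real, ← ENNReal.toReal_ofReal hδ.le,
        ← ENNReal.toReal_add (measure_ne_top _ _) ENNReal.ofReal_ne_top]
      exact ENNReal.toReal_mono (by finiteness) hV₀C.le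
    linarith
  have h9 := le_abs_self (∫ x, φ x * ⟪ν, σ x⟫ ∂μ)
  linarith

end Directional

section Plateau

/-- A smooth function which is `0` on `(-∞, -δ]` and `1` on `[δ, ∞)`. -/
def smoothStep (δ t : ℝ) : ℝ := Real.smoothTransition ((t + δ) / (2 * δ))

/-- A smooth function supported in `[-1/2 - δ, 1/2 + δ]` whose integer translates sum to `1`. -/
def plateau (δ t : ℝ) : ℝ := smoothStep δ (t + 1 / 2) - smoothStep δ (t - 1 / 2)

variable {δ t : ℝ}

lemma smoothStep_monotone (hδ : 0 < δ) : Monotone (smoothStep δ) := fun s t h =>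
  Real.smoothTransition.monotone (by gcongr)

lemma smoothStep_mem : 0 ≤ smoothStep δ t ∧ smoothStep δ t ≤ 1 :=
  ⟨Real.smoothTransition.nonneg _, Real.smoothTransition.le_one _⟩

lemma smoothStep_eq_zero (hδ : 0 < δ) (ht : t ≤ -δ) : smoothStep δ t = 0 :=
  Real.smoothTransition.zero_of_nonpos (div_nonpos_of_nonpos_of_nonneg (by linarith) (by linarith))

lemma smoothStep_eq_one (hδ : 0 < δ) (ht : δ ≤ t) : smoothStep δ t = 1 :=
  Real.smoothTransition.one_of_one_le ((one_le_div (by linarith)).2 (by linarith))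

lemma contDiff_plateau : ContDiff ℝ 1 (plateau δ) := by
  have h : ContDiff ℝ 1 (smoothStep δ) :=
    (Real.smoothTransition.contDiff (n := 1)).comp
      ((contDiff_id.add contDiff_const).div_const _)
  exact (h.comp (contDiff_id.add contDiff_const)).sub (h.comp (contDiff_id.sub contDiff_const))

lemma plateau_nonneg (hδ : 0 < δ) : 0 ≤ plateau δ t :=
  sub_nonneg.2 (smoothStep_monotone hδ (by linarith))

lemma plateau_le_one : plateau δ t ≤ 1 := by
  have h1 := smoothStep_mem (δ := δ) (t := t + 1 / 2)
  have h2 := smoothStep_mem (δ := δ) (t := t - 1 / 2)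
  unfold plateau
  linarith

lemma plateau_eq_one (hδ : 0 < δ) (hδ' : δ ≤ 1 / 4) (ht : |t| ≤ 1 / 4) : plateau δ t = 1 := by
  rw [abs_le] at ht
  rw [plateau, smoothStep_eq_one hδ (by linarith), smoothStep_eq_zero hδ (by linarith), sub_zero]

lemma abs_lt_of_plateau_ne_zero (hδ : 0 < δ) (h : plateau δ t ≠ 0) : |t| < 1 / 2 + δ := by
  contrapose! h
  rw [plateau]
  rcases le_abs'.1 h with h | h
  · rw [smoothStep_eq_zero hδ (by linarith), smoothStep_eq_zero hδ (by linarith), sub_zero]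
  · rw [smoothStep_eq_one hδ (by linarith), smoothStep_eq_one hδ (by linarith), sub_self]

lemma sum_plateau (M : ℕ) : ∑ j ∈ Finset.Icc (-(M : ℤ)) M, plateau δ (t - j) =
    smoothStep δ (t + M + 1 / 2) - smoothStep δ (t - M - 1 / 2) := by
  induction M with
  | zero => simp [plateau]
  | succ M ih =>
    have h1 : Finset.Icc (-((M + 1 : ℕ) : ℤ)) (M + 1 : ℕ) =
        insert (-((M : ℤ) + 1)) (insert ((M : ℤ) + 1) (Finset.Icc (-(M : ℤ)) M)) := by
      ext j
      simp only [Finset.mem_Icc, Finset.mem_insert]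
      push_cast
      omega
    rw [h1, Finset.sum_insert (by simp; omega), Finset.sum_insert (by simp), ih, plateau, plateau]
    push_cast
    ring_nf

lemma sum_plateau_mem (hδ : 0 < δ) (M : ℕ) :
    0 ≤ ∑ j ∈ Finset.Icc (-(M : ℤ)) M, plateau δ (t - j) ∧
      ∑ j ∈ Finset.Icc (-(M : ℤ)) M, plateau δ (t - j) ≤ 1 := by
  refine ⟨Finset.sum_nonneg fun _ _ => plateau_nonneg hδ, ?_⟩
  rw [sum_plateau]
  have h1 := smoothStep_mem (δ := δ) (t := t + M + 1 / 2)
  have h2 := smoothStep_mem (δ := δ) (t := t - M - 1 / 2)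
  linarith

lemma sum_plateau_eq_one (hδ : 0 < δ) (hδ' : δ ≤ 1 / 4) {M : ℕ} (ht : |t| ≤ M) :
    ∑ j ∈ Finset.Icc (-(M : ℤ)) M, plateau δ (t - j) = 1 := by
  rw [abs_le] at ht
  rw [sum_plateau, smoothStep_eq_one hδ (by linarith), smoothStep_eq_zero hδ (by linarith),
    sub_zero]

/-- A product of plateau functions: a smooth bump adapted to the unit cube. -/
def cubeBump (n : ℕ) (δ : ℝ) (u : Euc n) : ℝ := ∏ i, plateau δ (u i)

variable {n : ℕ} {u : Euc n}

lemma contDiff_cubeBump : ContDiff ℝ 1 (cubeBump n δ) :=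
  contDiff_prod fun i _ => contDiff_plateau.comp (contDiff_piLp_apply (p := 2) (i := i))

lemma cubeBump_mem (hδ : 0 < δ) : 0 ≤ cubeBump n δ u ∧ cubeBump n δ u ≤ 1 :=
  ⟨Finset.prod_nonneg fun _ _ => plateau_nonneg hδ,
    Finset.prod_le_one (fun _ _ => plateau_nonneg hδ) fun _ _ => plateau_le_one⟩

lemma abs_lt_of_cubeBump_ne_zero (hδ : 0 < δ) (h : cubeBump n δ u ≠ 0) (i : Fin n) :
    |u i| < 1 / 2 + δ :=
  abs_lt_of_plateau_ne_zero hδ (Finset.prod_ne_zero_iff.1 h i (Finset.mem_univ i))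

lemma hasCompactSupport_cubeBump (hδ : 0 < δ) : HasCompactSupport (cubeBump n δ) := by
  refine HasCompactSupport.intro (isCompact_closedBall 0 (n * (1 / 2 + δ))) fun u hu => ?_
  by_contra h
  refine hu ?_
  rw [mem_closedBall, dist_zero_right]
  exact euc_norm_le_of_coord_le fun i => (abs_lt_of_cubeBump_ne_zero hδ h i).le

end Plateau

section Step

variable {n : ℕ}

/-- The function jumping from `b` to `a` across the hyperplane through `x` orthogonal to `ν`. -/
def stepFun (ν : Euc n) (a b : ℝ) (x y : Euc n) : ℝ := if 0 < ⟪y - x, ν⟫ then a else b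

lemma measurable_stepFun_uncurry (ν : Euc n) (a b : ℝ) :
    Measurable (fun p : Euc n × Euc n => stepFun ν a b p.1 p.2) := by
  refine Measurable.ite ?_ measurable_const measurable_const
  exact (isOpen_lt continuous_const (by fun_prop)).measurableSet

lemma measurable_stepFun (ν : Euc n) (a b : ℝ) (x : Euc n) : Measurable (stepFun ν a b x) :=
  Measurable.ite (isOpen_lt continuous_const (by fun_prop)).measurableSet measurable_const
    measurable_const

lemma abs_stepFun_le (ν : Euc n) (a b : ℝ) (x y : Euc n) : |stepFun ν a b x y| ≤ max |a| |b| := by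
  unfold stepFun
  split_ifs
  · exact le_max_left _ _
  · exact le_max_right _ _

lemma integrableOn_stepFun (ν : Euc n) (a b : ℝ) (x : Euc n) {s : Set (Euc n)}
    (hs : volume s ≠ ⊤) : IntegrableOn (stepFun ν a b x) s :=
  Measure.integrableOn_of_bounded hs (measurable_stepFun ν a b x).aestronglyMeasurable
    (Eventually.of_forall fun y => abs_stepFun_le ν a b x y)

variable {T : Euc n ≃ₗᵢ[ℝ] Euc n} {i₀ : Fin n} {ν : Euc n}

lemma inner_eq_symm_apply (hT : T (EuclideanSpace.single i₀ 1) = ν) (y : Euc n) :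
    ⟪y, ν⟫ = T.symm y i₀ := by
  rw [← hT, ← T.symm.inner_map_map, T.symm_apply_apply, EuclideanSpace.inner_single_right]
  simp

lemma volume_slab_le (T : Euc n ≃ₗᵢ[ℝ] Euc n) (i₀ : Fin n) (c : Euc n) {r α β : ℝ} (hr : 0 < r) :
    volume {y | (∀ i, |T.symm (y - c) i| < r / 2) ∧ T.symm (y - c) i₀ ∈ Set.Ioc α β} ≤
      ENNReal.ofReal (r ^ (n - 1) * (β - α)) := by
  set I : Fin n → Set ℝ := fun i => if i = i₀ then Set.Ioc α β else Set.Ioo (-(r / 2)) (r / 2)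
    with hI
  have hIm : ∀ i, MeasurableSet (I i) := by
    intro i
    by_cases h : i = i₀
    · simp [hI, h]
    · simp [hI, h]
  have hm : MeasurePreserving (fun y : Euc n => T.symm (y - c)) volume volume :=
    T.symm.measurePreserving.comp (measurePreserving_sub_right volume c)
  have hsub : {y | (∀ i, |T.symm (y - c) i| < r / 2) ∧ T.symm (y - c) i₀ ∈ Set.Ioc α β} ⊆
      (fun y : Euc n => T.symm (y - c)) ⁻¹'
        ((MeasurableEquiv.toLp 2 (Fin n → ℝ)).symm ⁻¹' (Set.univ.pi I)) := by
    rintro y ⟨h1, h2⟩ i -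
    by_cases h : i = i₀
    · subst h
      simpa [hI] using h2
    · simpa [hI, h] using abs_lt.1 (h1 i)
  refine (measure_mono hsub).trans (le_of_eq ?_)
  have hm2 : MeasurableSet (Set.univ.pi I) := MeasurableSet.univ_pi hIm
  rw [hm.measure_preimage
      ((MeasurableEquiv.toLp 2 (Fin n → ℝ)).symm.measurable hm2).nullMeasurableSet,
    (EuclideanSpace.volume_preserving_symm_measurableEquiv_toLp (Fin n)).measure_preimage
      hm2.nullMeasurableSet, volume_pi_pi, ← Finset.mul_prod_erase _ _ (Finset.mem_univ i₀),
    Finset.prod_congr rfl (g := fun _ => ENNReal.ofReal r) fun i hi => by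
      simp [hI, (Finset.mem_erase.1 hi).1]]
  simp only [hI, if_true, Real.volume_Ioc, Finset.prod_const]
  rw [Finset.card_erase_of_mem (Finset.mem_univ _), Finset.card_univ, Fintype.card_fin,
    ENNReal.ofReal_mul (by positivity), ENNReal.ofReal_pow hr.le, mul_comm]

lemma abs_stepFun_sub_le (a b : ℝ) (x y : Euc n) (w : Euc n) :
    |stepFun ν a b x (y - w) - stepFun ν a b x y| ≤
      |a - b| * if ⟪y - x, ν⟫ ∈ Set.Ioc (min 0 ⟪w, ν⟫) (max 0 ⟪w, ν⟫) then 1 else 0 := by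
  have h1 : ⟪y - w - x, ν⟫ = ⟪y - x, ν⟫ - ⟪w, ν⟫ := by
    rw [← inner_sub_left]; congr 1; abel
  unfold stepFun
  rw [h1]
  simp only [Set.mem_Ioc, min_lt_iff, le_max_iff]
  split_ifs with h2 h3 h4 h4 h3 h4 h4 <;> simp only [mul_one, mul_zero, sub_self, abs_zero, le_refl,
    abs_nonneg, abs_sub_comm b a]
  all_goals
    exfalso
    first
    | exact h4 ⟨by first | (left; linarith) | (right; linarith), by first | (left; linarith) | (right; linarith)⟩
    
lemma abs_integral_stepFun_mul_fderiv_le (hT : T (EuclideanSpace.single i₀ 1) = ν) (a b : ℝ)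
    (x c : Euc n) {r : ℝ} (hr : 0 < r) {φ : Euc n → ℝ} (hφ : ContDiff ℝ 1 φ)
    (hφc : HasCompactSupport φ) (hφr : ∀ y, φ y ≠ 0 → y ∈ rotCube T r c) (hφ1 : ∀ y, |φ y| ≤ 1)
    {v : Euc n} (hv : ‖v‖ = 1) :
    |∫ y, stepFun ν a b x y * fderiv ℝ φ y v| ≤ |a - b| * r ^ (n - 1) := by
  have hν : ‖ν‖ = 1 := by rw [← hT]; simp
  set B := ball c (n * r + 2) with hB
  set G := B.indicator (stepFun ν a b x) with hG
  have hGi : Integrable G :=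
    (integrableOn_stepFun ν a b x measure_ball_lt_top.ne).integrable_indicator measurableSet_ball
  obtain ⟨L, hL⟩ := hφ.lipschitzWith_of_hasCompactSupport hφc one_ne_zero
  have hcB : ∀ y, φ y ≠ 0 → dist y c ≤ n * r := fun y hy =>
    mem_closedBall.1 (rotCube_subset_closedBall T c hr (hφr y hy))
  have hlim := LipschitzWith.integral_inv_smul_sub_mul_tendsto_integral_lineDeriv_mul hL hGi v
  have hlim2 : ∫ y, lineDeriv ℝ φ y v * G y = ∫ y, stepFun ν a b x y * fderiv ℝ φ y v := by
    refine integral_congr_ae (Eventually.of_forall fun y => ?_)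
    simp only [(hφ.differentiable one_ne_zero y).lineDeriv_eq_fderiv]
    by_cases hy : y ∈ B
    · rw [hG, Set.indicator_of_mem hy, mul_comm]
    · have : fderiv ℝ φ y = 0 := by
        refine image_eq_zero_of_notMem_tsupport fun h => hy ?_
        have h2 : tsupport φ ⊆ closedBall c (n * r) :=
          closure_minimal (fun z hz => mem_closedBall.2 (hcB z hz)) isClosed_closedBall
        have := mem_closedBall.1 (h2 (tsupport_fderiv_subset ℝ h))
        exact mem_ball.2 (by linarith)
      simp [this]
  rw [hlim2] at hlim
  refine le_of_tendsto hlim.abs ?_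
  have h01 : ∀ᶠ t in 𝓝[>] (0 : ℝ), t < 1 := nhdsWithin_le_nhds (gt_mem_nhds one_pos)
  filter_upwards [h01, eventually_mem_nhdsWithin] with t ht1 ht0
  have ht0 : 0 < t := ht0
  have hφG : ∀ w : Euc n, Integrable (fun y => φ (y + w) * G y) := fun w =>
    Integrable.bdd_mul (c := 1) hGi (hφ.continuous.comp (by fun_prop)).aestronglyMeasurable
      (Eventually.of_forall fun y => hφ1 _)
  have hφG0 : Integrable (fun y => φ y * G y) := by simpa using hφG 0
  have hφG2 : Integrable (fun y => φ y * G (y - t • v)) := by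
    simpa using (hφG (t • v)).comp_sub_right (t • v)
  have h1 : ∫ y, (t⁻¹ • (φ (y + t • v) - φ y)) * G y =
      t⁻¹ * ∫ y, φ y * (G (y - t • v) - G y) := by
    have e1 : ∫ y, φ (y + t • v) * G y = ∫ y, φ y * G (y - t • v) := by
      rw [← integral_sub_right_eq_self _ (t • v)]
      simp
    simp_rw [smul_eq_mul, mul_assoc]
    rw [integral_const_mul]
    simp_rw [sub_mul, mul_sub]
    rw [integral_sub (hφG _) hφG0, e1, integral_sub hφG2 hφG0]
  set m := ⟪c - x, ν⟫
  set S := {y | (∀ i, |T.symm (y - c) i| < r / 2) ∧ T.symm (y - c) i₀ ∈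
    Set.Ioc (min 0 ⟪t • v, ν⟫ - m) (max 0 ⟪t • v, ν⟫ - m)} with hS
  have hSm : MeasurableSet S := by
    refine (isOpen_rotCube T c (ε := r)).measurableSet.inter ?_
    exact measurableSet_Ioc.preimage (f := fun y => T.symm (y - c) i₀)
      (Continuous.measurable (by fun_prop))
  have hpt : ∀ y, ‖φ y * (G (y - t • v) - G y)‖ ≤ S.indicator (fun _ => |a - b|) y := by
    intro y
    by_cases hy : φ y = 0
    · rw [hy, zero_mul, norm_zero]
      exact Set.indicator_nonneg (fun _ _ => abs_nonneg _) _
    · have hyc := hcB y hy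
      have hyB : y ∈ B := mem_ball.2 (by linarith)
      have hyB2 : y - t • v ∈ B := by
        refine mem_ball.2 (lt_of_le_of_lt (dist_triangle _ y _) ?_)
        have : dist (y - t • v) y ≤ 1 := by
          rw [dist_eq_norm, sub_sub_cancel_left, norm_neg, norm_smul, hv,
            Real.norm_of_nonneg ht0.le]
          linarith
        linarith
      rw [hG, Set.indicator_of_mem hyB, Set.indicator_of_mem hyB2, norm_mul]
      have h2 : ‖φ y‖ ≤ 1 := hφ1 y
      refine (mul_le_of_le_one_left (norm_nonneg _) h2).trans
        ((abs_stepFun_sub_le a b x y (t • v)).trans ?_)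
      split_ifs with h3
      · rw [Set.indicator_of_mem, mul_one]
        refine ⟨hφr y hy, ?_⟩
        have h4 : T.symm (y - c) i₀ = ⟪y - x, ν⟫ - m := by
          rw [← inner_eq_symm_apply hT, ← inner_sub_left]
          congr 1; abel
        rw [h4]
        exact ⟨by linarith [h3.1], by linarith [h3.2]⟩
      · rw [mul_zero]
        exact Set.indicator_nonneg (fun _ _ => abs_nonneg _) _
  have hlen : max 0 ⟪t • v, ν⟫ - m - (min 0 ⟪t • v, ν⟫ - m) ≤ t := by
    have h2 : |⟪t • v, ν⟫| ≤ t := by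
      have := abs_real_inner_le_norm (t • v) ν
      rwa [norm_smul, hv, hν, Real.norm_of_nonneg ht0.le, mul_one, mul_one] at this
    have := max_sub_min_eq_abs' (0 : ℝ) ⟪t • v, ν⟫
    rw [zero_sub, abs_neg] at this
    linarith
  have hvol : volume S ≤ ENNReal.ofReal (r ^ (n - 1) * t) :=
    (volume_slab_le T i₀ c hr).trans (ENNReal.ofReal_le_ofReal (by gcongr))
  have hfin : volume S ≠ ⊤ := (hvol.trans_lt ENNReal.ofReal_lt_top).ne
  have h5 : |∫ y, φ y * (G (y - t • v) - G y)| ≤ |a - b| * (r ^ (n - 1) * t) := by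
    refine (norm_integral_le_of_norm_le ((integrableOn_const hfin).integrable_indicator hSm)
      (Eventually.of_forall hpt)).trans ?_
    rw [integral_indicator hSm, setIntegral_const, smul_eq_mul, mul_comm]
    gcongr
    exact ENNReal.toReal_le_of_le_ofReal (by positivity) hvol
  rw [h1, abs_mul, abs_of_pos (inv_pos.2 ht0)]
  calc t⁻¹ * |∫ y, φ y * (G (y - t • v) - G y)| ≤ t⁻¹ * (|a - b| * (r ^ (n - 1) * t)) := by gcongr
    _ = _ := by field_simp

end Step

section Blowup

variable {n : ℕ} {f : Euc n → ℝ} {ν : Euc n} {a b η r₀ : ℝ}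

/-- The points at which `f` is `η`-close, in the mean on all balls of radius less than `r₀`, to
the step function with values `a`, `b` and jump direction `ν`. -/
def blowupSet (f : Euc n → ℝ) (ν : Euc n) (a b η r₀ : ℝ) : Set (Euc n) :=
  {x | ∀ q : ℚ, 0 < (q : ℝ) → (q : ℝ) < r₀ →
    ∫⁻ y in ball x q, ENNReal.ofReal |f y - stepFun ν a b x y| ≤
      ENNReal.ofReal (η * |a - b| * (q : ℝ) ^ n)}

lemma measurableSet_blowupSet (hf : Measurable f) :
    MeasurableSet (blowupSet f ν a b η r₀) := by
  simp only [blowupSet, Set.ofPred_forall]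
  refine MeasurableSet.iInter fun q => MeasurableSet.iInter fun _ => MeasurableSet.iInter fun _ =>
    measurableSet_le ?_ measurable_const
  have h1 : Measurable (fun p : Euc n × Euc n =>
      {p : Euc n × Euc n | dist p.2 p.1 < q}.indicator
        (fun p => ENNReal.ofReal |f p.2 - stepFun ν a b p.1 p.2|) p) := by
    refine Measurable.indicator ?_ (isOpen_lt (by fun_prop) continuous_const).measurableSet
    exact (continuous_abs.measurable.comp ((hf.comp measurable_snd).sub
      (measurable_stepFun_uncurry ν a b))).ennreal_ofReal
  have h2 := h1.lintegral_prod_right' (ν := volume)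
  convert h2 using 2 with x
  rw [← lintegral_indicator measurableSet_ball]
  rfl

lemma lintegral_le_of_mem_blowupSet {x : Euc n} (hx : x ∈ blowupSet f ν a b η r₀) (hη : 0 ≤ η)
    {r : ℝ} (hr : 0 < r) (hr₀ : r < r₀) {s : Set (Euc n)} (hs : s ⊆ ball x r) :
    ∫⁻ y in s, ENNReal.ofReal |f y - stepFun ν a b x y| ≤
      ENNReal.ofReal (η * |a - b| * (2 * r) ^ n) := by
  obtain ⟨q, hq1, hq2⟩ := exists_rat_btwn (show r < min (2 * r) r₀ from lt_min (by linarith) hr₀)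
  have hq : (q : ℝ) < 2 * r := hq2.trans_le (min_le_left _ _)
  have hq0 : 0 < (q : ℝ) := hr.trans hq1
  refine (lintegral_mono_set (hs.trans (ball_subset_ball hq1.le))).trans
    ((hx q hq0 (hq2.trans_le (min_le_right _ _))).trans (ENNReal.ofReal_le_ofReal ?_))
  gcongr

lemma integral_le_of_mem_blowupSet (hf : Measurable f) {x : Euc n}
    (hx : x ∈ blowupSet f ν a b η r₀) (hη : 0 ≤ η)
    {r : ℝ} (hr : 0 < r) (hr₀ : r < r₀) {s : Set (Euc n)} (hs : s ⊆ ball x r) :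
    IntegrableOn (fun y => f y - stepFun ν a b x y) s ∧
      ∫ y in s, |f y - stepFun ν a b x y| ≤ η * |a - b| * (2 * r) ^ n := by
  have h1 := lintegral_le_of_mem_blowupSet hx hη hr hr₀ hs
  have hm : Measurable (fun y => f y - stepFun ν a b x y) := hf.sub (measurable_stepFun ν a b x)
  refine ⟨⟨hm.aestronglyMeasurable, ?_⟩, ?_⟩
  · refine lt_of_le_of_lt ?_ (h1.trans_lt ENNReal.ofReal_lt_top)
    refine lintegral_mono fun y => ?_
    rw [Real.enorm_eq_ofReal_abs]
  · rw [integral_eq_lintegral_of_nonneg_ae (Eventually.of_forall fun y => abs_nonneg _)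
      hm.norm.aestronglyMeasurable]
    exact ENNReal.toReal_le_of_le_ofReal (by positivity) h1

variable {T : Euc n ≃ₗᵢ[ℝ] Euc n} {i₀ : Fin n}

lemma inner_cubeMap_sub (hT : T (EuclideanSpace.single i₀ 1) = ν) (ε : ℝ) (x c u : Euc n) :
    ⟪cubeMap T ε c u - x, ν⟫ = ⟪c - x, ν⟫ + ε * u i₀ := by
  have : cubeMap T ε c u - x = (c - x) + T (ε • u) := by rw [cubeMap]; abel
  rw [this, inner_add_left, inner_eq_symm_apply hT (T (ε • u)), T.symm_apply_apply]
  rfl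

lemma cubeCoef_stepFun (hT : T (EuclideanSpace.single i₀ 1) = ν) (a b : ℝ) {ε : ℝ} (hε : 0 < ε)
    {x c : Euc n} (hxc : ⟪c - x, ν⟫ = 0) :
    cubeCoef i₀ T ε (stepFun ν a b x) c = (a - b) / 2 := by
  have h1 : ∀ u : Euc n, stepFun ν a b x (cubeMap T ε c u) * halfSign (u i₀) =
      (a + b) / 2 * halfSign (u i₀) + (a - b) / 2 := by
    intro u
    rw [stepFun, inner_cubeMap_sub hT, hxc, zero_add, halfSign]
    by_cases h : 0 < u i₀
    · rw [if_pos (by positivity), if_pos h]; ring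
    · rw [if_neg (by nlinarith), if_neg h]; ring
  have h2 : IntegrableOn (fun u : Euc n => halfSign (u i₀)) (unitCube n) := by
    simpa using integrableOn_mul_halfSign i₀ (integrableOn_const (μ := volume) (s := unitCube n)
      (C := (1 : ℝ)) (by rw [volume_unitCube]; exact ENNReal.one_ne_top))
  unfold cubeCoef
  simp_rw [h1]
  rw [integral_add (h2.const_mul _) (integrableOn_const (by rw [volume_unitCube]; simp)),
    integral_const_mul, integral_unitCube_halfSign, setIntegral_const, Measure.real,
    volume_unitCube]
  simp

lemma abs_cubeCoef_sub_le_of_mem_blowupSet (hT : T (EuclideanSpace.single i₀ 1) = ν)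
    (hf : Measurable f) {x c : Euc n} (hx : x ∈ blowupSet f ν a b η r₀) (hη : 0 ≤ η) {ε k : ℝ}
    (hε : 0 < ε) (hk : 0 < k) (hr₀ : k * ε < r₀) (hxc : ⟪c - x, ν⟫ = 0)
    (hQ : rotCube T ε c ⊆ ball x (k * ε)) :
    IntegrableOn (fun u => f (cubeMap T ε c u)) (unitCube n) ∧
    |cubeCoef i₀ T ε f c - (a - b) / 2| ≤ η * |a - b| * (2 * k) ^ n := by
  obtain ⟨h1, h2⟩ := integral_le_of_mem_blowupSet hf hx hη (by positivity) hr₀ hQ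
  have h3 : IntegrableOn (stepFun ν a b x) (rotCube T ε c) :=
    integrableOn_stepFun ν a b x (by rw [volume_rotCube T c hε]; exact ENNReal.ofReal_ne_top)
  have h4 : IntegrableOn f (rotCube T ε c) := by
    have := Integrable.add h1 h3
    exact this.congr (Eventually.of_forall fun y => by simp)
  have h5 := (integrableOn_rotCube_iff T c hε f).1 h4
  refine ⟨h5, ?_⟩
  rw [← cubeCoef_stepFun hT a b hε hxc]
  refine (abs_cubeCoef_sub_le i₀ T h5 ((integrableOn_rotCube_iff T c hε _).1 h3)).trans ?_
  rw [setIntegral_rotCube T c hε] at h2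
  refine le_of_mul_le_mul_left (h2.trans (le_of_eq ?_)) (pow_pos hε n)
  ring

lemma abs_inner_le_of_mem_blowupSet (hT : T (EuclideanSpace.single i₀ 1) = ν)
    (hf : Measurable f) (hab : a ≠ b) (hη : 0 ≤ η) (hη1 : 2 * η * (20 * n) ^ n < 1) {x x' : Euc n}
    (hx : x ∈ blowupSet f ν a b η r₀) (hx' : x' ∈ blowupSet f ν a b η r₀)
    (hr₀ : 10 * n * dist x x' < r₀) {ε : ℝ} (hε : 0 < ε)
    (hi : ∀ i, i ≠ i₀ → |T.symm (x' - x) i| ≤ 2 * ε) :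
    |T.symm (x' - x) i₀| ≤ ε / 4 := by
  have hn : (1 : ℝ) ≤ n := by
    have := i₀.pos
    exact_mod_cast this
  wlog hpos : 0 ≤ T.symm (x' - x) i₀ generalizing x x'
  · have h1 : ∀ i, T.symm (x - x') i = -T.symm (x' - x) i := by
      intro i
      rw [← neg_sub x' x, map_neg]; rfl
    have := this hx' hx (by rwa [dist_comm]) (fun i h => by rw [h1, abs_neg]; exact hi i h)
      (by rw [h1]; linarith)
    rwa [h1, abs_neg] at this
  have hν : ‖ν‖ = 1 := by rw [← hT]; simp
  rw [abs_of_nonneg hpos]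
  set h := T.symm (x' - x) i₀ with hh
  by_contra! hlt
  have hh0 : 0 < h := by linarith
  set c := x + (h / 2) • ν with hc
  have hA : 0 < |a - b| := abs_pos.2 (sub_ne_zero.2 hab)
  have hxx : dist x x' ≤ n * (8 * h) := by
    rw [dist_comm, dist_eq_norm, ← T.symm.norm_map]
    refine euc_norm_le_of_coord_le fun i => ?_
    by_cases hi0 : i = i₀
    · rw [hi0, ← hh, abs_of_pos hh0]; linarith
    · exact (hi i hi0).trans (by linarith)
  have hhx : h ≤ dist x x' := by
    rw [dist_comm, dist_eq_norm, ← T.symm.norm_map]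
    exact (le_abs_self _).trans (PiLp.norm_apply_le (T.symm (x' - x)) i₀)
  have hcx : dist c x = h / 2 := by
    rw [dist_eq_norm, hc, add_sub_cancel_left, norm_smul, hν, mul_one,
      Real.norm_of_nonneg (by positivity)]
  have hnh : h ≤ n * h := by nlinarith
  have hb1 : rotCube T h c ⊆ ball x (10 * n * h) := by
    intro y hy
    have h1 := mem_closedBall.1 (rotCube_subset_closedBall T c hh0 hy)
    rw [mem_ball]
    linarith [dist_triangle y c x]
  have hb2 : rotCube T h c ⊆ ball x' (10 * n * h) := by
    intro y hy
    have h1 := mem_closedBall.1 (rotCube_subset_closedBall T c hh0 hy)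
    rw [mem_ball]
    linarith [dist_triangle y c x, dist_triangle y x x']
  have hr : 10 * n * h < r₀ := lt_of_le_of_lt (by gcongr) hr₀
  have e1 := lintegral_le_of_mem_blowupSet hx hη (by positivity) hr hb1
  have e2 := lintegral_le_of_mem_blowupSet hx' hη (by positivity) hr hb2
  have hm : Measurable (fun y => ENNReal.ofReal |f y - stepFun ν a b x y|) :=
    (continuous_abs.measurable.comp (hf.sub (measurable_stepFun ν a b x))).ennreal_ofReal
  have hQm : MeasurableSet (rotCube T h c) := (isOpen_rotCube T c).measurableSet
  have e3 : ENNReal.ofReal (|a - b| * h ^ n) ≤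
      ∫⁻ y in rotCube T h c, (ENNReal.ofReal |f y - stepFun ν a b x y| +
        ENNReal.ofReal |f y - stepFun ν a b x' y|) := by
    rw [ENNReal.ofReal_mul (abs_nonneg _), ← volume_rotCube T c hh0, ← setLIntegral_const]
    refine setLIntegral_mono_ae' hQm (Eventually.of_forall fun y hy => ?_)
    have hy0 := abs_lt.1 (hy i₀)
    have s1 : ⟪y - x, ν⟫ = T.symm (y - c) i₀ + h / 2 := by
      have : y - x = (y - c) + (h / 2) • ν := by rw [hc]; abel
      rw [this, inner_add_left, real_inner_smul_left, real_inner_self_eq_norm_sq, hν,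
        inner_eq_symm_apply hT]
      ring
    have s2 : ⟪y - x', ν⟫ = T.symm (y - c) i₀ - h / 2 := by
      have : y - x' = (y - x) - (x' - x) := by abel
      rw [this, inner_sub_left, s1, inner_eq_symm_apply hT (x' - x), ← hh]
      ring
    have t1 : stepFun ν a b x y = a := if_pos (by linarith)
    have t2 : stepFun ν a b x' y = b := if_neg (by linarith)
    rw [t1, t2, ← ENNReal.ofReal_add (abs_nonneg _) (abs_nonneg _)]
    refine ENNReal.ofReal_le_ofReal ?_
    have := abs_sub_le a (f y) b
    rwa [abs_sub_comm a (f y)] at this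
  rw [lintegral_add_left hm] at e3
  have e4 := e3.trans (add_le_add e1 e2)
  rw [← ENNReal.ofReal_add (by positivity) (by positivity),
    ENNReal.ofReal_le_ofReal_iff (by positivity)] at e4
  have e5 : (2 * (10 * n * h)) ^ n = (20 * (n : ℝ)) ^ n * h ^ n := by rw [← mul_pow]; ring
  rw [e5] at e4
  have e6 : 0 < |a - b| * h ^ n := by positivity
  nlinarith

end Blowup

section Columns

variable {n : ℕ} {T : Euc n ≃ₗᵢ[ℝ] Euc n} {i₀ : Fin n}

/-- A bump function adapted to the cube `rotCube T ε c`. -/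
def rotBump (T : Euc n ≃ₗᵢ[ℝ] Euc n) (δ ε : ℝ) (c y : Euc n) : ℝ :=
  cubeBump n δ (ε⁻¹ • T.symm (y - c))

lemma disjoint_rotCube {ε : ℝ} {c c' : Euc n} (i : Fin n) (h : ε ≤ |T.symm (c - c') i|) :
    Disjoint (rotCube T ε c) (rotCube T ε c') := by
  refine Set.disjoint_left.2 fun y hy hy' => ?_
  have h1 : T.symm (c - c') i = T.symm (y - c') i - T.symm (y - c) i := by
    have : c - c' = (y - c') - (y - c) := by abel
    rw [this, map_sub]; rfl
  have h2 := abs_sub (T.symm (y - c') i) (T.symm (y - c) i)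
  rw [← h1] at h2
  linarith [hy i, hy' i]

/-- A compact set which is flat in the direction `T eᵢ₀` at scale `ε` is covered by a single layer
of cubes, with a subordinate family of bump functions. -/
lemma exists_cube_layer {C : Set (Euc n)} (hC : IsCompact C) {ε δ : ℝ} (hε : 0 < ε) (hδ : 0 < δ)
    (hδ' : δ ≤ 1 / 4) (hflat : ∀ x ∈ C, ∀ x' ∈ C, (∀ i, i ≠ i₀ → |T.symm (x' - x) i| ≤ 2 * ε) →
      |T.symm (x' - x) i₀| ≤ ε / 4) :
    ∃ (I : Finset (Fin n → ℤ)) (c x : (Fin n → ℤ) → Euc n),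
      (∀ k ∈ I, x k ∈ C ∧ T.symm (c k - x k) i₀ = 0 ∧ dist (c k) (x k) ≤ n * ε) ∧
      (∀ k ∈ I, ∀ k' ∈ I, k ≠ k' → Disjoint (rotCube T ε (c k)) (rotCube T ε (c k'))) ∧
      (∀ y, ∑ k ∈ I, rotBump T δ ε (c k) y ≤ 1) ∧
      (∀ y ∈ C, ∑ k ∈ I, rotBump T δ ε (c k) y = 1) := by
  obtain ⟨R, hR⟩ := hC.isBounded.exists_norm_le
  set M : ℕ := ⌈R / ε⌉₊ with hM
  set t : Fin n → Finset ℤ := fun i => if i = i₀ then {0} else Finset.Icc (-(M : ℤ)) M with ht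
  set P : (Fin n → ℤ) → Prop := fun k => ∃ x ∈ C, ∀ i, i ≠ i₀ → |T.symm x i / ε - k i| ≤ 1 with hP
  set I := (Fintype.piFinset t).filter P with hI
  choose! x hxC hxk using fun (k : Fin n → ℤ) (hk : P k) => hk
  set c : (Fin n → ℤ) → Euc n := fun k =>
    T (WithLp.toLp 2 fun i => if i = i₀ then T.symm (x k) i₀ else ε * k i) with hc
  have hc0 : ∀ k, T.symm (c k) i₀ = T.symm (x k) i₀ := fun k => by simp [hc]
  have hci : ∀ k i, i ≠ i₀ → T.symm (c k) i = ε * k i := fun k i hi => by simp [hc, hi]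
  have hsub : ∀ y z i, T.symm (y - z) i = T.symm y i - T.symm z i := fun y z i => by
    rw [map_sub]; rfl
  have hkI : ∀ k ∈ I, P k := fun k hk => (Finset.mem_filter.1 hk).2
  have hk0 : ∀ k ∈ I, k i₀ = 0 := fun k hk => by
    have := Fintype.mem_piFinset.1 (Finset.mem_filter.1 hk).1 i₀
    simpa [ht] using this
  have hscale : ∀ (s : ℝ) (m : ℤ), |s - ε * m| = ε * |s / ε - m| := fun s m => by
    rw [← abs_of_pos hε, ← abs_mul, abs_of_pos hε, mul_sub, mul_div_cancel₀ _ hε.ne']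
  set g : Euc n → Fin n → ℤ → ℝ := fun y i j =>
    if i = i₀ then 1 else plateau δ (T.symm y i / ε - j) with hg
  have hg0 : ∀ y i j, 0 ≤ g y i j := fun y i j => by
    simp only [hg]; split_ifs
    · exact zero_le_one
    · exact plateau_nonneg hδ
  have hbump : ∀ k y i, (ε⁻¹ • T.symm (y - c k)) i = (T.symm y i - T.symm (c k) i) / ε :=
    fun k y i => by
      rw [PiLp.smul_apply, hsub, smul_eq_mul, inv_mul_eq_div]
  have hbump2 : ∀ k y i, i ≠ i₀ → (ε⁻¹ • T.symm (y - c k)) i = T.symm y i / ε - k i :=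
    fun k y i hi => by
      rw [hbump, hci k i hi, sub_div, mul_div_cancel_left₀ _ hε.ne']
  have hsum : ∀ y, ∑ k ∈ Fintype.piFinset t, ∏ i, g y i (k i) = ∏ i, ∑ j ∈ t i, g y i j :=
    fun y => (Finset.prod_univ_sum t (g y)).symm
  have hle : ∀ y k, rotBump T δ ε (c k) y ≤ ∏ i, g y i (k i) := fun y k => by
    unfold rotBump cubeBump
    refine Finset.prod_le_prod (fun i _ => plateau_nonneg hδ) fun i _ => ?_
    by_cases hi : i = i₀
    · simp only [hg, hi, if_true]; exact plateau_le_one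
    · simp only [hg, hi, if_false]; rw [hbump2 k y i hi]
  refine ⟨I, c, x, fun k hk => ⟨hxC k (hkI k hk), ?_, ?_⟩, fun k hk k' hk' hkk => ?_,
    fun y => ?_, fun y hy => ?_⟩
  · rw [hsub, hc0, sub_self]
  · rw [dist_eq_norm, ← T.symm.norm_map]
    refine euc_norm_le_of_coord_le fun i => ?_
    by_cases hi : i = i₀
    · rw [hi, hsub, hc0, sub_self, abs_zero]; exact hε.le
    · rw [hsub, hci k i hi, abs_sub_comm, hscale]
      nlinarith [hxk k (hkI k hk) i hi]
  · obtain ⟨i, hi⟩ := Function.ne_iff.1 hkk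
    have hi0 : i ≠ i₀ := fun h => hi (by rw [h, hk0 k hk, hk0 k' hk'])
    refine disjoint_rotCube i ?_
    rw [hsub, hci k i hi0, hci k' i hi0, ← mul_sub, abs_mul, abs_of_pos hε]
    have : (1 : ℝ) ≤ |(k i : ℝ) - k' i| := by
      have := Int.one_le_abs (sub_ne_zero.2 hi)
      exact_mod_cast this
    nlinarith
  · calc ∑ k ∈ I, rotBump T δ ε (c k) y ≤ ∑ k ∈ I, ∏ i, g y i (k i) :=
          Finset.sum_le_sum fun k _ => hle y k
      _ ≤ ∑ k ∈ Fintype.piFinset t, ∏ i, g y i (k i) :=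
          Finset.sum_le_sum_of_subset_of_nonneg (Finset.filter_subset _ _)
            fun k _ _ => Finset.prod_nonneg fun i _ => hg0 _ _ _
      _ = ∏ i, ∑ j ∈ t i, g y i j := hsum y
      _ ≤ 1 := by
          refine Finset.prod_le_one (fun i _ => Finset.sum_nonneg fun j _ => hg0 _ _ _)
            fun i _ => ?_
          by_cases hi : i = i₀
          · simp [ht, hg, hi]
          · simp only [ht, hg, hi, if_false]
            exact (sum_plateau_mem hδ M).2
  · have h1 : ∑ k ∈ Fintype.piFinset t, ∏ i, g y i (k i) = 1 := by
      rw [hsum]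
      refine Finset.prod_eq_one fun i _ => ?_
      by_cases hi : i = i₀
      · simp [ht, hg, hi]
      · simp only [ht, hg, hi, if_false]
        refine sum_plateau_eq_one hδ hδ' ?_
        rw [abs_div, abs_of_pos hε]
        refine le_trans ?_ (Nat.le_ceil _)
        gcongr
        refine (PiLp.norm_apply_le (T.symm y) i).trans ?_
        rw [T.symm.norm_map]
        exact hR y hy
    have hne : ∀ k : Fin n → ℤ, ∏ i, g y i (k i) ≠ 0 → ∀ i, i ≠ i₀ → |T.symm y i / ε - k i| ≤ 1 := by
      intro k hk i hi
      have := Finset.prod_ne_zero_iff.1 hk i (Finset.mem_univ i)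
      simp only [hg, hi, if_false] at this
      linarith [abs_lt_of_plateau_ne_zero hδ this]
    rw [← h1, hI, ← Finset.sum_filter_of_ne (s := Fintype.piFinset t) (p := P)
      fun k _ hk => ⟨y, hy, hne k hk⟩]
    refine Finset.sum_congr rfl fun k hk => ?_
    by_cases hz : ∏ i, g y i (k i) = 0
    · refine le_antisymm (hle y k) ?_
      rw [hz]
      exact (cubeBump_mem hδ).1
    · have hyk := hne k hz
      have hPk := hkI k hk
      unfold rotBump cubeBump
      refine Finset.prod_congr rfl fun i _ => ?_
      by_cases hi : i = i₀
      · simp only [hg, hi, if_true]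
        refine plateau_eq_one hδ hδ' ?_
        rw [hbump, hc0, ← hsub, abs_div, abs_of_pos hε, div_le_iff₀ hε]
        refine (hflat _ (hxC k hPk) y hy fun j hj => ?_).trans (by linarith)
        have e1 : T.symm (y - x k) j = (T.symm y j - ε * k j) - (T.symm (x k) j - ε * k j) := by
          rw [hsub]; ring
        rw [e1]
        refine (abs_sub _ _).trans ?_
        rw [hscale, hscale]
        nlinarith [hxk k hPk j hj, hyk j hj]
      · simp only [hg, hi, if_false]; rw [hbump2 k y i hi]

end Columns

section Bump

variable {n : ℕ} {T : Euc n ≃ₗᵢ[ℝ] Euc n} {i₀ : Fin n} {δ ε : ℝ} {c : Euc n}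

lemma contDiff_rotBump : ContDiff ℝ 1 (rotBump T δ ε c) := by
  have h : ContDiff ℝ 1 fun y => T.symm (y - c) :=
    T.symm.contDiff.comp (contDiff_id.sub contDiff_const)
  exact contDiff_cubeBump.comp (h.const_smul ε⁻¹)

lemma mem_rotCube_of_rotBump_ne_zero (hδ : 0 < δ) (hε : 0 < ε) {y : Euc n}
    (h : rotBump T δ ε c y ≠ 0) : y ∈ rotCube T ((1 + 2 * δ) * ε) c := by
  intro i
  have h1 := abs_lt_of_cubeBump_ne_zero hδ h i
  rw [PiLp.smul_apply, smul_eq_mul, abs_mul, abs_of_pos (inv_pos.2 hε), inv_mul_lt_iff₀ hε] at h1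
  linarith

lemma tsupport_rotBump_subset (hδ : 0 < δ) (hδ' : δ ≤ 1 / 4) (hε : 0 < ε) :
    tsupport (rotBump T δ ε c) ⊆ rotCube T (2 * ε) c := by
  have h1 : tsupport (rotBump T δ ε c) ⊆ {y | ∀ i, |T.symm (y - c) i| ≤ (1 + 2 * δ) * ε / 2} := by
    refine closure_minimal (fun y hy i => (mem_rotCube_of_rotBump_ne_zero hδ hε hy i).le) ?_
    simp only [Set.ofPred_forall]
    exact isClosed_iInter fun i => isClosed_le (by fun_prop) continuous_const
  intro y hy i
  have := h1 hy i
  nlinarith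

lemma hasCompactSupport_rotBump (hδ : 0 < δ) (hδ' : δ ≤ 1 / 4) (hε : 0 < ε) :
    HasCompactSupport (rotBump T δ ε c) :=
  (isCompact_closedBall c (n * (2 * ε))).of_isClosed_subset (isClosed_tsupport _)
    ((tsupport_rotBump_subset hδ hδ' hε).trans (rotCube_subset_closedBall T c (by positivity)))

lemma norm_fderiv_rotBump_le {L : NNReal} (hL : LipschitzWith L (cubeBump n δ)) (hε : 0 < ε)
    (y : Euc n) : ‖fderiv ℝ (rotBump T δ ε c) y‖ ≤ L / ε := by
  have h1 : LipschitzWith (L * Real.toNNReal ε⁻¹) (rotBump T δ ε c) := by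
    refine hL.comp (LipschitzWith.of_dist_le_mul fun y z => ?_)
    rw [dist_eq_norm, ← smul_sub, ← map_sub, norm_smul, T.symm.norm_map, sub_sub_sub_cancel_right,
      Real.norm_of_nonneg (by positivity), dist_eq_norm, Real.coe_toNNReal _ (by positivity)]
  refine (norm_fderiv_le_of_lipschitz ℝ h1).trans (le_of_eq ?_)
  rw [NNReal.coe_mul, Real.coe_toNNReal _ (by positivity), div_eq_mul_inv]

lemma abs_integral_mul_fderiv_rotBump_le {ν : Euc n} {f : Euc n → ℝ} {a b η r₀ : ℝ}
    {Ω : Set (Euc n)} {x v : Euc n}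
    (hT : T (EuclideanSpace.single i₀ 1) = ν) (hf : Measurable f)
    (hx : x ∈ blowupSet f ν a b η r₀) (hη : 0 ≤ η) (hδ : 0 < δ) (hδ' : δ ≤ 1 / 4) {L : NNReal}
    (hL : LipschitzWith L (cubeBump n δ)) (hε : 0 < ε) {k : ℝ} (hk : 0 < k) (hr₀ : k * ε < r₀)
    (hQ : rotCube T (2 * ε) c ⊆ ball x (k * ε)) (hΩm : MeasurableSet Ω)
    (hΩ : rotCube T (2 * ε) c ⊆ Ω) (hv : ‖v‖ = 1) :
    |∫ y in Ω, f y * fderiv ℝ (rotBump T δ ε c) y v| ≤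
      |a - b| * ε ^ (n - 1) * ((1 + 2 * δ) ^ (n - 1) + L * η * (2 * k) ^ n) := by
  set φ := rotBump T δ ε c with hφ
  set Q := rotCube T (2 * ε) c with hQdef
  have hφC : ContDiff ℝ 1 φ := contDiff_rotBump
  have hφc : HasCompactSupport φ := hasCompactSupport_rotBump hδ hδ' hε
  have hφQ : tsupport φ ⊆ Q := tsupport_rotBump_subset hδ hδ' hε
  have hQm : MeasurableSet Q := (isOpen_rotCube T c).measurableSet
  have hQv : volume Q ≠ ⊤ := by
    rw [volume_rotCube T c (by positivity)]; exact ENNReal.ofReal_ne_top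
  have hz : ∀ y ∉ Q, fderiv ℝ φ y v = 0 := by
    intro y hy
    rw [image_eq_zero_of_notMem_tsupport fun h => hy (hφQ (tsupport_fderiv_subset ℝ h))]
    rfl
  have hb : ∀ y, |fderiv ℝ φ y v| ≤ L / ε := fun y => by
    have := (fderiv ℝ φ y).le_opNorm v
    rw [hv, mul_one] at this
    exact this.trans (norm_fderiv_rotBump_le hL hε y)
  have hcont : Continuous fun y => fderiv ℝ φ y v :=
    (hφC.continuous_fderiv one_ne_zero).clm_apply continuous_const
  obtain ⟨h1, h2⟩ := integral_le_of_mem_blowupSet hf hx hη (by positivity) hr₀ hQ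
  have h3 : IntegrableOn (stepFun ν a b x) Q := integrableOn_stepFun ν a b x hQv
  have h4 : ∫ y in Ω, f y * fderiv ℝ φ y v = ∫ y in Q, f y * fderiv ℝ φ y v := by
    exact setIntegral_eq_of_subset_of_forall_sdiff_eq_zero hΩm hΩ fun y hy => by
      rw [hz y hy.2, mul_zero]
  have h5 : ∫ y, stepFun ν a b x y * fderiv ℝ φ y v =
      ∫ y in Q, stepFun ν a b x y * fderiv ℝ φ y v :=
    (setIntegral_eq_integral_of_forall_compl_eq_zero fun y hy => by rw [hz y hy, mul_zero]).symm
  have i1 : IntegrableOn (fun y => (f y - stepFun ν a b x y) * fderiv ℝ φ y v) Q :=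
    Integrable.mul_bdd (c := (L : ℝ) / ε) h1 hcont.aestronglyMeasurable (Eventually.of_forall hb)
  have i2 : IntegrableOn (fun y => stepFun ν a b x y * fderiv ℝ φ y v) Q :=
    Integrable.mul_bdd (c := L / ε) h3 hcont.aestronglyMeasurable (Eventually.of_forall hb)
  have h6 : ∫ y in Q, f y * fderiv ℝ φ y v =
      (∫ y in Q, (f y - stepFun ν a b x y) * fderiv ℝ φ y v) +
        ∫ y in Q, stepFun ν a b x y * fderiv ℝ φ y v := by
    rw [← integral_add i1 i2]
    congr 1; ext y; ring
  have h7 : |∫ y in Q, (f y - stepFun ν a b x y) * fderiv ℝ φ y v| ≤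
      L / ε * (η * |a - b| * (2 * (k * ε)) ^ n) := by
    have h1n : IntegrableOn (fun y => L / ε * |f y - stepFun ν a b x y|) Q := h1.norm.const_mul _
    refine (norm_integral_le_of_norm_le (G := ℝ) h1n (Eventually.of_forall fun y => ?_)).trans ?_
    · rw [norm_mul, mul_comm]
      exact mul_le_mul (hb y) le_rfl (norm_nonneg _) (by positivity)
    · rw [integral_const_mul]
      gcongr
  have h8 := abs_integral_stepFun_mul_fderiv_le hT a b x c (r := (1 + 2 * δ) * ε) (by positivity)
    hφC hφc (fun y => mem_rotCube_of_rotBump_ne_zero hδ hε) (fun y => by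
      have := cubeBump_mem (n := n) hδ (u := ε⁻¹ • T.symm (y - c))
      exact abs_le.2 ⟨(neg_nonpos.2 zero_le_one).trans this.1, this.2⟩) hv
  rw [h4, h6, ← h5]
  refine (abs_add_le _ _).trans ((add_le_add h7 h8).trans (le_of_eq ?_))
  have hn : ε ^ n = ε * ε ^ (n - 1) := by
    rw [← pow_succ', Nat.sub_add_cancel i₀.pos]
  have e1 : (2 * (k * ε)) ^ n = (2 * k) ^ n * (ε * ε ^ (n - 1)) := by
    rw [← hn, ← mul_pow]; ring
  rw [e1, mul_pow _ ε]
  field_simp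
  ring

end Bump

section Jump

variable {n : ℕ} {F : ℝ → Euc n → ℝ} {f : Euc n → ℝ} {Ω : Set (Euc n)} {μ : Measure (Euc n)}
  {σ : Euc n → Euc n} {T : Euc n ≃ₗᵢ[ℝ] Euc n} {i₀ : Fin n} {ν v : Euc n} {a b η r₀ δ ε s : ℝ}
  {L : NNReal}

lemma abs_integral_mul_fderiv_sum_le (hf : LocallyIntegrableOn f Ω)
    {ι : Type*} (I : Finset ι) (c : ι → Euc n) (hδ : 0 < δ) (hδ' : δ ≤ 1 / 4) (hε : 0 < ε)
    (hcΩ : ∀ k ∈ I, rotCube T (2 * ε) (c k) ⊆ Ω) {B : ℝ}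
    (hB : ∀ k ∈ I, |∫ y in Ω, f y * fderiv ℝ (rotBump T δ ε (c k)) y v| ≤ B) :
    |∫ y in Ω, f y * fderiv ℝ (fun y => ∑ k ∈ I, rotBump T δ ε (c k) y) y v| ≤ I.card * B := by
  have h1 : ∀ y, f y * fderiv ℝ (fun y => ∑ k ∈ I, rotBump T δ ε (c k) y) y v =
      ∑ k ∈ I, f y * fderiv ℝ (rotBump T δ ε (c k)) y v := by
    intro y
    rw [fderiv_fun_sum fun k _ => contDiff_rotBump.differentiable one_ne_zero y,
      sum_apply, Finset.mul_sum]
  simp_rw [h1]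
  rw [integral_finsetSum _ fun k hk => integrableOn_mul_fderiv hf contDiff_rotBump
    (hasCompactSupport_rotBump hδ hδ' hε)
    ((tsupport_rotBump_subset hδ hδ' hε).trans (hcΩ k hk)) v]
  refine (Finset.abs_sum_le_sum_abs _ _).trans ((Finset.sum_le_sum hB).trans (le_of_eq ?_))
  rw [Finset.sum_const, nsmul_eq_mul]

/-- The lower bound for `κ_ε` near a piece of the jump set, at a fixed scale. -/
lemma IsVariationPair.jump_measure_le_kappa (hp : IsVariationPair n f Ω μ σ) (hΩ : IsOpen Ω)
    (hfΩ : LocallyIntegrableOn f Ω) (hf : Measurable f) {g : Euc n → ℝ}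
    (hg : LocallyIntegrableOn g Ω)
    (hT : T (EuclideanSpace.single i₀ 1) = ν) (hab : a ≠ b) (hv : ‖v‖ = 1)
    {C V U : Set (Euc n)} (hC : IsCompact C) (hCB : C ⊆ blowupSet f ν a b η r₀)
    (hdiam : ∀ x ∈ C, ∀ x' ∈ C, 10 * n * dist x x' < r₀)
    (hVΩ : V ⊆ Ω) (hV : MeasurableSet V) (hVC : cthickening (4 * n * ε) C ⊆ V)
    (hUC : cthickening (4 * n * ε) C ⊆ U)
    (hs : 0 < s) (hs' : s ≤ 1 / 8) (hσ : ∀ x ∈ C, 1 - s ≤ ⟪v, σ x⟫)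
    (hδ : 0 < δ) (hδ' : δ ≤ 1 / 4) (hδs : (1 + 2 * δ) ^ (n - 1) ≤ 1 + s)
    (hL : LipschitzWith L (cubeBump n δ)) (hη : 0 < η) (hη1 : 2 * η * (20 * n) ^ n < 1)
    (hη2 : L * η * (2 * (4 * n)) ^ n ≤ s) (hη3 : η * (2 * (4 * n)) ^ n + η ≤ s)
    (hε : 0 < ε) (hεr : 4 * n * ε < r₀)
    (hgf : ∀ᵐ x ∂volume.restrict (cthickening (4 * n * ε) C), |g x - f x| ≤ η * |a - b|) :
    ENNReal.ofReal ((1 / 2 - 3 * s) * μ.real C - μ.real (V \ C)) ≤ kappa n ε g U := by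
  have hn : (1 : ℝ) ≤ n := by
    have := i₀.pos
    exact_mod_cast this
  have hA : 0 < |a - b| := abs_pos.2 (sub_ne_zero.2 hab)
  obtain ⟨I, c, x, hI, hdisj, hsum1, hsumC⟩ := exists_cube_layer (T := T) (i₀ := i₀) hC hε hδ hδ'
    fun y hy y' hy' hi => abs_inner_le_of_mem_blowupSet hT hf hab hη.le hη1 (hCB hy) (hCB hy')
      (hdiam y hy y' hy') hε hi
  have hcx : ∀ k ∈ I, ⟪c k - x k, ν⟫ = 0 := fun k hk => by
    rw [inner_eq_symm_apply hT]; exact (hI k hk).2.1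
  have hQ2 : ∀ k ∈ I, rotCube T (2 * ε) (c k) ⊆ ball (x k) (4 * n * ε) := by
    intro k hk y hy
    have h1 := mem_closedBall.1 (rotCube_subset_closedBall T (c k) (by positivity) hy)
    have h2 := (hI k hk).2.2
    have h3 : 0 < n * ε := by positivity
    rw [mem_ball]
    linarith [dist_triangle y (c k) (x k)]
  have hQ1 : ∀ k, rotCube T ε (c k) ⊆ rotCube T (2 * ε) (c k) := fun k y hy i => by
    have := hy i
    linarith
  have hthick : ∀ k ∈ I, ball (x k) (4 * n * ε) ⊆ cthickening (4 * n * ε) C := fun k hk =>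
    ball_subset_closedBall.trans (closedBall_subset_cthickening (hI k hk).1 _)
  have hQΩ : ∀ k ∈ I, rotCube T (2 * ε) (c k) ⊆ Ω := fun k hk =>
    (hQ2 k hk).trans ((hthick k hk).trans (hVC.trans hVΩ))
  have hKc : IsCompact (cthickening (4 * n * ε) C) := hC.cthickening
  set X := (I.card : ℝ) * (|a - b| * ε ^ (n - 1)) with hX
  have hX0 : 0 ≤ X := by positivity
  -- the test function
  set ψ : Euc n → ℝ := fun y => ∑ k ∈ I, rotBump T δ ε (c k) y with hψ
  have hψC : ContDiff ℝ 1 ψ := ContDiff.sum fun k _ => contDiff_rotBump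
  have hψ0 : ∀ y ∉ cthickening (4 * n * ε) C, ψ y = 0 := by
    intro y hy
    refine Finset.sum_eq_zero fun k hk => ?_
    by_contra h
    exact hy (hthick k hk (hQ2 k hk (tsupport_rotBump_subset hδ hδ' hε (subset_tsupport _ h))))
  have hψts : tsupport ψ ⊆ cthickening (4 * n * ε) C :=
    closure_minimal (fun y hy => by_contra fun h => hy (hψ0 y h)) isClosed_cthickening
  have hψc : HasCompactSupport ψ := hKc.of_isClosed_subset (isClosed_tsupport _) hψts
  have h1 := hp.le_integral_mul_inner hv hC.measurableSet hV
    ((self_subset_cthickening C).trans hVC) hσ hψC.continuous.measurable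
    (fun y => ⟨Finset.sum_nonneg fun k _ => (cubeBump_mem hδ).1, hsum1 y⟩) hsumC
    (fun y hy => hψ0 y fun h => hy (hVC h))
  have h2 := hp.integral_fderiv hψC hψc (hψts.trans (hVC.trans hVΩ)) v
  have h3 : |∫ y in Ω, f y * fderiv ℝ ψ y v| ≤
      I.card * (|a - b| * ε ^ (n - 1) * (1 + 2 * s)) := by
    refine abs_integral_mul_fderiv_sum_le hfΩ I c hδ hδ' hε hQΩ fun k hk => ?_
    refine (abs_integral_mul_fderiv_rotBump_le hT hf (hCB (hI k hk).1) hη.le hδ hδ' hL hε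
      (by positivity) hεr (hQ2 k hk) hΩ.measurableSet (hQΩ k hk) hv).trans ?_
    exact mul_le_mul_of_nonneg_left (by linarith [hδs, hη2]) (by positivity)
  have h4 : (1 - s) * μ.real C - μ.real (V \ C) ≤ X * (1 + 2 * s) := by
    have := neg_le_abs (∫ y in Ω, f y * fderiv ℝ ψ y v)
    rw [h2, neg_neg, ← h2] at this
    calc _ ≤ _ := h1
      _ ≤ _ := this
      _ ≤ _ := h3
      _ = _ := by rw [hX]; ring
  -- the lower bound for `κ_ε`
  have hgQ : ∀ k ∈ I, IntegrableOn g (rotCube T ε (c k)) := fun k hk =>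
    (hg.integrableOn_compact_subset (hVC.trans hVΩ) hKc).mono_set
      ((hQ1 k).trans ((hQ2 k hk).trans (hthick k hk)))
  have h5 : ∀ k ∈ I, |a - b| * (1 / 2 - s) ≤ |cubeCoef i₀ T ε g (c k)| := by
    intro k hk
    obtain ⟨e1, e2⟩ := abs_cubeCoef_sub_le_of_mem_blowupSet hT hf (hCB (hI k hk).1) hη.le hε
      (by positivity) hεr (hcx k hk) ((hQ1 k).trans (hQ2 k hk))
    have e3 := abs_cubeCoef_sub_le i₀ T ((integrableOn_rotCube_iff T _ hε g).1 (hgQ k hk)) e1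
    have e4 : ∫ u in unitCube n, |g (cubeMap T ε (c k) u) - f (cubeMap T ε (c k) u)| ≤
        η * |a - b| := by
      have h6 : ∀ᵐ x ∂volume.restrict (rotCube T ε (c k)), |g x - f x| ≤ η * |a - b| :=
        ae_restrict_of_ae_restrict_of_subset
          ((hQ1 k).trans ((hQ2 k hk).trans (hthick k hk))) hgf
      have h7 := ae_comp_cubeMap T hε h6
      refine (integral_mono_of_nonneg (Eventually.of_forall fun u => abs_nonneg _)
        (integrableOn_const (C := η * |a - b|) (by rw [volume_unitCube]; simp)) h7).trans ?_
      rw [setIntegral_const, Measure.real, volume_unitCube]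
      simp
    have e5 : |a - b| / 2 ≤ |cubeCoef i₀ T ε g (c k)| +
        |cubeCoef i₀ T ε g (c k) - cubeCoef i₀ T ε f (c k)| +
        |cubeCoef i₀ T ε f (c k) - (a - b) / 2| := by
      have := abs_sub_abs_le_abs_sub ((a - b) / 2) (cubeCoef i₀ T ε g (c k))
      rw [abs_div, abs_two, abs_sub_comm _ (cubeCoef i₀ T ε g (c k))] at this
      linarith [abs_sub_le (cubeCoef i₀ T ε g (c k)) (cubeCoef i₀ T ε f (c k)) ((a - b) / 2)]
    nlinarith
  have h6 := tsum_cubeCoef_le_kappa (i₀ := i₀) (T := T) (U := U) hε (fun k : I => c k)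
    (fun k => (hQ1 k).trans ((hQ2 k k.2).trans ((hthick k k.2).trans hUC)))
    (fun k k' hkk => hdisj k k.2 k' k'.2 fun h => hkk (Subtype.ext h)) (fun k => hgQ k k.2)
  refine le_trans ?_ h6
  rw [tsum_fintype]
  calc ENNReal.ofReal ((1 / 2 - 3 * s) * μ.real C - μ.real (V \ C))
      ≤ ENNReal.ofReal (ε ^ (n - 1) * (I.card * (|a - b| * (1 / 2 - s)))) := by
        refine ENNReal.ofReal_le_ofReal ?_
        have m1 : 0 ≤ μ.real C := measureReal_nonneg
        have m2 : 0 ≤ μ.real (V \ C) := measureReal_nonneg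
        have e : ε ^ (n - 1) * (I.card * (|a - b| * (1 / 2 - s))) = X * (1 / 2 - s) := by
          rw [hX]; ring
        rw [e]
        have k1 := mul_le_mul_of_nonneg_left h4 (show 0 ≤ 1 / 2 - s by linarith)
        have k2 : (1 / 2 - 3 * s) * (1 + 2 * s) ≤ (1 / 2 - s) * (1 - s) := by nlinarith
        have k3 := mul_le_mul_of_nonneg_right k2 m1
        refine le_of_mul_le_mul_right (a := 1 + 2 * s) ?_ (by linarith)
        nlinarith [mul_nonneg hs.le m2]
    _ = ENNReal.ofReal (ε ^ (n - 1)) * ∑ k : I, ENNReal.ofReal (|a - b| * (1 / 2 - s)) := by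
        rw [ENNReal.ofReal_mul (by positivity), Finset.sum_const, nsmul_eq_mul, Finset.card_univ,
          Fintype.card_coe, ENNReal.ofReal_mul (by positivity), ENNReal.ofReal_natCast]
    _ ≤ _ := by
        gcongr with k
        exact h5 k k.2

end Jump

section JumpLimit

variable {n : ℕ} {F : ℝ → Euc n → ℝ} {f : Euc n → ℝ} {Ω : Set (Euc n)} {μ : Measure (Euc n)}
  {σ : Euc n → Euc n} {ν v : Euc n} {a b η r₀ s : ℝ}

lemma exists_jump_constants (n : ℕ) (hs : 0 < s) :
    ∃ (δ η : ℝ) (L : NNReal), 0 < δ ∧ δ ≤ 1 / 4 ∧ (1 + 2 * δ) ^ (n - 1) ≤ 1 + s ∧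
      LipschitzWith L (cubeBump n δ) ∧ 0 < η ∧ 2 * η * (20 * n) ^ n < 1 ∧
      L * η * (2 * (4 * n)) ^ n ≤ s ∧ η * (2 * (4 * n)) ^ n + η ≤ s := by
  obtain ⟨δ, ⟨h1, h2⟩, h3⟩ : ∃ δ : ℝ, (δ ≤ 1 / 4 ∧ (1 + 2 * δ) ^ (n - 1) ≤ 1 + s) ∧ 0 < δ := by
    have hc : Tendsto (fun δ : ℝ => (1 + 2 * δ) ^ (n - 1)) (𝓝 0) (𝓝 1) := by
      have : Continuous fun δ : ℝ => (1 + 2 * δ) ^ (n - 1) := by fun_prop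
      simpa using this.tendsto 0
    have e : ∀ᶠ δ in 𝓝[>] (0 : ℝ), (δ ≤ 1 / 4 ∧ (1 + 2 * δ) ^ (n - 1) ≤ 1 + s) ∧ 0 < δ :=
      ((Eventually.and (ge_mem_nhds (by norm_num : (0 : ℝ) < 1 / 4))
        (hc.eventually (ge_mem_nhds (by linarith)))).filter_mono nhdsWithin_le_nhds).and
        (self_mem_nhdsWithin (s := Set.Ioi (0 : ℝ)))
    exact e.exists
  obtain ⟨L, hL⟩ := contDiff_cubeBump.lipschitzWith_of_hasCompactSupport
    (hasCompactSupport_cubeBump (n := n) h3) one_ne_zero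
  have e : ∀ᶠ η : ℝ in 𝓝[>] (0 : ℝ), (2 * η * (20 * (n : ℝ)) ^ n < 1 ∧
      L * η * (2 * (4 * (n : ℝ))) ^ n ≤ s ∧ η * (2 * (4 * (n : ℝ))) ^ n + η ≤ s) ∧ 0 < η := by
    have c1 : Continuous fun η : ℝ => 2 * η * (20 * (n : ℝ)) ^ n := by fun_prop
    have c2 : Continuous fun η : ℝ => L * η * (2 * (4 * (n : ℝ))) ^ n := by fun_prop
    have c3 : Continuous fun η : ℝ => η * (2 * (4 * (n : ℝ))) ^ n + η := by fun_prop
    have e1 : ∀ᶠ η in 𝓝 (0 : ℝ), 2 * η * (20 * (n : ℝ)) ^ n < 1 :=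
      (c1.tendsto 0).eventually (gt_mem_nhds (by simp))
    have e2 : ∀ᶠ η in 𝓝 (0 : ℝ), L * η * (2 * (4 * (n : ℝ))) ^ n ≤ s :=
      (c2.tendsto 0).eventually (ge_mem_nhds (by simpa using hs))
    have e3 : ∀ᶠ η in 𝓝 (0 : ℝ), η * (2 * (4 * (n : ℝ))) ^ n + η ≤ s :=
      (c3.tendsto 0).eventually (ge_mem_nhds (by simpa using hs))
    exact ((e1.and (e2.and e3)).filter_mono nhdsWithin_le_nhds).and
      (self_mem_nhdsWithin (s := Set.Ioi (0 : ℝ)))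
  obtain ⟨η, ⟨h4, h5, h6⟩, h7⟩ := e.exists
  exact ⟨δ, η, L, h3, h1, h2, hL, h7, h4, h5, h6⟩

/-- On the pieces of the jump set, `κ` controls half of the total variation. -/
lemma exists_jump_measure_le (i₀ : Fin n) (hs : 0 < s) (hs' : s ≤ 1 / 8) :
    ∃ η : ℝ, 0 < η ∧ η * (2 * (4 * n)) ^ n + η ≤ s ∧
      ∀ {F : ℝ → Euc n → ℝ} {f : Euc n → ℝ} {Ω : Set (Euc n)} {μ : Measure (Euc n)}
        {σ : Euc n → Euc n} {ν v : Euc n} {a b r₀ : ℝ} {C U : Set (Euc n)},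
        LocUnifConv n F f Ω → IsVariationPair n f Ω μ σ → Measurable f → ‖ν‖ = 1 → a ≠ b →
        ‖v‖ = 1 → IsCompact C → C ⊆ blowupSet f ν a b η r₀ →
        (∀ x ∈ C, ∀ x' ∈ C, 10 * n * dist x x' < r₀) → 0 < r₀ → IsOpen U → C ⊆ U → U ⊆ Ω →
        (∀ x ∈ C, 1 - s ≤ ⟪v, σ x⟫) →
        ENNReal.ofReal (1 / 2 - 3 * s) * μ C ≤ liminfKappa n F U := by
  obtain ⟨δ, η, L, hδ, hδ', hδs, hL, hη, hη1, hη2, hη3⟩ := exists_jump_constants n hs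
  refine ⟨η, hη, hη3, ?_⟩
  intro F f Ω μ σ ν v a b r₀ C U H hp hf hν hab hv hC hCB hdiam hr₀ hU hCU hUΩ hσ
  obtain ⟨T, hT⟩ := exists_linearIsometryEquiv_apply_single i₀ hν
  have := hp.1
  refine ofReal_mul_measure_le_of_forall_pos (by linarith) fun τ hτ => ?_
  obtain ⟨V₀, hCV₀, hV₀, hV₀C⟩ := C.exists_isOpen_lt_add (measure_ne_top μ C)
    (ε := ENNReal.ofReal τ) (ENNReal.ofReal_pos.2 hτ).ne'
  have hV₀τ : μ.real (V₀ \ C) ≤ τ := by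
    rw [measureReal_sdiff hCV₀ hC.measurableSet]
    have : μ.real V₀ ≤ μ.real C + τ := by
      rw [Measure.real, Measure.real, ← ENNReal.toReal_ofReal hτ.le,
        ← ENNReal.toReal_add (measure_ne_top _ _) ENNReal.ofReal_ne_top]
      exact ENNReal.toReal_mono (by finiteness) hV₀C.le
    linarith
  obtain ⟨ρ, hρ, hρV⟩ := hC.exists_cthickening_subset_open (hV₀.inter hU)
    (Set.subset_inter hCV₀ hCU)
  have hA : 0 < |a - b| := abs_pos.2 (sub_ne_zero.2 hab)
  have c1 : Tendsto (fun ε : ℝ => 4 * n * ε) (𝓝[>] 0) (𝓝 0) := by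
    have : Continuous fun ε : ℝ => 4 * n * ε := by fun_prop
    have := (this.tendsto 0).mono_left (nhdsWithin_le_nhds (s := Set.Ioi 0))
    rwa [mul_zero] at this
  refine le_liminf_of_le ?_ ?_
  · exact isCobounded_ge_of_top
  filter_upwards [self_mem_nhdsWithin, c1.eventually (gt_mem_nhds hρ),
    c1.eventually (gt_mem_nhds hr₀), H.eventually_le (hC.cthickening (r := ρ))
      (hρV.trans (Set.inter_subset_right.trans hUΩ)) (mul_pos hη hA)] with ε hε h1 h2 h3
  have hsub : cthickening (4 * n * ε) C ⊆ cthickening ρ C := cthickening_mono h1.le _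
  refine le_trans (ENNReal.ofReal_le_ofReal ?_) (hp.jump_measure_le_kappa (V := V₀ ∩ U)
    H.isOpen H.locInt hf (H.locInt_approx ε hε) hT hab hv hC hCB hdiam
    (Set.inter_subset_right.trans hUΩ) (hV₀.inter hU).measurableSet (hsub.trans hρV)
    (hsub.trans (hρV.trans Set.inter_subset_right)) hs hs' hσ hδ hδ' hδs hL hη hη1 hη2 hη3 hε h2
    (ae_restrict_of_ae_restrict_of_subset hsub h3))
  have : μ.real ((V₀ ∩ U) \ C) ≤ μ.real (V₀ \ C) :=
    measureReal_mono (Set.sdiff_subset_sdiff_left Set.inter_subset_left)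
  linarith

end JumpLimit

section Merge

variable {n : ℕ} {F : ℝ → Euc n → ℝ} {Ω : Set (Euc n)} {μ : Measure (Euc n)}

lemma liminfKappa_add_le {U V W : Set (Euc n)} (hUV : Disjoint U V) (hU : U ⊆ W) (hV : V ⊆ W) :
    liminfKappa n F U + liminfKappa n F V ≤ liminfKappa n F W := by
  rcases eq_or_ne (liminfKappa n F U) 0 with hU0 | hU0
  · rw [hU0, zero_add]
    exact liminfKappa_mono hV
  rcases eq_or_ne (liminfKappa n F V) 0 with hV0 | hV0
  · rw [hV0, add_zero]
    exact liminfKappa_mono hU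
  refine le_of_forall_lt fun c hc => ?_
  obtain ⟨a, ha, b, hb, hab⟩ := ENNReal.exists_lt_add_of_lt_add hc hU0 hV0
  refine hab.trans_le (le_liminf_of_le (by isBoundedDefault) ?_)
  filter_upwards [eventually_lt_of_lt_liminf ha, eventually_lt_of_lt_liminf hb,
    self_mem_nhdsWithin] with ε h1 h2 hε
  exact (add_le_add h1.le h2.le).trans (kappa_add_le hε hUV hU hV)

lemma sum_mul_measure_le_of_isCompact {ι : Type*} {c : ι → ℝ≥0∞} {C : ι → Set (Euc n)}
    (I : Finset ι) (hC : ∀ i ∈ I, IsCompact (C i))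
    (hdisj : ∀ i ∈ I, ∀ j ∈ I, i ≠ j → Disjoint (C i) (C j))
    (h : ∀ i ∈ I, ∀ U, IsOpen U → C i ⊆ U → U ⊆ Ω → c i * μ (C i) ≤ liminfKappa n F U)
    {U : Set (Euc n)} (hU : IsOpen U) (hCU : ∀ i ∈ I, C i ⊆ U) (hUΩ : U ⊆ Ω) :
    ∑ i ∈ I, c i * μ (C i) ≤ liminfKappa n F U := by
  induction I using Finset.induction_on generalizing U with
  | empty => simp
  | insert j I hj ih =>
    have hI : ∀ i ∈ I, i ∈ insert j I := fun i hi => Finset.mem_insert_of_mem hi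
    have hjI : j ∈ insert j I := Finset.mem_insert_self j I
    obtain ⟨V, W, hV, hW, hjV, hIW, hVW⟩ := SeparatedNhds.of_isCompact_isCompact (hC j hjI)
      (I.isCompact_biUnion fun i hi => hC i (hI i hi))
      (Set.disjoint_iUnion₂_right.2 fun i hi => hdisj j hjI i (hI i hi) fun h => hj (h ▸ hi))
    rw [Finset.sum_insert hj]
    refine le_trans (add_le_add (h j hjI (V ∩ U) (hV.inter hU) (Set.subset_inter hjV (hCU j hjI))
      (Set.inter_subset_right.trans hUΩ)) (ih (U := W ∩ U) (fun i hi => hC i (hI i hi))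
      (fun i hi k hk => hdisj i (hI i hi) k (hI k hk)) (fun i hi => h i (hI i hi)) (hW.inter hU)
      (fun i hi => Set.subset_inter ((Set.subset_biUnion_of_mem (u := C) hi).trans hIW)
        (hCU i (hI i hi))) (Set.inter_subset_right.trans hUΩ))) ?_
    exact liminfKappa_add_le (hVW.mono Set.inter_subset_left Set.inter_subset_left)
      Set.inter_subset_right Set.inter_subset_right

lemma tsum_mul_measure_le [IsFiniteMeasure μ] (hΩ : IsOpen Ω) {ι : Type*} {c : ι → ℝ≥0∞}
    (hc : ∀ i, c i ≠ ⊤)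
    {B : ι → Set (Euc n)} (hB : ∀ i, MeasurableSet (B i)) (hBΩ : ∀ i, B i ⊆ Ω)
    (hdisj : Pairwise (Function.onFun Disjoint B))
    (h : ∀ i C U, IsCompact C → C ⊆ B i → IsOpen U → C ⊆ U → U ⊆ Ω →
      c i * μ C ≤ liminfKappa n F U) :
    ∑' i, c i * μ (B i) ≤ liminfKappa n F Ω := by
  rw [ENNReal.tsum_eq_iSup_sum]
  refine iSup_le fun I => ?_
  have hk : ∀ k : ℕ, ∑ i ∈ I, c i * μ (B i) ≤
      liminfKappa n F Ω + (∑ i ∈ I, c i) * (k + 1 : ℝ≥0∞)⁻¹ := by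
    intro k
    choose C hCB hC hμ using fun i => (hB i).exists_isCompact_lt_add (measure_ne_top μ (B i))
      (ε := (k + 1 : ℝ≥0∞)⁻¹) (by simp)
    calc ∑ i ∈ I, c i * μ (B i) ≤ ∑ i ∈ I, (c i * μ (C i) + c i * (k + 1 : ℝ≥0∞)⁻¹) := by
          gcongr with i
          rw [← mul_add]
          gcongr
          exact (hμ i).le
      _ = ∑ i ∈ I, c i * μ (C i) + (∑ i ∈ I, c i) * (k + 1 : ℝ≥0∞)⁻¹ := by
          rw [Finset.sum_add_distrib, Finset.sum_mul]
      _ ≤ _ := by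
          gcongr
          exact sum_mul_measure_le_of_isCompact I (fun i _ => hC i)
            (fun i _ j _ hij => (hdisj hij).mono (hCB i) (hCB j))
            (fun i _ U hU hCU hUΩ => h i (C i) U (hC i) (hCB i) hU hCU hUΩ) hΩ
            (fun i _ => (hCB i).trans (hBΩ i)) subset_rfl
  have hlim : Tendsto (fun k : ℕ => liminfKappa n F Ω + (∑ i ∈ I, c i) * (k + 1 : ℝ≥0∞)⁻¹) atTop
      (𝓝 (liminfKappa n F Ω + (∑ i ∈ I, c i) * 0)) := by
    refine Tendsto.add tendsto_const_nhds (ENNReal.Tendsto.const_mul ?_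
      (Or.inr (ENNReal.sum_ne_top.2 fun i _ => hc i)))
    have := (tendsto_add_atTop_iff_nat 1).2 ENNReal.tendsto_inv_nat_nhds_zero
    simpa using this
  rw [mul_zero, add_zero] at hlim
  exact ge_of_tendsto' hlim hk

lemma mul_measure_iUnion_add_le [IsFiniteMeasure μ] (hΩ : IsOpen Ω) {c d : ℝ≥0∞} (hc : c ≠ ⊤)
    (hd : d ≠ ⊤) {ι κ : Type*} [Countable ι] [Countable κ] {B : ι → Set (Euc n)}
    {D : κ → Set (Euc n)}
    (hB : ∀ i, MeasurableSet (B i)) (hBΩ : ∀ i, B i ⊆ Ω)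
    (hD : ∀ i, MeasurableSet (D i)) (hDΩ : ∀ i, D i ⊆ Ω)
    (h₁ : ∀ i C U, IsCompact C → C ⊆ B i → IsOpen U → C ⊆ U → U ⊆ Ω →
      c * μ C ≤ liminfKappa n F U)
    (h₂ : ∀ i C U, IsCompact C → C ⊆ D i → IsOpen U → C ⊆ U → U ⊆ Ω →
      d * μ C ≤ liminfKappa n F U) :
    c * μ (⋃ i, B i) + d * μ ((⋃ i, D i) \ ⋃ i, B i) ≤ liminfKappa n F Ω := by
  have := Encodable.ofCountable ι
  have := Encodable.ofCountable κ
  set B' : ℕ → Set (Euc n) := fun k => ⋃ i ∈ Encodable.decode₂ ι k, B i with hB'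
  set D' : ℕ → Set (Euc n) := fun k => ⋃ i ∈ Encodable.decode₂ κ k, D i with hD'
  have b1 : ∀ k, MeasurableSet (B' k) := fun k =>
    Encodable.iUnion_decode₂_cases (C := MeasurableSet) MeasurableSet.empty hB
  have b2 : ∀ k, MeasurableSet (D' k) := fun k =>
    Encodable.iUnion_decode₂_cases (C := MeasurableSet) MeasurableSet.empty hD
  have hJ : MeasurableSet (⋃ i, B i) := MeasurableSet.iUnion hB
  have hemp : ∀ {c : ℝ≥0∞} C U, C ⊆ (∅ : Set (Euc n)) → c * μ C ≤ liminfKappa n F U := by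
    intro c C U hC
    rw [Set.subset_empty_iff.1 hC, measure_empty, mul_zero]
    exact zero_le
  have p1 : ∀ k C U, IsCompact C → C ⊆ B' k → IsOpen U → C ⊆ U → U ⊆ Ω →
      c * μ C ≤ liminfKappa n F U := fun k =>
    Encodable.iUnion_decode₂_cases (C := fun S => ∀ C U, IsCompact C → C ⊆ S → IsOpen U → C ⊆ U →
      U ⊆ Ω → c * μ C ≤ liminfKappa n F U) (fun C U _ h _ _ _ => hemp C U h) h₁
  have p2 : ∀ k C U, IsCompact C → C ⊆ D' k → IsOpen U → C ⊆ U → U ⊆ Ω →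
      d * μ C ≤ liminfKappa n F U := fun k =>
    Encodable.iUnion_decode₂_cases (C := fun S => ∀ C U, IsCompact C → C ⊆ S → IsOpen U → C ⊆ U →
      U ⊆ Ω → d * μ C ≤ liminfKappa n F U) (fun C U _ h _ _ _ => hemp C U h) h₂
  have q1 : ∀ k, B' k ⊆ ⋃ i, B i := fun k => Set.iUnion₂_subset fun i _ => Set.subset_iUnion B i
  have q2 : ∀ k, D' k ⊆ ⋃ i, D i := fun k => Set.iUnion₂_subset fun i _ => Set.subset_iUnion D i
  set E : ℕ ⊕ ℕ → Set (Euc n) :=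
    Sum.elim (disjointed B') (fun k => disjointed D' k \ ⋃ i, B i) with hE
  have hEdisj : Pairwise (Function.onFun Disjoint E) := by
    have hx : ∀ k l, Disjoint (disjointed B' k) (disjointed D' l \ ⋃ i, B i) := fun k l =>
      (Set.disjoint_sdiff_left.mono_right ((disjointed_subset B' k).trans (q1 k))).symm
    rintro (k | k) (l | l) hkl
    · exact disjoint_disjointed B' fun h => hkl (congrArg _ h)
    · exact hx k l
    · exact (hx l k).symm
    · exact (disjoint_disjointed D' fun h => hkl (congrArg _ h)).mono Set.sdiff_subset
        Set.sdiff_subset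
  have key := tsum_mul_measure_le (μ := μ) (F := F) (B := E)
    (c := Sum.elim (fun _ => c) fun _ => d) hΩ ?_ ?_ ?_ hEdisj ?_
  · rw [ENNReal.summable.tsum_sum ENNReal.summable] at key
    simp only [hE, Sum.elim_inl, Sum.elim_inr, ENNReal.tsum_mul_left] at key
    rw [← measure_iUnion (disjoint_disjointed B') (MeasurableSet.disjointed b1),
      ← measure_iUnion (fun k l hkl => (disjoint_disjointed D' hkl).mono Set.sdiff_subset
        Set.sdiff_subset) (fun k => (MeasurableSet.disjointed b2 k).diff hJ), ← Set.iUnion_sdiff,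
      iUnion_disjointed, iUnion_disjointed, hB', hD', Encodable.iUnion_decode₂,
      Encodable.iUnion_decode₂] at key
    exact key
  · rintro (k | k)
    exacts [hc, hd]
  · rintro (k | k)
    exacts [MeasurableSet.disjointed b1 k, (MeasurableSet.disjointed b2 k).diff hJ]
  · rintro (k | k)
    exacts [(disjointed_subset B' k).trans ((q1 k).trans (Set.iUnion_subset hBΩ)),
      Set.sdiff_subset.trans ((disjointed_subset D' k).trans ((q2 k).trans (Set.iUnion_subset hDΩ)))]
  · rintro (k | k) C U hC hCE
    exacts [p1 k C U hC (hCE.trans (disjointed_subset B' k)),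
      p2 k C U hC (hCE.trans (Set.sdiff_subset.trans (disjointed_subset D' k)))]

end Merge

section Cover

variable {n : ℕ} {f g : Euc n → ℝ} {Ω : Set (Euc n)} {ν ν' x : Euc n} {a b a' b' η r₀ r s τ : ℝ}
  {T : Euc n ≃ₗᵢ[ℝ] Euc n} {i₀ : Fin n}

lemma volume_ball_le (x : Euc n) (hr : 0 < r) : volume (ball x r) ≤ ENNReal.ofReal ((2 * r) ^ n) := by
  rw [← volume_rotCube (LinearIsometryEquiv.refl ℝ (Euc n)) x (show 0 < 2 * r by positivity)]
  refine measure_mono fun y hy i => ?_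
  have h1 : |(y - x) i| ≤ ‖y - x‖ := PiLp.norm_apply_le (y - x) i
  rw [mem_ball, dist_eq_norm] at hy
  have : (LinearIsometryEquiv.refl ℝ (Euc n)).symm (y - x) i = (y - x) i := rfl
  rw [this]
  linarith

lemma setLIntegral_le_of_setAverage_le {S : Set (Euc n)} {c : ℝ} (hr : 0 < r) (hS : S ⊆ ball x r)
    (hf : IntegrableOn f (ball x r)) (hτ : 0 ≤ τ) (h : ⨍ y in S, |f y - c| ≤ τ) :
    ∫⁻ y in S, ENNReal.ofReal |f y - c| ≤ ENNReal.ofReal (τ * (2 * r) ^ n) := by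
  have hfin : volume S ≠ ⊤ := ((measure_mono hS).trans_lt measure_ball_lt_top).ne
  have hi : IntegrableOn (fun y => |f y - c|) S :=
    ((hf.mono_set hS).sub (integrableOn_const hfin)).abs
  rw [← ofReal_integral_eq_lintegral_ofReal hi (Eventually.of_forall fun y => abs_nonneg _),
    ← measure_smul_setAverage _ hfin, smul_eq_mul, mul_comm]
  refine ENNReal.ofReal_le_ofReal ?_
  gcongr
  exact ENNReal.toReal_le_of_le_ofReal (by positivity)
    ((measure_mono hS).trans (volume_ball_le x hr))

lemma eventually_ball_subset_and_integrableOn (hΩ : IsOpen Ω) (hf : LocallyIntegrableOn f Ω) (hx : x ∈ Ω) :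
    ∀ᶠ r in 𝓝[>] (0 : ℝ), ball x r ⊆ Ω ∧ IntegrableOn f (ball x r) := by
  obtain ⟨ρ, hρ, h⟩ := nhds_basis_closedBall.mem_iff.1 (hΩ.mem_nhds hx)
  filter_upwards [nhdsWithin_le_nhds (Iio_mem_nhds hρ)] with r hr
  have h1 : ball x r ⊆ closedBall x ρ := ball_subset_closedBall.trans
    (closedBall_subset_closedBall (le_of_lt hr))
  exact ⟨h1.trans h, (hf.integrableOn_compact_subset h (isCompact_closedBall x ρ)).mono_set h1⟩

lemma eventually_lintegral_sub_le_of_tendsto (hΩ : IsOpen Ω) (hf : LocallyIntegrableOn f Ω)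
    (hx : x ∈ Ω) (hg : ∀ᵐ y ∂volume.restrict Ω, g y = f y) {c : ℝ} (hτ : 0 < τ)
    (h : Tendsto (fun r : ℝ => ⨍ y in ball x r, |f y - c| ∂volume) (𝓝[>] 0) (𝓝 0)) :
    ∀ᶠ r in 𝓝[>] (0 : ℝ), ∫⁻ y in ball x r, ENNReal.ofReal |g y - c| ≤
      ENNReal.ofReal (τ * (2 * r) ^ n) := by
  filter_upwards [eventually_ball_subset_and_integrableOn hΩ hf hx, h.eventually (ge_mem_nhds hτ),
    self_mem_nhdsWithin] with r h1 h2 hr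
  refine (lintegral_congr_ae ?_).trans_le
    (setLIntegral_le_of_setAverage_le hr subset_rfl h1.2 hτ.le h2)
  filter_upwards [ae_restrict_of_ae_restrict_of_subset h1.1 hg] with y hy
  rw [hy]

lemma eventually_lintegral_sub_stepFun_le (hT : T (EuclideanSpace.single i₀ 1) = ν)
    (hΩ : IsOpen Ω) (hf : LocallyIntegrableOn f Ω)
    (hx : x ∈ Ω) (hg : ∀ᵐ y ∂volume.restrict Ω, g y = f y) (hτ : 0 < τ)
    (ha : Tendsto (fun r : ℝ => ⨍ y in {y ∈ ball x r | 0 < ⟪y - x, ν⟫}, |f y - a| ∂volume)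
      (𝓝[>] 0) (𝓝 0))
    (hb : Tendsto (fun r : ℝ => ⨍ y in {y ∈ ball x r | ⟪y - x, ν⟫ < 0}, |f y - b| ∂volume)
      (𝓝[>] 0) (𝓝 0)) :
    ∀ᶠ r in 𝓝[>] (0 : ℝ), ∫⁻ y in ball x r, ENNReal.ofReal |g y - stepFun ν a b x y| ≤
      ENNReal.ofReal (τ * (2 * r) ^ n) := by
  filter_upwards [eventually_ball_subset_and_integrableOn hΩ hf hx, ha.eventually (ge_mem_nhds (half_pos hτ)),
    hb.eventually (ge_mem_nhds (half_pos hτ)), self_mem_nhdsWithin] with r h1 h2 h3 hr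
  have hr : 0 < r := hr
  have e1 := setLIntegral_le_of_setAverage_le hr (fun y hy => hy.1) h1.2 (half_pos hτ).le h2
  have e2 := setLIntegral_le_of_setAverage_le hr (fun y hy => hy.1) h1.2 (half_pos hτ).le h3
  set P := {y ∈ ball x r | 0 < ⟪y - x, ν⟫} with hP
  set N := {y ∈ ball x r | ⟪y - x, ν⟫ < 0} with hN
  set Z := {y ∈ ball x r | ⟪y - x, ν⟫ = 0} with hZ
  have hc : Continuous fun y : Euc n => ⟪y - x, ν⟫ := by fun_prop
  have hPm : MeasurableSet P := measurableSet_ball.inter (isOpen_lt continuous_const hc).measurableSet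
  have hNm : MeasurableSet N := measurableSet_ball.inter (isOpen_lt hc continuous_const).measurableSet
  have hZ0 : volume Z = 0 := by
    refine le_antisymm (ge_of_tendsto (f := fun t : ℝ => ENNReal.ofReal ((2 * r) ^ (n - 1) * t))
      (x := 𝓝[>] 0) ?_ ?_) bot_le
    · have : Continuous fun t : ℝ => ENNReal.ofReal ((2 * r) ^ (n - 1) * t) :=
        ENNReal.continuous_ofReal.comp (by fun_prop)
      have := (this.tendsto 0).mono_left (nhdsWithin_le_nhds (s := Set.Ioi 0))
      simpa using this
    · filter_upwards [self_mem_nhdsWithin] with t ht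
      have := volume_slab_le T i₀ x (r := 2 * r) (α := -t) (β := 0) (by positivity)
      rw [zero_sub, neg_neg] at this
      refine (measure_mono ?_).trans this
      rintro y ⟨hy1, hy2⟩
      refine ⟨fun i => ?_, ?_⟩
      · rw [mem_ball, dist_eq_norm, ← T.symm.norm_map] at hy1
        have : |T.symm (y - x) i| ≤ _ := PiLp.norm_apply_le (T.symm (y - x)) i
        linarith
      · rw [← inner_eq_symm_apply hT, hy2]
        exact ⟨neg_lt_zero.2 ht, le_rfl⟩
  have hball : ball x r ⊆ (P ∪ N) ∪ Z := by
    intro y hy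
    rcases lt_trichotomy 0 ⟪y - x, ν⟫ with h | h | h
    · exact Or.inl (Or.inl ⟨hy, h⟩)
    · exact Or.inr ⟨hy, h.symm⟩
    · exact Or.inl (Or.inr ⟨hy, h⟩)
  have hgf : ∀ S ⊆ ball x r, ∀ᵐ y ∂volume.restrict S, g y = f y := fun S hS =>
    ae_restrict_of_ae_restrict_of_subset (hS.trans h1.1) hg
  have i1 : ∫⁻ y in P, ENNReal.ofReal |g y - stepFun ν a b x y| ≤
      ENNReal.ofReal (τ / 2 * (2 * r) ^ n) := by
    refine (lintegral_congr_ae ?_).trans_le e1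
    filter_upwards [hgf P fun y hy => hy.1, ae_restrict_mem hPm] with y hy hyP
    rw [hy, stepFun, if_pos hyP.2]
  have i2 : ∫⁻ y in N, ENNReal.ofReal |g y - stepFun ν a b x y| ≤
      ENNReal.ofReal (τ / 2 * (2 * r) ^ n) := by
    refine (lintegral_congr_ae ?_).trans_le e2
    filter_upwards [hgf N fun y hy => hy.1, ae_restrict_mem hNm] with y hy hyN
    rw [hy, stepFun, if_neg hyN.2.not_gt]
  refine (lintegral_mono_set hball).trans ((lintegral_union_le _ _ _).trans ?_)
  rw [setLIntegral_measure_zero Z _ hZ0, add_zero]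
  refine (lintegral_union_le _ _ _).trans ((add_le_add i1 i2).trans (le_of_eq ?_))
  rw [← ENNReal.ofReal_add (by positivity) (by positivity)]
  congr 1
  ring

lemma lintegral_stepFun_sub_stepFun_le (hT : T (EuclideanSpace.single i₀ 1) = ν) (x : Euc n)
    (hr : 0 < r) (hν : ‖ν - ν'‖ ≤ τ) (ha : |a - a'| ≤ τ) (hb : |b - b'| ≤ τ) :
    ∫⁻ y in ball x r, ENNReal.ofReal |stepFun ν a b x y - stepFun ν' a' b' x y| ≤
      ENNReal.ofReal ((1 + |a - b|) * τ * (2 * r) ^ n) := by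
  have hτ : 0 ≤ τ := (norm_nonneg _).trans hν
  set S := {y | (∀ i, |T.symm (y - x) i| < 2 * r / 2) ∧
    T.symm (y - x) i₀ ∈ Set.Ioc (-(r * τ)) (r * τ)} with hS
  have hSv := volume_slab_le T i₀ x (r := 2 * r) (α := -(r * τ)) (β := r * τ) (by positivity)
  have hSm : MeasurableSet S := by
    have hc : ∀ i, Continuous fun y : Euc n => T.symm (y - x) i := fun i => by fun_prop
    rw [hS, Set.ofPred_and, Set.ofPred_forall]
    exact (MeasurableSet.iInter fun i => (isOpen_lt (hc i).abs continuous_const).measurableSet).inter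
      ((hc i₀).measurable measurableSet_Ioc)
  have hpt : ∀ y ∈ ball x r, ENNReal.ofReal |stepFun ν a b x y - stepFun ν' a' b' x y| ≤
      ENNReal.ofReal τ + S.indicator (fun _ => ENNReal.ofReal |a - b|) y := by
    intro y hy
    rw [mem_ball, dist_eq_norm] at hy
    have hin : |⟪y - x, ν⟫ - ⟪y - x, ν'⟫| ≤ r * τ := by
      rw [← inner_sub_right]
      exact (abs_real_inner_le_norm _ _).trans (mul_le_mul hy.le hν (norm_nonneg _) hr.le)
    rw [abs_le] at hin
    have hmem : T.symm (y - x) i₀ ∈ Set.Ioc (-(r * τ)) (r * τ) → y ∈ S := by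
      refine fun h => ⟨fun i => ?_, h⟩
      have : |T.symm (y - x) i| ≤ _ := PiLp.norm_apply_le (T.symm (y - x)) i
      rw [T.symm.norm_map] at this
      linarith
    rw [← inner_eq_symm_apply hT] at hmem
    have hsum : ∀ {t : ℝ}, y ∈ S → t ≤ τ + |a - b| → ENNReal.ofReal t ≤
        ENNReal.ofReal τ + S.indicator (fun _ => ENNReal.ofReal |a - b|) y := by
      intro t hy ht
      rw [Set.indicator_of_mem hy, ← ENNReal.ofReal_add hτ (abs_nonneg _)]
      exact ENNReal.ofReal_le_ofReal ht
    unfold stepFun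
    split_ifs with h1 h2 h2
    · exact (ENNReal.ofReal_le_ofReal ha).trans le_self_add
    · refine hsum (hmem ⟨?_, ?_⟩) ?_
      · linarith [mul_nonneg hr.le hτ]
      · linarith
      · linarith [abs_sub_le a b b']
    · refine hsum (hmem ⟨?_, ?_⟩) ?_
      · linarith
      · linarith [mul_nonneg hr.le hτ]
      · rw [abs_sub_comm a b]
        linarith [abs_sub_le b a a']
    · exact (ENNReal.ofReal_le_ofReal hb).trans le_self_add
  refine (setLIntegral_mono' measurableSet_ball hpt).trans ?_
  rw [lintegral_add_left measurable_const, setLIntegral_const]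
  have h1 : ∫⁻ y in ball x r, S.indicator (fun _ => ENNReal.ofReal |a - b|) y ≤
      ENNReal.ofReal |a - b| * volume S := by
    rw [← setLIntegral_const, ← lintegral_indicator hSm]
    exact setLIntegral_le_lintegral _ _
  refine (add_le_add (mul_le_mul_right (volume_ball_le x hr) _)
    (h1.trans (mul_le_mul_right hSv _))).trans (le_of_eq ?_)
  rw [← ENNReal.ofReal_mul hτ, ← ENNReal.ofReal_mul (abs_nonneg _),
    ← ENNReal.ofReal_add (by positivity)]
  · congr 1
    have h2 : (2 * r) ^ n = (2 * r) ^ (n - 1) * (2 * r) := by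
      rw [← pow_succ, Nat.sub_add_cancel (Nat.one_le_iff_ne_zero.2 i₀.pos.ne')]
    rw [h2]
    ring
  · have : 0 ≤ r * τ - -(r * τ) := by linarith [mul_nonneg hr.le hτ]
    positivity

/-- Every jump point belongs to a blow-up set with data in a given dense set. -/
lemma exists_mem_blowupSet_of_mem_jumpSet (hn : 1 ≤ n) (hΩ : IsOpen Ω)
    (hf : LocallyIntegrableOn f Ω) (hg : ∀ᵐ y ∂volume.restrict Ω, g y = f y) (hη : 0 < η)
    {D : Set (sphere (0 : Euc n) 1)} (hD : Dense D) (hx : x ∈ Ω) (hxJ : x ∈ jumpSet n f) :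
    ∃ ν ∈ D, ∃ (a b : ℚ) (k : ℕ), (a : ℝ) ≠ b ∧
      x ∈ blowupSet g (ν : Euc n) a b η (1 / (k + 1)) := by
  obtain ⟨ν, hν, a, b, hab, ha, hb⟩ := hxJ
  obtain ⟨T, hT⟩ := exists_linearIsometryEquiv_apply_single ⟨0, hn⟩ hν
  have hA : 0 < |a - b| := abs_pos.2 (sub_ne_zero.2 hab)
  obtain ⟨τ, ⟨ht1, ht2⟩, hτ⟩ : ∃ τ : ℝ, (2 * τ ≤ |a - b| / 2 ∧
      (2 + |a - b|) * τ * 2 ^ n ≤ η * (|a - b| / 2)) ∧ 0 < τ := by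
    have c1 : Continuous fun τ : ℝ => 2 * τ := by fun_prop
    have c2 : Continuous fun τ : ℝ => (2 + |a - b|) * τ * 2 ^ n := by fun_prop
    have e1 : ∀ᶠ τ in 𝓝 (0 : ℝ), 2 * τ ≤ |a - b| / 2 :=
      (c1.tendsto 0).eventually (ge_mem_nhds (by rw [mul_zero]; positivity))
    have e2 : ∀ᶠ τ in 𝓝 (0 : ℝ), (2 + |a - b|) * τ * 2 ^ n ≤ η * (|a - b| / 2) :=
      (c2.tendsto 0).eventually (ge_mem_nhds (by rw [mul_zero, zero_mul]; positivity))
    exact (((e1.and e2).filter_mono nhdsWithin_le_nhds).and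
      (self_mem_nhdsWithin (s := Set.Ioi (0 : ℝ)))).exists
  obtain ⟨ν', hν'D, hν'⟩ := hD.exists_dist_lt ⟨ν, by simpa using hν⟩ hτ
  obtain ⟨a', ha'⟩ := Rat.denseRange_cast.exists_dist_lt a hτ
  obtain ⟨b', hb'⟩ := Rat.denseRange_cast.exists_dist_lt b hτ
  rw [Real.dist_eq] at ha' hb'
  rw [Subtype.dist_eq, dist_eq_norm] at hν'
  have hA' : |a - b| / 2 ≤ |(a' : ℝ) - b'| := by
    have h1 := abs_sub_le a (a' : ℝ) b
    have h2 := abs_sub_le (a' : ℝ) (b' : ℝ) b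
    rw [abs_sub_comm (b' : ℝ) b] at h2
    linarith
  have hev := eventually_lintegral_sub_stepFun_le hT hΩ hf hx hg hτ ha hb
  obtain ⟨ρ, hρ, hev⟩ := (nhdsGT_basis (0 : ℝ)).eventually_iff.1 hev
  obtain ⟨k, hk⟩ := exists_nat_one_div_lt hρ
  refine ⟨ν', hν'D, a', b', k, fun h => ?_, fun q hq hqk => ?_⟩
  · rw [h, sub_self, abs_zero] at hA'
    linarith
  have h1 := hev (x := (q : ℝ)) ⟨hq, hqk.trans hk⟩
  have h2 := lintegral_stepFun_sub_stepFun_le hT x hq hν'.le ha'.le hb'.le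
  have hm : Measurable fun y =>
      ENNReal.ofReal |stepFun ν a b x y - stepFun (ν' : Euc n) a' b' x y| :=
    (continuous_abs.measurable.comp
      ((measurable_stepFun ν a b x).sub (measurable_stepFun (ν' : Euc n) a' b' x))).ennreal_ofReal
  calc ∫⁻ y in ball x q, ENNReal.ofReal |g y - stepFun (ν' : Euc n) a' b' x y|
      ≤ ∫⁻ y in ball x q, (ENNReal.ofReal |g y - stepFun ν a b x y| +
          ENNReal.ofReal |stepFun ν a b x y - stepFun (ν' : Euc n) a' b' x y|) := by
        refine lintegral_mono fun y => ?_
        rw [← ENNReal.ofReal_add (abs_nonneg _) (abs_nonneg _)]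
        exact ENNReal.ofReal_le_ofReal (abs_sub_le _ _ _)
    _ ≤ ENNReal.ofReal (τ * (2 * q) ^ n) + ENNReal.ofReal ((1 + |a - b|) * τ * (2 * q) ^ n) := by
        rw [lintegral_add_right _ hm]
        exact add_le_add h1 h2
    _ = ENNReal.ofReal ((2 + |a - b|) * τ * 2 ^ n * q ^ n) := by
        rw [← ENNReal.ofReal_add (by positivity) (by positivity), mul_pow]
        congr 1
        ring
    _ ≤ ENNReal.ofReal (η * |(a' : ℝ) - b'| * q ^ n) := by
        refine ENNReal.ofReal_le_ofReal (mul_le_mul_of_nonneg_right (ht2.trans ?_) (by positivity))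
        exact mul_le_mul_of_nonneg_left hA' hη.le

/-- Blow-up sets consist of approximate discontinuity points. -/
lemma mem_approxDiscontSet_of_mem_blowupSet (i₀ : Fin n) (hν : ‖ν‖ = 1) (hab : a ≠ b)
    (hΩ : IsOpen Ω) (hf : LocallyIntegrableOn f Ω) (hgm : Measurable g)
    (hg : ∀ᵐ y ∂volume.restrict Ω, g y = f y) (hη : 0 ≤ η) (hη' : η * (2 * (4 * n)) ^ n ≤ 1 / 8)
    (hr₀ : 0 < r₀) (hxΩ : x ∈ Ω) (hx : x ∈ blowupSet g ν a b η r₀) :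
    x ∈ approxDiscontSet n f := by
  rintro ⟨c, hc⟩
  have hn : (1 : ℝ) ≤ n := by
    have := i₀.pos
    exact_mod_cast this
  obtain ⟨T, hT⟩ := exists_linearIsometryEquiv_apply_single i₀ hν
  have hA : 0 < |a - b| := abs_pos.2 (sub_ne_zero.2 hab)
  set τ := |a - b| / (8 * (2 * (4 * n)) ^ n) with hτ
  have hτ0 : 0 < τ := by positivity
  have c1 : Tendsto (fun ε : ℝ => 4 * n * ε) (𝓝[>] 0) (𝓝[>] 0) := by
    refine tendsto_nhdsWithin_iff.2 ⟨?_, ?_⟩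
    · have : Continuous fun ε : ℝ => 4 * n * ε := by fun_prop
      have := (this.tendsto 0).mono_left (nhdsWithin_le_nhds (s := Set.Ioi 0))
      rwa [mul_zero] at this
    · filter_upwards [self_mem_nhdsWithin] with ε hε
      have hε : 0 < ε := hε
      exact Set.mem_Ioi.2 (by positivity)
  obtain ⟨ε, ⟨h1, h2⟩, hε⟩ := (((c1.eventually
    (eventually_lintegral_sub_le_of_tendsto hΩ hf hxΩ hg hτ0 hc)).and
    (c1.eventually (nhdsWithin_le_nhds (gt_mem_nhds hr₀)))).and
      (self_mem_nhdsWithin (s := Set.Ioi (0 : ℝ)))).exists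
  have hε : 0 < ε := hε
  have hQ : rotCube T ε x ⊆ ball x (4 * n * ε) := by
    refine (rotCube_subset_closedBall T x hε).trans (closedBall_subset_ball ?_)
    have : 0 < n * ε := by positivity
    linarith
  obtain ⟨e1, e2⟩ := abs_cubeCoef_sub_le_of_mem_blowupSet hT hgm hx hη hε (by positivity) h2
    (c := x) (by rw [sub_self, inner_zero_left]) hQ
  have e3 := abs_cubeCoef_sub_le (g₂ := stepFun ν c c x) i₀ T e1
    ((integrableOn_rotCube_iff T x hε _).1 (integrableOn_stepFun ν c c x
      (by rw [volume_rotCube T x hε]; exact ENNReal.ofReal_ne_top)))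
  rw [cubeCoef_stepFun hT c c hε (by rw [sub_self, inner_zero_left]), sub_self, zero_div,
    sub_zero] at e3
  have hstep : stepFun ν c c x = fun _ => c := by
    funext y
    exact ite_self c
  have e4 : ∫ y in rotCube T ε x, |g y - c| ≤ τ * (2 * (4 * n * ε)) ^ n := by
    have hm : Measurable fun y => |g y - c| :=
      continuous_abs.measurable.comp (hgm.sub measurable_const)
    rw [integral_eq_lintegral_of_nonneg_ae (Eventually.of_forall fun y => abs_nonneg _)
      hm.aestronglyMeasurable]
    exact ENNReal.toReal_le_of_le_ofReal (by positivity) ((lintegral_mono_set hQ).trans h1)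
  rw [setIntegral_rotCube T x hε] at e4
  have e5 : ∫ u in unitCube n, |g (cubeMap T ε x u) - stepFun ν c c x (cubeMap T ε x u)| ≤
      |a - b| / 8 := by
    rw [hstep]
    refine le_of_mul_le_mul_left (e4.trans (le_of_eq ?_)) (pow_pos hε n)
    have : (2 * (4 * (n : ℝ) * ε)) ^ n = (2 * (4 * n)) ^ n * ε ^ n := by
      rw [← mul_pow]
      ring
    rw [this, hτ]
    field_simp
  have e6 := abs_sub_abs_le_abs_sub ((a - b) / 2) (cubeCoef i₀ T ε g x)
  rw [abs_sub_comm ((a - b) / 2) (cubeCoef i₀ T ε g x), abs_div, abs_two] at e6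
  nlinarith

end Cover

section Final

variable {n : ℕ} {F : ℝ → Euc n → ℝ} {f g : Euc n → ℝ} {Ω : Set (Euc n)} {μ : Measure (Euc n)}
  {σ : Euc n → Euc n} {s : ℝ}

lemma LocUnifConv.congr (H : LocUnifConv n F f Ω) (hg : f =ᵐ[volume.restrict Ω] g) :
    LocUnifConv n F g Ω where
  isOpen := H.isOpen
  locInt := by
    intro x hx
    obtain ⟨t, ht, h⟩ := H.locInt x hx
    refine ⟨t ∩ Ω, inter_mem ht self_mem_nhdsWithin, ?_⟩
    exact (h.mono_set Set.inter_subset_left).congr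
      (ae_restrict_of_ae_restrict_of_subset Set.inter_subset_right hg)
  locInt_approx := H.locInt_approx
  conv K hK hKΩ := by
    refine (H.conv K hK hKΩ).congr fun ε => eLpNorm_congr_ae ?_
    filter_upwards [ae_restrict_of_ae_restrict_of_subset hKΩ hg] with x hx
    rw [hx]

lemma IsVariationPair.congr (h : IsVariationPair n f Ω μ σ) (hg : f =ᵐ[volume.restrict Ω] g) :
    IsVariationPair n g Ω μ σ := by
  refine ⟨h.1, h.2.1, h.2.2.1, h.2.2.2.1, fun Φ a b c => ?_⟩
  rw [← h.2.2.2.2 Φ a b c]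
  refine integral_congr_ae ?_
  filter_upwards [hg] with x hx
  rw [hx]

lemma one_sub_le_inner_of_dist_lt {v w : Euc n} (hw : ‖w‖ = 1) (h : dist w v < s) :
    1 - s ≤ ⟪v, w⟫ := by
  have h1 : ⟪v, w⟫ = 1 - ⟪w - v, w⟫ := by
    rw [inner_sub_left, real_inner_self_eq_norm_sq, hw]
    ring
  have h2 : ⟪w - v, w⟫ ≤ ‖w - v‖ * ‖w‖ := real_inner_le_norm _ _
  rw [hw, mul_one, ← dist_eq_norm] at h2
  linarith

/-- The lower bound with separate constants on a set squeezed between the jump set and the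
approximate discontinuity set. -/
lemma exists_jump_diffuse_le (hn : 1 ≤ n) (H : LocUnifConv n F f Ω)
    (hp : IsVariationPair n f Ω μ σ) (hs : 0 < s) (hs' : s ≤ 1 / 8) :
    ∃ J : Set (Euc n), MeasurableSet J ∧ J ⊆ Ω ∧ J ⊆ approxDiscontSet n f ∧
      (∀ᵐ x ∂μ, x ∈ jumpSet n f ∩ Ω → x ∈ J) ∧
      ENNReal.ofReal (1 / 2 - 3 * s) * μ J + ENNReal.ofReal (1 / 4 * (1 - s)) * μ (Ω \ J) ≤
        liminfKappa n F Ω := by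
  have hΩ := H.isOpen
  have := hp.1
  obtain ⟨σ', hσm, hp'⟩ := hp.exists_stronglyMeasurable
  obtain ⟨g, hgm, hg⟩ : ∃ g : Euc n → ℝ, Measurable g ∧ f =ᵐ[volume.restrict Ω] g :=
    ⟨_, H.locInt.aestronglyMeasurable.stronglyMeasurable_mk.measurable,
      H.locInt.aestronglyMeasurable.ae_eq_mk⟩
  have hg' : ∀ᵐ y ∂volume.restrict Ω, g y = f y := hg.symm
  have Hg := H.congr hg
  have hpg := hp'.congr hg
  obtain ⟨η, hη, hηs, hjump⟩ := exists_jump_measure_le (n := n) ⟨0, hn⟩ hs hs'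
  obtain ⟨D, hDc, hD⟩ := TopologicalSpace.exists_countable_dense (sphere (0 : Euc n) 1)
  obtain ⟨P, hPc, hP⟩ := TopologicalSpace.exists_countable_dense (Euc n)
  have := hDc.to_subtype
  have := hPc.to_subtype
  have hn0 : (0 : ℝ) < n := by exact_mod_cast hn
  have hnorm : ∀ v : sphere (0 : Euc n) 1, ‖(v : Euc n)‖ = 1 := fun v => by simp
  set S : D → Set (Euc n) := fun v => {x | 1 - s ≤ ⟪((v : sphere (0 : Euc n) 1) : Euc n), σ' x⟫} ∩ Ω
    with hS
  have hSm : ∀ v, MeasurableSet (S v) := fun v =>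
    (measurableSet_le measurable_const
      ((stronglyMeasurable_const.inner hσm).measurable)).inter hΩ.measurableSet
  set ι := (D × {q : ℚ × ℚ // (q.1 : ℝ) ≠ q.2}) × ℕ × D × P
  set B : ι → Set (Euc n) := fun i =>
    blowupSet g ((i.1.1 : sphere (0 : Euc n) 1) : Euc n) i.1.2.1.1 i.1.2.1.2 η (1 / (i.2.1 + 1)) ∩
      (S i.2.2.1 ∩ ball (i.2.2.2 : Euc n) (1 / (20 * n * (i.2.1 + 1)))) with hB
  have hBS : ∀ i, B i ⊆ S i.2.2.1 := fun i =>
    Set.inter_subset_right.trans Set.inter_subset_left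
  have hcov : ∀ x ∈ Ω, ‖σ' x‖ = 1 → ∃ v, x ∈ S v := by
    intro x hx hσ
    obtain ⟨v, hv, hvd⟩ := hD.exists_dist_lt (⟨σ' x, by simpa using hσ⟩ : sphere (0 : Euc n) 1) hs
    exact ⟨⟨v, hv⟩, one_sub_le_inner_of_dist_lt hσ hvd, hx⟩
  have key := mul_measure_iUnion_add_le (μ := μ) (F := F) (c := ENNReal.ofReal (1 / 2 - 3 * s))
    (d := ENNReal.ofReal (1 / 4 * (1 - s))) (B := B) (D := S) hΩ ENNReal.ofReal_ne_top
    ENNReal.ofReal_ne_top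
    (fun i => (measurableSet_blowupSet hgm).inter ((hSm _).inter measurableSet_ball))
    (fun i => (hBS i).trans Set.inter_subset_right) hSm (fun i => Set.inter_subset_right) ?_ ?_
  · refine ⟨⋃ i, B i, MeasurableSet.iUnion fun i =>
      (measurableSet_blowupSet hgm).inter ((hSm _).inter measurableSet_ball),
      Set.iUnion_subset fun i => (hBS i).trans Set.inter_subset_right,
      Set.iUnion_subset fun i x hx => ?_, ?_, ?_⟩
    · exact mem_approxDiscontSet_of_mem_blowupSet ⟨0, hn⟩ (hnorm _) i.1.2.2 hΩ H.locInt hgm hg' hη.le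
        (by linarith) (by positivity) (hBS i hx).2 hx.1
    · filter_upwards [hp'.2.2.2.1] with x hx hxJ
      obtain ⟨ν, hν, a, b, k, hab, hmem⟩ :=
        exists_mem_blowupSet_of_mem_jumpSet hn hΩ H.locInt hg' hη hD hxJ.2 hxJ.1
      obtain ⟨v, hv⟩ := hcov x hxJ.2 hx
      obtain ⟨p, hp, hpx⟩ := hP.exists_dist_lt x (ε := 1 / (20 * n * ((k : ℝ) + 1)))
        (by positivity)
      exact Set.mem_iUnion.2
        ⟨((⟨ν, hν⟩, ⟨(a, b), hab⟩), k, v, ⟨p, hp⟩), hmem, hv, mem_ball.2 hpx⟩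
    · refine le_trans (add_le_add_right (mul_le_mul_right (measure_mono_ae ?_) _) _) key
      filter_upwards [hp'.2.2.2.1] with x hx hxd
      exact ⟨Set.mem_iUnion.2 (hcov x hxd.1 hx), hxd.2⟩
  · intro i C U hC hCB hU hCU hUΩ
    refine hjump Hg hpg hgm (hnorm i.1.1) i.1.2.2 (hnorm i.2.2.1) hC
      (hCB.trans Set.inter_subset_left) (fun x hx x' hx' => ?_) (by positivity) hU hCU hUΩ
      fun x hx => (hBS i (hCB hx)).1
    have h1 := mem_ball.1 (hCB hx).2.2
    have h2 := mem_ball.1 (hCB hx').2.2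
    have h3 := dist_triangle_right x x' (i.2.2.2 : Euc n)
    calc 10 * n * dist x x'
        < 10 * n * (1 / (20 * n * (i.2.1 + 1)) + 1 / (20 * n * (i.2.1 + 1))) := by
          gcongr
          linarith
      _ = 1 / (i.2.1 + 1) := by
          field_simp
          norm_num
  · intro i C U hC hCB hU hCU hUΩ
    exact hpg.quarter_measure_le Hg ⟨0, hn⟩ (hnorm i) hC hU hCU hUΩ (by linarith)
      fun x hx => (hCB hx).1

lemma lower_bound_of_pos (hn : 1 ≤ n) (H : LocUnifConv n F f Ω)
    (hp : IsVariationPair n f Ω μ σ) (hs : 0 < s) (hs' : s ≤ 1 / 12) :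
    volume.withDensity (μ.rnDeriv volume) Ω * ENNReal.ofReal (1 / 4 * (1 - s)) +
      μ.singularPart volume (Ω \ approxDiscontSet n f) * ENNReal.ofReal (1 / 4 * (1 - s)) +
      μ.singularPart volume (jumpSet n f ∩ Ω) * ENNReal.ofReal (1 / 2 - 3 * s) ≤
      liminfKappa n F Ω := by
  have := hp.1
  obtain ⟨J, hJ, hJΩ, hJS, hJJ, hle⟩ := exists_jump_diffuse_le hn H hp hs (by linarith)
  refine le_trans ?_ hle
  have hΩJ : MeasurableSet (Ω \ J) := H.isOpen.measurableSet.diff hJ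
  set α := volume.withDensity (μ.rnDeriv volume)
  set β := μ.singularPart volume with hβ
  set c := ENNReal.ofReal (1 / 2 - 3 * s)
  set d := ENNReal.ofReal (1 / 4 * (1 - s))
  have hdc : d ≤ c := ENNReal.ofReal_le_ofReal (by linarith)
  have hμ : ∀ A, μ A = β A + α A := fun A => by
    conv_lhs => rw [← μ.singularPart_add_rnDeriv volume]
    rfl
  have h1 : α Ω = α J + α (Ω \ J) := by
    rw [← measure_inter_add_sdiff Ω hJ, Set.inter_eq_self_of_subset_right hJΩ]
  have h2 : β (Ω \ approxDiscontSet n f) ≤ β (Ω \ J) :=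
    measure_mono (Set.sdiff_subset_sdiff_right hJS)
  have h3 : β (jumpSet n f ∩ Ω) ≤ β J :=
    measure_mono_ae ((Measure.absolutelyContinuous_of_le (Measure.singularPart_le _ _)).ae_le hJJ)
  rw [h1, hμ, hμ]
  calc _ ≤ (α J + α (Ω \ J)) * d + β (Ω \ J) * d + β J * c := by gcongr
    _ = α J * d + (α (Ω \ J) * d + β (Ω \ J) * d + β J * c) := by ring
    _ ≤ α J * c + (α (Ω \ J) * d + β (Ω \ J) * d + β J * c) := by gcongr
    _ = _ := by ring

lemma lower_bound (hn : 1 ≤ n) (H : LocUnifConv n F f Ω) (hp : IsVariationPair n f Ω μ σ) :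
    volume.withDensity (μ.rnDeriv volume) Ω / 4 +
      μ.singularPart volume (Ω \ approxDiscontSet n f) / 4 +
      μ.singularPart volume (jumpSet n f ∩ Ω) / 2 ≤ liminfKappa n F Ω := by
  have hc : ∀ {h : ℝ → ℝ} {l : ℝ} (_ : Continuous h) (_ : h 0 = l⁻¹) (_ : 0 < l) (A : ℝ≥0∞),
      Tendsto (fun s => A * ENNReal.ofReal (h s)) (𝓝[>] 0) (𝓝 (A / ENNReal.ofReal l)) := by
    intro h l hh h0 hl A
    rw [div_eq_mul_inv, ← ENNReal.ofReal_inv_of_pos hl, ← h0]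
    refine ENNReal.Tendsto.const_mul ?_ (Or.inl ?_)
    · exact (ENNReal.tendsto_ofReal hh.continuousAt).mono_left nhdsWithin_le_nhds
    · rw [h0]
      exact (ENNReal.ofReal_pos.2 (inv_pos.2 hl)).ne'
  have h4 := hc (h := fun s => 1 / 4 * (1 - s)) (l := 4) (by fun_prop) (by norm_num) (by norm_num)
  have h2 := hc (h := fun s => 1 / 2 - 3 * s) (l := 2) (by fun_prop) (by norm_num) (by norm_num)
  rw [ENNReal.ofReal_ofNat] at h4 h2
  refine le_of_tendsto (((h4 _).add (h4 _)).add (h2 _)) ?_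
  filter_upwards [Ioc_mem_nhdsGT (show (0 : ℝ) < 1 / 12 by norm_num)] with s hs
  exact lower_bound_of_pos hn H hp hs.1 hs.2

end Final

/-- Lower bound for the `Γ_∞`-limit: if `f_ε − f → 0` in
`L^∞_loc(Ω)`, then
`(1/4)|D^a f|(Ω) + (1/4)|D^c f|(Ω) + (1/2)|D^j f|(Ω) ≤ liminf_{ε→0} κ_ε(f_ε, Ω)`. -/
theorem gammaInfty_lower_bound
    (n : ℕ) (hn : 1 ≤ n)
    (Ω : Set (EuclideanSpace ℝ (Fin n))) (hΩ : IsOpen Ω)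
    (f : EuclideanSpace ℝ (Fin n) → ℝ) (hf : LocallyIntegrableOn f Ω volume)
    (F : ℝ → EuclideanSpace ℝ (Fin n) → ℝ)
    (hFloc : ∀ ε, 0 < ε → LocallyIntegrableOn (F ε) Ω volume)
    (hFmem : ∀ ε, 0 < ε → ∀ K, IsCompact K → K ⊆ Ω →
      eLpNorm (fun x => F ε x - f x) ⊤ (volume.restrict K) < ⊤)
    (hconv : ∀ K, IsCompact K → K ⊆ Ω →
      Tendsto (fun ε => eLpNorm (fun x => F ε x - f x) ⊤ (volume.restrict K))
        (𝓝[>] (0:ℝ)) (𝓝 0)) :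
    absVar n f Ω / 4 + cantorVar n f Ω / 4 + jumpVar n f Ω / 2 ≤
      liminf (fun ε => kappa n ε (F ε) Ω) (𝓝[>] (0:ℝ)) := by
  have H : LocUnifConv n F f Ω := ⟨hΩ, hf, hFloc, hconv⟩
  change _ ≤ liminfKappa n F Ω
  by_cases hfin : liminfKappa n F Ω = ⊤
  · rw [hfin]
    exact le_top
  have h := exists_isVariationPair H hfin
  rw [absVar, cantorVar, jumpVar, dif_pos h, dif_pos h, dif_pos h]
  exact lower_bound hn H h.choose_spec

end
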